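/- For every positive integer D the set 𝓡_D is finite. Moreover, for every ε > 0 there exists a constant C > 0 such that |𝓡_D| ≤ C·D^{1+ε} for all positive integers D, and |𝓡_D| ≥ C⁻¹·D^{1−ε} for all positive integers D with D mod 16 ∉ {0, 7, 12, 15}. -/

import Mathlib

/-- The standard inner product on `ℚ⁴`. -/
def innerQ4 (x y : Fin 4 → ℚ) : ℚ := ∑ i, x i * y i

/-- A vector of `ℚ⁴` lies in `ℤ⁴`. -/
def IsIntVec (x : Fin 4 → ℚ) : Prop := ∀ i, ∃ n : ℤ, x i = n

/-- `(v₁, v₂)` is a `ℤ`-basis of the lattice `L ∩ ℤ⁴`. -/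
def IsZBasisOf (L : Submodule ℚ (Fin 4 → ℚ)) (v₁ v₂ : Fin 4 → ℚ) : Prop :=
  v₁ ∈ L ∧ v₂ ∈ L ∧ IsIntVec v₁ ∧ IsIntVec v₂ ∧ LinearIndependent ℚ ![v₁, v₂] ∧
    ∀ x ∈ L, IsIntVec x → ∃ m n : ℤ, x = (m : ℚ) • v₁ + (n : ℚ) • v₂

/-- The determinant of the Gram matrix of the pair `(v₁, v₂)` with respect to the standard
inner product. -/
def gramDet (v₁ v₂ : Fin 4 → ℚ) : ℚ :=
  innerQ4 v₁ v₁ * innerQ4 v₂ v₂ - innerQ4 v₁ v₂ ^ 2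

/-- The set `𝓡_D` of 2-dimensional `ℚ`-subspaces of `ℚ⁴` of discriminant `D`. -/
def RD (D : ℕ) : Set (Submodule ℚ (Fin 4 → ℚ)) :=
  {L | Module.finrank ℚ L = 2 ∧ ∃ v₁ v₂ : Fin 4 → ℚ, IsZBasisOf L v₁ v₂ ∧ gramDet v₁ v₂ = D}

noncomputable section
open Complex Filter Topology DirichletCharacter

/-- partial sums of a character -/
def chT {q : ℕ} (χ : DirichletCharacter ℂ q) (n : ℕ) : ℂ := ∑ k ∈ Finset.range n, χ ((k + 1 : ℕ) : ZMod q)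

lemma sum_range_zmod {q : ℕ} [NeZero q] (f : ZMod q → ℂ) :
    ∑ i ∈ Finset.range q, f (i : ZMod q) = ∑ a : ZMod q, f a := by
  refine Finset.sum_nbij' (fun i => (i : ZMod q)) (fun a => a.val) ?_ ?_ ?_ ?_ ?_
  · simp
  · intro a _; simpa using ZMod.val_lt a
  · intro i hi; exact ZMod.val_cast_of_lt (by simpa using hi)
  · intro a _; simp
  · simp

lemma chT_add {q : ℕ} [NeZero q] (χ : DirichletCharacter ℂ q) (hχ : χ ≠ 1) (n : ℕ) :
    chT χ (n + q) = chT χ n := by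
  unfold chT
  rw [Finset.sum_range_add]
  have : ∑ x ∈ Finset.range q, χ ((n + x + 1 : ℕ) : ZMod q) = 0 := by
    have h := sum_range_zmod (fun a : ZMod q => χ (((n + 1 : ℕ) : ZMod q) + a))
    have h2 : ∑ a : ZMod q, χ (((n + 1 : ℕ) : ZMod q) + a) = ∑ a : ZMod q, χ a :=
      Fintype.sum_equiv (Equiv.addLeft ((n + 1 : ℕ) : ZMod q)) _ _ (fun a => rfl)
    rw [h2, MulChar.sum_eq_zero_of_ne_one hχ] at h
    rw [← h]
    refine Finset.sum_congr rfl fun x _ => ?_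
    congr 1; push_cast; ring
  rw [this, add_zero]

lemma chT_norm_le_self {q : ℕ} (χ : DirichletCharacter ℂ q) (n : ℕ) : ‖chT χ n‖ ≤ n := by
  unfold chT
  refine (norm_sum_le _ _).trans ?_
  refine (Finset.sum_le_card_nsmul _ _ 1 (fun k _ => norm_le_one χ _)).trans ?_
  simp

lemma chT_norm_le {q : ℕ} [NeZero q] (χ : DirichletCharacter ℂ q) (hχ : χ ≠ 1) (n : ℕ) :
    ‖chT χ n‖ ≤ q := by
  induction n using Nat.strong_induction_on with
  | _ n ih =>
    rcases lt_or_ge n q with h | h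
    · exact (chT_norm_le_self χ n).trans (by exact_mod_cast h.le)
    · obtain ⟨m, rfl⟩ := Nat.exists_eq_add_of_le' h
      rw [chT_add χ hχ]
      exact ih m (by have := NeZero.pos q; omega)

/-- the weights -/
def wt (s : ℂ) (n : ℕ) : ℂ := ((n + 1 : ℕ) : ℂ) ^ (-s)

lemma wt_diff (s : ℂ) (hs : 0 < s.re) (n : ℕ) :
    ‖wt s n - wt s (n + 1)‖ ≤ ‖s‖ * ((n + 1 : ℕ) : ℝ) ^ (-s.re - 1) := by
  have hpos : (0 : ℝ) < ((n + 1 : ℕ) : ℝ) := by positivity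
  have hs0 : -s ≠ 0 := by
    intro h; have := congrArg Complex.re h; simp at this; linarith
  have key := Convex.norm_image_sub_le_of_norm_hasDerivWithin_le (𝕜 := ℝ)
    (f := fun t : ℝ => (t : ℂ) ^ (-s)) (f' := fun t : ℝ => (-s) * (t : ℂ) ^ (-s - 1))
    (s := Set.Icc ((n + 1 : ℕ) : ℝ) ((n + 1 + 1 : ℕ) : ℝ))
    (C := ‖s‖ * ((n + 1 : ℕ) : ℝ) ^ (-s.re - 1)) (x := ((n + 1 + 1 : ℕ) : ℝ)) (y := ((n + 1 : ℕ) : ℝ))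
    ?_ ?_ (convex_Icc _ _) ?_ ?_
  · simp only [wt]
    push_cast at key ⊢
    refine key.trans ?_
    simp
  · intro x hx
    have hx0 : 0 < x := lt_of_lt_of_le hpos hx.1
    exact (hasDerivAt_ofReal_cpow_const hx0.ne' hs0).hasDerivWithinAt
  · intro x hx
    have hx0 : 0 < x := lt_of_lt_of_le hpos hx.1
    rw [norm_mul, norm_neg, Complex.norm_cpow_eq_rpow_re_of_pos hx0]
    gcongr
    simp only [sub_re, neg_re, one_re]
    exact Real.rpow_le_rpow_of_nonpos hpos hx.1 (by linarith)
  · constructor <;> simp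
  · constructor <;> simp

end

noncomputable section
open Complex Filter Topology DirichletCharacter

def chTerm {q : ℕ} (χ : DirichletCharacter ℂ q) (s : ℂ) (n : ℕ) : ℂ :=
  chT χ (n + 1) * (wt s n - wt s (n + 1))

lemma summable_pow_aux {σ : ℝ} (hσ : 0 < σ) : Summable (fun n : ℕ => ((n + 1 : ℕ) : ℝ) ^ (-σ - 1)) := by
  have h := (Real.summable_nat_rpow (p := -σ - 1)).mpr (by linarith)
  exact (summable_nat_add_iff 1).mpr h

lemma chTerm_bound {q : ℕ} [NeZero q] (χ : DirichletCharacter ℂ q) (hχ : χ ≠ 1) {s : ℂ} {σ R : ℝ}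
    (hσ : 0 < σ) (hs : σ ≤ s.re) (hR : ‖s‖ ≤ R) (n : ℕ) :
    ‖chTerm χ s n‖ ≤ q * R * ((n + 1 : ℕ) : ℝ) ^ (-σ - 1) := by
  have h1 := wt_diff s (hσ.trans_le hs) n
  have h2 := chT_norm_le χ hχ (n + 1)
  unfold chTerm
  rw [norm_mul, mul_assoc]
  have h3 : ((n + 1 : ℕ) : ℝ) ^ (-s.re - 1) ≤ ((n + 1 : ℕ) : ℝ) ^ (-σ - 1) :=
    Real.rpow_le_rpow_of_exponent_le (by simp) (by linarith)
  refine mul_le_mul h2 (h1.trans ?_) (norm_nonneg _) (by positivity)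
  exact mul_le_mul hR h3 (by positivity) ((norm_nonneg _).trans hR)

def chL {q : ℕ} (χ : DirichletCharacter ℂ q) (s : ℂ) : ℂ := ∑' n, chTerm χ s n

lemma chTerm_differentiable {q : ℕ} (χ : DirichletCharacter ℂ q) (n : ℕ) :
    Differentiable ℂ (fun s => chTerm χ s n) := by
  unfold chTerm wt
  have h1 : ((n + 1 : ℕ) : ℂ) ≠ 0 := by exact_mod_cast Nat.succ_ne_zero n
  have h2 : ((n + 1 + 1 : ℕ) : ℂ) ≠ 0 := by exact_mod_cast Nat.succ_ne_zero (n + 1)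
  refine (differentiable_const _).mul (Differentiable.sub ?_ ?_)
  · exact Differentiable.const_cpow differentiable_neg (Or.inl h1)
  · exact Differentiable.const_cpow differentiable_neg (Or.inl h2)

lemma chL_differentiableOn {q : ℕ} [NeZero q] (χ : DirichletCharacter ℂ q) (hχ : χ ≠ 1) :
    DifferentiableOn ℂ (chL χ) {s | 0 < s.re} := by
  intro s hs
  have hs' : 0 < s.re := hs
  set U : Set ℂ := {z | s.re / 2 < z.re} ∩ Metric.ball 0 (‖s‖ + 1) with hU
  have hUo : IsOpen U :=
    (continuous_re.isOpen_preimage _ isOpen_Ioi).inter Metric.isOpen_ball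
  have hsU : s ∈ U := ⟨by simp only [Set.mem_ofPred_eq]; linarith, by simp⟩
  have := differentiableOn_tsum_of_summable_norm (F := fun n s => chTerm χ s n) (U := U)
    (u := fun n => q * (‖s‖ + 1) * ((n + 1 : ℕ) : ℝ) ^ (-(s.re / 2) - 1))
    ((summable_pow_aux (by linarith)).mul_left _)
    (fun n => (chTerm_differentiable χ n).differentiableOn) hUo
    (fun n w hw => chTerm_bound χ hχ (by linarith) (le_of_lt hw.1) (by
      have := hw.2; simp at this; exact this.le) n)
  exact (this.differentiableAt (hUo.mem_nhds hsU)).differentiableWithinAt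

lemma chL_eq_of_one_lt {q : ℕ} [NeZero q] (χ : DirichletCharacter ℂ q) (hχ : χ ≠ 1) {s : ℂ}
    (hs : 1 < s.re) : chL χ s = LFunction χ s := by
  rw [LFunction_eq_LSeries χ hs]
  have hsum : LSeriesSummable (fun n => χ n) s := LSeriesSummable_of_one_lt_re χ hs
  have h1 : HasSum (LSeries.term (fun n => χ n) s) (LSeries (fun n => χ n) s) := hsum.hasSum
  have h2 := (hasSum_nat_add_iff' 1).mpr h1
  simp only [Finset.range_one, Finset.sum_singleton, LSeries.term_zero, sub_zero] at h2
  have h3 := h2.tendsto_sum_nat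
  have h4 : HasSum (chTerm χ s) (chL χ s) := by
    refine Summable.hasSum (Summable.of_norm_bounded
      (g := fun n : ℕ => q * ‖s‖ * ((n + 1 : ℕ) : ℝ) ^ (-1 - 1 : ℝ))
      ((summable_pow_aux one_pos).mul_left _) (fun n => chTerm_bound χ hχ one_pos hs.le le_rfl n))
  have h5 := h4.tendsto_sum_nat
  have hid : ∀ N, ∑ i ∈ Finset.range N, LSeries.term (fun n => χ n) s (i + 1) =
      ∑ i ∈ Finset.range N, chTerm χ s i + chT χ N * wt s N := by
    intro N
    induction N with
    | zero => simp [chT]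
    | succ N ih =>
      rw [Finset.sum_range_succ, Finset.sum_range_succ, ih, LSeries.term_of_ne_zero (by omega)]
      have : chT χ (N + 1) = chT χ N + χ ((N + 1 : ℕ) : ZMod q) := by
        unfold chT; rw [Finset.sum_range_succ]
      unfold chTerm
      rw [this]
      have hw : χ ((N + 1 : ℕ) : ZMod q) / ((N + 1 : ℕ) : ℂ) ^ s = χ ((N + 1 : ℕ) : ZMod q) * wt s N := by
        unfold wt; rw [cpow_neg, div_eq_mul_inv]
      rw [hw]; ring
  have h6 : Tendsto (fun N => chT χ N * wt s N) atTop (𝓝 0) := by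
    refine squeeze_zero_norm (a := fun N : ℕ => q * ((N + 1 : ℕ) : ℝ) ^ (-1 : ℝ)) (fun N => ?_) ?_
    · rw [norm_mul]
      refine mul_le_mul (chT_norm_le χ hχ N) ?_ (norm_nonneg _) (by positivity)
      unfold wt
      rw [Complex.norm_natCast_cpow_of_pos (Nat.succ_pos N)]
      exact Real.rpow_le_rpow_of_exponent_le (by simp) (by simp; linarith)
    · have := (tendsto_rpow_neg_atTop one_pos).comp (tendsto_natCast_atTop_atTop (R := ℝ))
      have := (tendsto_add_atTop_iff_nat 1).mpr this
      simpa using this.const_mul (q : ℝ)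
  have h7 := h5.add h6
  simp only [← hid, add_zero] at h7
  exact tendsto_nhds_unique h7 h3

lemma chL_eq {q : ℕ} [NeZero q] (χ : DirichletCharacter ℂ q) (hχ : χ ≠ 1) {s : ℂ}
    (hs : 0 < s.re) : chL χ s = LFunction χ s := by
  have hop : IsOpen {s : ℂ | 0 < s.re} := continuous_re.isOpen_preimage _ isOpen_Ioi
  have hf : AnalyticOnNhd ℂ (chL χ) {s : ℂ | 0 < s.re} := (chL_differentiableOn χ hχ).analyticOnNhd hop
  have hg : AnalyticOnNhd ℂ (LFunction χ) {s : ℂ | 0 < s.re} :=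
    (differentiable_LFunction hχ).differentiableOn.analyticOnNhd hop
  refine hf.eqOn_of_preconnected_of_eventuallyEq hg (convex_halfSpace_re_gt 0).isPreconnected
    (z₀ := 2) (by simp) ?_ hs
  have hop1 : IsOpen {s : ℂ | 1 < s.re} := continuous_re.isOpen_preimage _ isOpen_Ioi
  filter_upwards [hop1.mem_nhds (show (2 : ℂ) ∈ {s : ℂ | 1 < s.re} by simp)] with z hz
  exact chL_eq_of_one_lt χ hχ hz

/-- uniform bound on the disc -/
lemma L_disc_bound : ∃ C : ℝ, 1 ≤ C ∧ ∀ (q : ℕ) [NeZero q] (χ : DirichletCharacter ℂ q), χ ≠ 1 →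
    ∀ s ∈ Metric.closedBall (2 : ℂ) (3 / 2), ‖LFunction χ s‖ ≤ C * q := by
  have hS := summable_pow_aux (σ := 1 / 2) (by norm_num)
  refine ⟨max 1 (7 / 2 * ∑' n : ℕ, ((n + 1 : ℕ) : ℝ) ^ (-(1 / 2 : ℝ) - 1)), le_max_left _ _, ?_⟩
  intro q _ χ hχ s hs
  have hd : ‖s - 2‖ ≤ 3 / 2 := by simpa [dist_eq_norm] using hs
  have h1 : 1 / 2 ≤ s.re := by
    have := (abs_le.mp ((abs_re_le_norm (s - 2)).trans hd)).1
    simp at this; linarith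
  have h2 : ‖s‖ ≤ 7 / 2 := by
    calc ‖s‖ = ‖(s - 2) + 2‖ := by ring_nf
      _ ≤ ‖s - 2‖ + ‖(2 : ℂ)‖ := norm_add_le _ _
      _ ≤ 7 / 2 := by simp; linarith
  rw [← chL_eq χ hχ (by linarith)]
  have := tsum_of_norm_bounded ((hS.mul_left (q * (7 / 2) : ℝ)).hasSum)
    (fun n => chTerm_bound χ hχ (by norm_num) h1 h2 n)
  unfold chL
  refine this.trans ?_
  rw [tsum_mul_left]
  calc _ = (7 / 2 * ∑' n : ℕ, ((n + 1 : ℕ) : ℝ) ^ (-(1 / 2 : ℝ) - 1)) * q := by ring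
    _ ≤ _ := by gcongr; exact le_max_right _ _

lemma L_one_bound (ε : ℝ) (hε : 0 < ε) (hε1 : ε ≤ 1) : ∃ C : ℝ, 0 < C ∧ ∀ (q : ℕ) [NeZero q]
    (χ : DirichletCharacter ℂ q), χ ≠ 1 → ‖LFunction χ 1‖ ≤ C * (q : ℝ) ^ ε := by
  have hS := summable_pow_aux hε
  refine ⟨max 1 (∑' n : ℕ, ((n + 1 : ℕ) : ℝ) ^ (-ε - 1)), by positivity, ?_⟩
  intro q _ χ hχ
  have hq : (1 : ℝ) ≤ q := by exact_mod_cast NeZero.one_le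
  rw [← chL_eq χ hχ (by simp)]
  have hb : ∀ n, ‖chTerm χ 1 n‖ ≤ (q : ℝ) ^ ε * ((n + 1 : ℕ) : ℝ) ^ (-ε - 1) := by
    intro n
    have h1 := wt_diff 1 (by simp) n
    have hn : (0 : ℝ) < ((n + 1 : ℕ) : ℝ) := by positivity
    have h2 : ‖chT χ (n + 1)‖ ≤ (q : ℝ) ^ ε * ((n + 1 : ℕ) : ℝ) ^ (1 - ε) := by
      have e : ‖chT χ (n + 1)‖ = ‖chT χ (n + 1)‖ ^ ε * ‖chT χ (n + 1)‖ ^ (1 - ε) := by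
        rw [← Real.rpow_add' (norm_nonneg _) (by simp)]; simp
      rw [e]
      refine mul_le_mul ?_ ?_ (by positivity) (by positivity)
      · exact Real.rpow_le_rpow (norm_nonneg _) (chT_norm_le χ hχ _) hε.le
      · exact Real.rpow_le_rpow (norm_nonneg _) (chT_norm_le_self χ _) (by linarith)
    unfold chTerm
    rw [norm_mul]
    refine (mul_le_mul h2 h1 (norm_nonneg _) (by positivity)).trans (le_of_eq ?_)
    simp only [norm_one, one_re, one_mul]
    rw [mul_assoc, ← Real.rpow_add hn]
    congr 2; ring
  have := tsum_of_norm_bounded ((hS.mul_left _).hasSum) hb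
  unfold chL
  refine this.trans ?_
  rw [tsum_mul_left, mul_comm]
  gcongr
  exact le_max_right _ _

lemma chi_im {q : ℕ} (χ : DirichletCharacter ℂ q) (hχ : χ ^ 2 = 1) (a : ZMod q) : (χ a).im = 0 := by
  rcases MulChar.isQuadratic_iff_sq_eq_one.mpr hχ a with h | h | h <;> simp [h]

lemma L_real {q : ℕ} [NeZero q] (χ : DirichletCharacter ℂ q) (hχ : χ ≠ 1) (h2 : χ ^ 2 = 1)
    {x : ℝ} (hx : 0 < x) : (LFunction χ x).im = 0 := by
  rw [← chL_eq χ hχ (by simpa)]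
  unfold chL
  have hw : ∀ n, (wt x n).im = 0 := by
    intro n
    unfold wt
    rw [← ofReal_natCast, ← ofReal_neg, ← ofReal_cpow (by positivity), ofReal_im]
  have ht : ∀ n, (chT χ n).im = 0 := by
    intro n; unfold chT; rw [im_sum]; exact Finset.sum_eq_zero fun k _ => chi_im χ h2 _
  have hsum : Summable (chTerm χ x) := Summable.of_norm_bounded
      (g := fun n : ℕ => q * ‖(x : ℂ)‖ * ((n + 1 : ℕ) : ℝ) ^ (-x - 1 : ℝ))
      ((summable_pow_aux hx).mul_left _) (fun n => chTerm_bound χ hχ hx (by simp) le_rfl n)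
  rw [im_tsum hsum]
  convert tsum_zero with n
  unfold chTerm
  simp [hw, ht]

end

noncomputable section
open Complex Filter Topology DirichletCharacter

/-- `(s-1) ζ(s)` made entire -/
def zE : ℂ → ℂ := LFunctionTrivChar₁ 1

lemma zE_diff : Differentiable ℂ zE := differentiable_LFunctionTrivChar₁ 1
lemma zE_one : zE 1 = 1 := by simp [zE]
lemma zE_ne {s : ℂ} (hs : s ≠ 1) : zE s = (s - 1) * riemannZeta s := by
  simp [zE, Function.update_of_ne hs, LFunctionTrivChar, LFunction_modOne_eq]

open scoped ComplexOrder Nat in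
/-- real-variable end of Estermann's argument -/
lemma estermann_real {c : ℕ → ℝ} {β lam C0 : ℝ} (hβ : 7 / 8 ≤ β) (hβ1 : β < 1) (hC0 : 1 ≤ C0)
    {v : ℝ} (hsum : HasSum (fun m => c m * (2 - β) ^ m) v) (hv : v ≤ lam / (1 - β))
    (h0 : 1 - lam ≤ c 0) (hm : ∀ m, -lam ≤ c m) (hb : ∀ m, |c m| ≤ C0 * (2 / 3) ^ m) :
    (1 - β) / 4 * (8 * C0) ^ (-(4 * (1 - β))) ≤ lam := by
  set u := 2 - β with hu
  have hu1 : 1 ≤ u := by linarith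
  have hu2 : u ≤ 9 / 8 := by linarith
  have hd : 0 < 1 - β := by linarith
  set M := ⌈4 * Real.log (8 * C0)⌉₊ with hM
  have hlog : 0 < Real.log (8 * C0) := Real.log_pos (by linarith)
  have hM1 : 4 * Real.log (8 * C0) ≤ M := Nat.le_ceil _
  have hM2 : (M : ℝ) < 4 * Real.log (8 * C0) + 1 := Nat.ceil_lt_add_one (by positivity)
  have hMpos : 0 < M := by rw [hM, Nat.ceil_pos]; positivity
  have h34 : (3 / 4 : ℝ) ^ M ≤ 1 / (8 * C0) := by
    have h1 : (3 / 4 : ℝ) ≤ Real.exp (-(1 / 4)) := by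
      have := Real.add_one_le_exp (-(1 / 4) : ℝ); linarith
    calc (3 / 4 : ℝ) ^ M ≤ Real.exp (-(1 / 4)) ^ M := by gcongr
      _ = Real.exp (-(M / 4)) := by rw [← Real.exp_nat_mul]; ring_nf
      _ ≤ Real.exp (-Real.log (8 * C0)) := by gcongr; linarith
      _ = 1 / (8 * C0) := by rw [Real.exp_neg, Real.exp_log (by positivity), one_div]
  have huM : u ^ M ≤ 2 * (8 * C0) ^ (4 * (1 - β)) := by
    have h1 : u ≤ Real.exp (1 - β) := by
      have := Real.add_one_le_exp (1 - β : ℝ); linarith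
    calc u ^ M ≤ Real.exp (1 - β) ^ M := by gcongr
      _ = Real.exp (M * (1 - β)) := by rw [← Real.exp_nat_mul]
      _ ≤ Real.exp ((4 * Real.log (8 * C0) + 1) * (1 - β)) := by gcongr
      _ = Real.exp (1 - β) * (8 * C0) ^ (4 * (1 - β)) := by
        rw [Real.rpow_def_of_pos (by positivity), ← Real.exp_add]; ring_nf
      _ ≤ 2 * (8 * C0) ^ (4 * (1 - β)) := by
        gcongr
        calc Real.exp (1 - β) ≤ Real.exp (1 / 8) := by gcongr; linarith
          _ ≤ 2 := by
            have := Real.exp_bound_div_one_sub_of_interval (x := 1 / 8) (by norm_num) (by norm_num)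
            linarith
  have hsplit := hsum.summable.sum_add_tsum_nat_add M
  rw [hsum.tsum_eq] at hsplit
  have hfin : 1 - lam * ∑ m ∈ Finset.range M, u ^ m ≤ ∑ m ∈ Finset.range M, c m * u ^ m := by
    obtain ⟨N, hN⟩ : ∃ N, M = N + 1 := ⟨M - 1, by omega⟩
    rw [hN, Finset.sum_range_succ', Finset.sum_range_succ', mul_add, Finset.mul_sum]
    have : ∑ k ∈ Finset.range N, -(lam * u ^ (k + 1)) ≤ ∑ k ∈ Finset.range N, c (k + 1) * u ^ (k + 1) := by
      refine Finset.sum_le_sum fun k _ => ?_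
      have := mul_le_mul_of_nonneg_right (hm (k + 1)) (pow_nonneg (zero_le_one.trans hu1) (k + 1))
      linarith
    rw [Finset.sum_neg_distrib] at this
    simp only [pow_zero, mul_one]
    linarith
  have htail : -(1 / 2) ≤ ∑' m, c (m + M) * u ^ (m + M) := by
    have hg : HasSum (fun m : ℕ => C0 * (3 / 4) ^ M * (3 / 4 : ℝ) ^ m) (C0 * (3 / 4) ^ M * (1 - 3 / 4)⁻¹) :=
      (hasSum_geometric_of_lt_one (by norm_num) (by norm_num)).mul_left _
    have := tsum_of_norm_bounded hg (f := fun m => c (m + M) * u ^ (m + M)) (fun m => by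
      rw [Real.norm_eq_abs, abs_mul, abs_of_nonneg (pow_nonneg (zero_le_one.trans hu1) _)]
      calc |c (m + M)| * u ^ (m + M) ≤ (C0 * (2 / 3) ^ (m + M)) * (9 / 8) ^ (m + M) := by
            gcongr; exact hb _
        _ = C0 * (3 / 4) ^ M * (3 / 4 : ℝ) ^ m := by
            rw [mul_assoc, ← mul_pow, mul_assoc, ← pow_add, add_comm M m]; norm_num)
    rw [Real.norm_eq_abs] at this
    have h2 := (abs_le.mp this).1
    have h3 : C0 * (3 / 4) ^ M * (1 - 3 / 4)⁻¹ ≤ 1 / 2 := by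
      calc C0 * (3 / 4) ^ M * (1 - 3 / 4)⁻¹ ≤ C0 * (1 / (8 * C0)) * (1 - 3 / 4)⁻¹ := by
            gcongr
        _ = 1 / 2 := by field_simp; norm_num
    linarith
  have hgeo : ∑ m ∈ Finset.range M, u ^ m = (u ^ M - 1) / (1 - β) := by
    rw [geom_sum_eq (by linarith)]; congr 1; linarith
  rw [hgeo] at hfin
  have h5 : 1 / 2 ≤ lam / (1 - β) + lam * ((u ^ M - 1) / (1 - β)) := by linarith
  have h6 : (1 - β) / 2 ≤ lam * u ^ M := by
    have : lam / (1 - β) + lam * ((u ^ M - 1) / (1 - β)) = lam * u ^ M / (1 - β) := by field_simp; ring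
    rw [this, le_div_iff₀ hd] at h5; linarith
  have huMpos : 0 < u ^ M := by positivity
  have hlam : 0 < lam := by
    by_contra h
    have : lam * u ^ M ≤ 0 := mul_nonpos_of_nonpos_of_nonneg (not_lt.mp h) huMpos.le
    linarith
  have h7 : (1 - β) / 2 ≤ lam * (2 * (8 * C0) ^ (4 * (1 - β))) := h6.trans (by gcongr)
  rw [Real.rpow_neg (by positivity)]
  have hp : 0 < (8 * C0) ^ (4 * (1 - β)) := by positivity
  rw [← div_eq_mul_inv, div_le_iff₀ hp]
  linarith

open scoped ComplexOrder Nat in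
lemma estermann : ∃ K : ℝ, 1 ≤ K ∧ ∀ (P : ℂ → ℂ), Differentiable ℂ P → ∀ B : ℝ, 1 ≤ B →
    (∀ s ∈ Metric.closedBall (2 : ℂ) (3 / 2), ‖P s‖ ≤ B) → ∀ a : ℕ → ℂ, 0 ≤ a → a 1 = 1 →
    LSeries.abscissaOfAbsConv a ≤ 1 → (∀ s : ℂ, 1 < s.re → riemannZeta s * P s = LSeries a s) →
    ∀ β : ℝ, 7 / 8 ≤ β → β < 1 → (riemannZeta β * P β).re ≤ 0 →
    (1 - β) / 4 * (K * B) ^ (-(4 * (1 - β))) ≤ (P 1).re := by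
  obtain ⟨K0, hK0⟩ := (isCompact_closedBall (2 : ℂ) (3 / 2)).exists_bound_of_continuousOn
    zE_diff.continuous.continuousOn
  have hK00 : 0 ≤ K0 := (norm_nonneg _).trans (hK0 2 (Metric.mem_closedBall_self (by norm_num)))
  refine ⟨8 * (2 * (K0 + 1)), by linarith, ?_⟩
  intro P hP B hB1 hB a ha0 ha1 habs hF β hβ hβ1 hre
  set G : ℂ → ℂ := fun s => zE s * P s with hG
  have hGd : Differentiable ℂ G := zE_diff.mul hP
  set H : ℂ → ℂ := dslope G 1 with hH
  have hHd : Differentiable ℂ H := by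
    rw [← differentiableOn_univ]
    exact (Complex.differentiableOn_dslope univ_mem).mpr hGd.differentiableOn
  have hHv : ∀ s : ℂ, s ≠ 1 → H s = riemannZeta s * P s - P 1 * (1 * s - 1)⁻¹ := by
    intro s hs
    have hs' : s - 1 ≠ 0 := sub_ne_zero.mpr hs
    rw [hH, dslope_of_ne _ hs, slope_def_field, hG]
    simp only [zE_one, zE_ne hs, one_mul]
    field_simp
  -- sphere bound
  have hsph : ∀ z ∈ Metric.sphere (2 : ℂ) (3 / 2), ‖H z‖ ≤ 2 * (K0 + 1) * B := by
    intro z hz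
    have hz2 : ‖z - 2‖ = 3 / 2 := by simpa [dist_eq_norm] using hz
    have hzc : z ∈ Metric.closedBall (2 : ℂ) (3 / 2) := Metric.sphere_subset_closedBall hz
    have h1 : 1 / 2 ≤ ‖z - 1‖ := by
      have : ‖z - 2‖ ≤ ‖z - 1‖ + ‖(1 : ℂ)‖ := by
        calc ‖z - 2‖ = ‖(z - 1) - 1‖ := by ring_nf
          _ ≤ _ := norm_sub_le _ _
      rw [norm_one] at this; linarith
    have hne : z ≠ 1 := by rintro rfl; norm_num at h1
    have h1c : (1 : ℂ) ∈ Metric.closedBall (2 : ℂ) (3 / 2) := by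
      rw [Metric.mem_closedBall, dist_eq_norm]; norm_num
    rw [hH, dslope_of_ne _ hne, slope_def_field, norm_div, div_le_iff₀ (by linarith)]
    have h2 : ‖G z - G 1‖ ≤ (K0 + 1) * B := by
      refine (norm_sub_le _ _).trans ?_
      simp only [hG, norm_mul, zE_one, norm_one, one_mul]
      have := mul_le_mul (hK0 z hzc) (hB z hzc) (norm_nonneg _) hK00
      have := hB 1 h1c
      linarith
    have h3 : 0 ≤ (K0 + 1) * B := by positivity
    nlinarith
  have hcauchy : ∀ m, ‖iteratedDeriv m H 2‖ ≤ m ! * (2 * (K0 + 1) * B) / (3 / 2) ^ m := fun m =>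
    norm_iteratedDeriv_le_of_forall_mem_sphere_norm_le m (by norm_num) hHd.diffContOnCl hsph
  have hop : IsOpen {s : ℂ | 1 < s.re} := continuous_re.isOpen_preimage _ isOpen_Ioi
  have hlt2 : LSeries.abscissaOfAbsConv a < ((2 : ℝ) : EReal) := habs.trans_lt (by norm_cast)
  have hder : ∀ m, iteratedDeriv m H 2 = iteratedDeriv m (LSeries a) 2 - P 1 * ((-1) ^ m * m !) := by
    intro m
    have hev : H =ᶠ[𝓝 2] (fun s => LSeries a s - P 1 * (1 * s - 1)⁻¹) := by
      filter_upwards [hop.mem_nhds (show (2 : ℂ) ∈ {s : ℂ | 1 < s.re} by simp)] with s hs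
      have hs' : 1 < s.re := hs
      rw [hHv s (by rintro rfl; simp at hs'), hF s hs']
    have hinv : ContDiffAt ℂ m (fun s : ℂ => (1 * s - 1)⁻¹) 2 := by
      refine ContDiffAt.inv (by fun_prop) (by norm_num)
    rw [hev.iteratedDeriv_eq, iteratedDeriv_fun_sub, iteratedDeriv_const_mul_field,
      iteratedDeriv_eq_iterate (f := fun s : ℂ => (1 * s - 1)⁻¹), iter_deriv_inv_linear_sub]
    · norm_num
    · exact (LSeries_analyticOnNhd a 2 (by simpa using hlt2)).contDiffAt
    · exact contDiffAt_const.mul hinv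
  set cc : ℕ → ℂ := fun m => (m ! : ℂ)⁻¹ * ((-1) ^ m * iteratedDeriv m H 2) with hcc
  have hccv : ∀ m, cc m = (m ! : ℂ)⁻¹ * ((-1) ^ m * iteratedDeriv m (LSeries a) 2) - P 1 := by
    intro m
    have hf : (m ! : ℂ) ≠ 0 := by exact_mod_cast Nat.factorial_ne_zero m
    have h1 : ((-1 : ℂ) ^ m) * (-1) ^ m = 1 := by rw [← mul_pow]; simp
    rw [hcc]; simp only
    rw [hder]
    have : (m ! : ℂ)⁻¹ * m ! = 1 := inv_mul_cancel₀ hf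
    linear_combination (-(P 1) * (m ! : ℂ)⁻¹ * m !) * h1 - P 1 * this
  have hHβ := hasSum_taylorSeries_of_entire hHd 2 (β : ℂ)
  have hsum : HasSum (fun m => (cc m).re * (2 - β) ^ m) (H β).re := by
    have := Complex.hasSum_re hHβ
    convert this using 2 with m
    have e : (m ! : ℂ)⁻¹ • ((β : ℂ) - 2) ^ m • iteratedDeriv m H 2 = (((2 - β) ^ m : ℝ) : ℂ) * cc m := by
      simp only [smul_eq_mul, hcc]
      have : ((β : ℂ) - 2) ^ m = (((2 - β) ^ m : ℝ) : ℂ) * (-1) ^ m := by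
        push_cast; rw [← mul_pow]; ring
      rw [this]; ring
    rw [e, re_ofReal_mul, mul_comm]
  have hnn : ∀ m, 0 ≤ ((m ! : ℂ)⁻¹ * ((-1) ^ m * iteratedDeriv m (LSeries a) 2)).re := by
    intro m
    have := LSeries.iteratedDeriv_alternating ha0 hlt2 m
    have h2 : (0 : ℂ) ≤ (m ! : ℂ)⁻¹ := by
      rw [← ofReal_natCast, ← ofReal_inv]; exact zero_le_real.mpr (by positivity)
    exact (Complex.le_def.mp (mul_nonneg h2 this)).1
  refine le_of_eq_of_le ?_ (estermann_real (c := fun m => (cc m).re) (C0 := 2 * (K0 + 1) * B) hβ hβ1 (by nlinarith) hsum ?_ ?_ ?_ ?_)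
  · ring_nf
  · rw [hHv β (by exact_mod_cast hβ1.ne)]
    have e : (P 1 * (1 * (β : ℂ) - 1)⁻¹).re = (P 1).re / (β - 1) := by
      have : (1 * (β : ℂ) - 1)⁻¹ = (((β - 1)⁻¹ : ℝ) : ℂ) := by push_cast; ring
      rw [this, mul_comm, re_ofReal_mul]; ring
    rw [sub_re, e]
    have : (P 1).re / (β - 1) = -((P 1).re / (1 - β)) := by
      rw [← neg_sub 1 β, div_neg]
    rw [this]; linarith
  · simp only [hccv, sub_re]
    have h1 : (1 : ℝ) ≤ (LSeries a 2).re := by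
      have hs : LSeriesSummable a 2 := LSeriesSummable_of_abscissaOfAbsConv_lt_re (by simpa using hlt2)
      have hre2 : Summable (fun n => (LSeries.term a 2 n).re) := (Complex.hasSum_re hs.hasSum).summable
      rw [LSeries, Complex.re_tsum hs]
      have := hre2.le_tsum 1 (fun n _ => by
        have := LSeries.term_nonneg (ha0 n) 2
        exact_mod_cast (Complex.le_def.mp this).1)
      simpa [LSeries.term, ha1] using this
    simpa using h1
  · intro m; simp only [hccv, sub_re]; linarith [hnn m]
  · intro m
    refine (abs_re_le_norm _).trans ?_
    rw [hcc]; simp only [norm_mul, norm_inv, norm_pow, norm_neg, norm_one, one_pow, one_mul]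
    rw [Complex.norm_natCast]
    have hf : (0 : ℝ) < m ! := by exact_mod_cast Nat.factorial_pos m
    rw [inv_mul_le_iff₀ hf]
    refine (hcauchy m).trans (le_of_eq ?_)
    rw [div_eq_mul_inv, ← inv_pow, mul_assoc]; norm_num

end

noncomputable section
open Complex Filter Topology DirichletCharacter

lemma zE_pos_near : ∃ δ : ℝ, 0 < δ ∧ δ ≤ 1 / 8 ∧ ∀ x : ℝ, |x - 1| ≤ δ → 0 < (zE x).re := by
  have hc : ContinuousAt (fun x : ℝ => (zE x).re) 1 :=
    (continuous_re.comp (zE_diff.continuous.comp continuous_ofReal)).continuousAt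
  have h1 : (0 : ℝ) < (fun x : ℝ => (zE x).re) 1 := by simp [zE_one]
  obtain ⟨δ, hδ, h⟩ := Metric.eventually_nhds_iff.mp (hc.eventually (lt_mem_nhds h1))
  refine ⟨min (δ / 2) (1 / 8), by positivity, min_le_right _ _, fun x hx => h ?_⟩
  rw [Real.dist_eq]
  have := min_le_left (δ / 2) (1 / 8)
  linarith

lemma zeta_re (x : ℝ) (hx : x ≠ 1) : (zE x).re = (x - 1) * (riemannZeta x).re := by
  rw [zE_ne (by exact_mod_cast hx)]
  have : ((x : ℂ) - 1) = ((x - 1 : ℝ) : ℂ) := by push_cast; ring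
  rw [this, re_ofReal_mul]

lemma zetaMul_LSeries {q : ℕ} [NeZero q] (χ : DirichletCharacter ℂ q) {s : ℂ} (hs : 1 < s.re) :
    riemannZeta s * LFunction χ s = LSeries χ.zetaMul s := by
  rw [zetaMul, LFunction_eq_LSeries χ hs, ← LSeriesHasSum_one hs |>.LSeries_eq]
  rw [← ArithmeticFunction.coe_mul, LSeries_convolution']
  · congr 1
    · exact (LSeries_congr (fun {n} hn => by simp [hn]) s)
    · exact (LSeries_congr (fun {n} hn => by simp [toArithmeticFunction, hn]) s)
  · exact ArithmeticFunction.LSeriesSummable_zeta_iff.mpr hs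
  · refine (LSeriesSummable_congr s (fun {n} hn => ?_)).mp (LSeriesSummable_of_one_lt_re χ hs)
    simp [toArithmeticFunction, hn]

lemma zetaMul_one {q : ℕ} (χ : DirichletCharacter ℂ q) : χ.zetaMul 1 = 1 :=
  (isMultiplicative_zetaMul χ).map_one

lemma zetaMul_absc {q : ℕ} (χ : DirichletCharacter ℂ q) :
    LSeries.abscissaOfAbsConv χ.zetaMul ≤ 1 := by
  have := LSeries.abscissaOfAbsConv_le_of_forall_lt_LSeriesSummable (f := χ.zetaMul) (x := 1)
    (fun y hy => LSeriesSummable_zetaMul χ (by simpa using hy))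
  simpa using this

lemma L_one_pos {q : ℕ} [NeZero q] (χ : DirichletCharacter ℂ q) (h2 : χ ^ 2 = 1) (h1 : χ ≠ 1) :
    0 < (LFunction χ 1).re := by
  obtain ⟨δ, hδ, -, hz⟩ := zE_pos_near
  have hge : 0 ≤ (LFunction χ 1).re := by
    have hc : ContinuousWithinAt (fun x : ℝ => (LFunction χ x).re) (Set.Ioi 1) 1 :=
      (continuous_re.comp ((differentiable_LFunction h1).continuous.comp
        continuous_ofReal)).continuousWithinAt
    have hc' : Tendsto (fun x : ℝ => (LFunction χ x).re) (𝓝[>] 1) (𝓝 (LFunction χ 1).re) := by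
      simpa using hc.tendsto
    refine ge_of_tendsto hc' ?_
    filter_upwards [Ioo_mem_nhdsGT (show (1 : ℝ) < 1 + δ by linarith)] with x hx
    have hx1 : 1 < x := hx.1
    have hx2 : x < 1 + δ := hx.2
    have hzp := hz x (by rw [abs_of_pos] <;> linarith)
    rw [zeta_re x hx1.ne'] at hzp
    have hzz : 0 < (riemannZeta x).re := by
      by_contra h
      have : (x - 1) * (riemannZeta x).re ≤ 0 :=
        mul_nonpos_of_nonneg_of_nonpos (by linarith) (not_lt.mp h)
      linarith
    have hs := zetaMul_LSeries χ (s := x) (by simpa using hx1)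
    have hre : 0 ≤ (LSeries χ.zetaMul x).re := by
      have hsum : LSeriesSummable χ.zetaMul (x : ℂ) := LSeriesSummable_zetaMul χ (by simpa using hx1)
      rw [LSeries, Complex.re_tsum hsum]
      refine tsum_nonneg fun n => ?_
      have := LSeries.term_nonneg (zetaMul_nonneg h2 n) x
      exact (Complex.le_def.mp this).1
    rw [← hs, mul_re, L_real χ h1 h2 (by linarith)] at hre
    have : 0 ≤ (riemannZeta x).re * (LFunction χ x).re := by linarith
    exact (mul_nonneg_iff_of_pos_left hzz).mp this
  refine lt_of_le_of_ne hge fun h => LFunction_apply_one_ne_zero h1 ?_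
  have := L_real χ h1 h2 (x := 1) one_pos
  apply Complex.ext
  · simpa using h.symm
  · simpa using this

lemma E1 : ∃ δ : ℝ, 0 < δ ∧ δ ≤ 1 / 8 ∧ ∃ K : ℝ, 1 ≤ K ∧ ∀ (q : ℕ) [NeZero q]
    (χ : DirichletCharacter ℂ q), χ ^ 2 = 1 → χ ≠ 1 → ∀ β : ℝ, 1 - δ ≤ β → β < 1 →
    0 ≤ (LFunction χ β).re → (1 - β) / 4 * (K * q) ^ (-(4 * (1 - β))) ≤ (LFunction χ 1).re := by
  obtain ⟨δ, hδ, hδ8, hz⟩ := zE_pos_near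
  obtain ⟨K, hK, hE⟩ := estermann
  obtain ⟨C, hC, hB⟩ := L_disc_bound
  refine ⟨δ, hδ, hδ8, K * C, by nlinarith, ?_⟩
  intro q _ χ h2 h1 β hβ hβ1 hre
  have hq : (1 : ℝ) ≤ q := by exact_mod_cast Nat.one_le_iff_ne_zero.mpr (NeZero.ne q)
  have := hE (LFunction χ) (differentiable_LFunction h1) (C * q) (by nlinarith)
    (fun s hs => hB q χ h1 s hs) χ.zetaMul (fun n => zetaMul_nonneg h2 n) (zetaMul_one χ)
    (zetaMul_absc χ) (fun s hs => zetaMul_LSeries χ hs) β (by linarith) hβ1 ?_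
  · rwa [← mul_assoc] at this
  · have hzp := hz β (by rw [abs_of_neg] <;> linarith)
    rw [zeta_re β hβ1.ne] at hzp
    have hzz : (riemannZeta β).re ≤ 0 := by
      by_contra h
      have : (β - 1) * (riemannZeta β).re ≤ 0 :=
        mul_nonpos_of_nonpos_of_nonneg (by linarith) (not_le.mp h).le
      linarith
    rw [mul_re, L_real χ h1 h2 (by linarith)]
    have := mul_nonpos_of_nonpos_of_nonneg hzz hre
    linarith

section four
variable {q1 q2 q3 : ℕ} (χ1 : DirichletCharacter ℂ q1) (χ2 : DirichletCharacter ℂ q2)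

def tA {q : ℕ} (χ : DirichletCharacter ℂ q) : ArithmeticFunction ℂ := toArithmeticFunction (χ ·)

def fourA : ArithmeticFunction ℂ := zetaMul χ1 * (tA χ2).pmul (zetaMul χ1)

lemma tA_apply {q : ℕ} (χ : DirichletCharacter ℂ q) {n : ℕ} (hn : n ≠ 0) : tA χ n = χ n := by
  simp [tA, toArithmeticFunction, hn]

lemma pmul_conv {χ3 : DirichletCharacter ℂ q3} (h3 : ∀ n : ℕ, χ3 n = χ1 n * χ2 n) :
    (tA χ2).pmul (zetaMul χ1) = tA χ2 * tA χ3 := by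
  ext n
  rcases eq_or_ne n 0 with rfl | hn
  · simp
  rw [ArithmeticFunction.pmul_apply, zetaMul, ArithmeticFunction.mul_apply,
    ArithmeticFunction.mul_apply, Finset.mul_sum]
  refine Finset.sum_congr rfl fun x hx => ?_
  obtain ⟨hx1, -⟩ := Nat.mem_divisorsAntidiagonal.mp hx
  have ha : x.1 ≠ 0 := by rintro h; simp [h] at hx1; exact hn hx1.symm
  have hb : x.2 ≠ 0 := by rintro h; simp [h] at hx1; exact hn hx1.symm
  have e : toArithmeticFunction (χ1 ·) = tA χ1 := rfl
  rw [e, tA_apply _ hn, tA_apply _ ha, tA_apply _ hb, tA_apply _ hb, h3, ← hx1]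
  simp [ha]; ring

lemma four_symm {χ3 : DirichletCharacter ℂ q3} (h3 : ∀ n : ℕ, χ3 n = χ1 n * χ2 n) :
    fourA χ1 χ2 = fourA χ2 χ1 := by
  rw [fourA, fourA, pmul_conv χ1 χ2 h3, pmul_conv χ2 χ1 (χ3 := χ3) (fun n => by rw [h3, mul_comm]), zetaMul, zetaMul]
  change _ * tA χ1 * _ = _ * tA χ2 * _
  ring

open scoped ComplexOrder in
lemma four_nonneg {χ3 : DirichletCharacter ℂ q3} (h3 : ∀ n : ℕ, χ3 n = χ1 n * χ2 n)
    (hs1 : χ1 ^ 2 = 1) (hs2 : χ2 ^ 2 = 1) (n : ℕ) :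
    0 ≤ (fourA χ1 χ2) n := by
  have hmult : (fourA χ1 χ2).IsMultiplicative :=
    (isMultiplicative_zetaMul χ1).mul
      ((isMultiplicative_toArithmeticFunction χ2).pmul (isMultiplicative_zetaMul χ1))
  have key : ∀ p : ℕ, p.Prime → ∀ k, 0 ≤ (fourA χ1 χ2) (p ^ k) := by
    intro p hp k
    have hpk : ∀ i, p ^ i ≠ 0 := fun i => pow_ne_zero _ hp.ne_zero
    rcases MulChar.isQuadratic_iff_sq_eq_one.mpr hs1 p with h | h | h
    rotate_left 2
    · rw [fourA, ArithmeticFunction.mul_apply]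
      refine Finset.sum_nonneg fun x hx => ?_
      obtain ⟨hx1, -⟩ := Nat.mem_divisorsAntidiagonal.mp hx
      obtain ⟨j, -, hj⟩ := (Nat.dvd_prime_pow hp).mp (Dvd.intro_left _ hx1)
      refine mul_nonneg (zetaMul_nonneg hs1 _) ?_
      rw [ArithmeticFunction.pmul_apply, hj, tA_apply _ (hpk j)]
      rcases Nat.even_or_odd j with he | ho
      · refine mul_nonneg ?_ (zetaMul_nonneg hs1 _)
        rw [Nat.cast_pow, map_pow]
        rcases MulChar.isQuadratic_iff_sq_eq_one.mpr hs2 p with h' | h' | h'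
        · rw [h']; exact pow_nonneg le_rfl _
        · rw [h']; simp
        · rw [h', he.neg_one_pow]; exact zero_le_one
      · have : zetaMul χ1 (p ^ j) = 0 := by
          have e : zetaMul χ1 = ArithmeticFunction.zeta * tA χ1 := rfl
          rw [e, ArithmeticFunction.coe_zeta_mul_apply, Nat.sum_divisors_prime_pow hp]
          simp only [tA_apply _ (hpk _), Nat.cast_pow, map_pow, h, neg_one_geom_sum]
          rw [if_pos ho.add_one]
        rw [this]; simp
    all_goals
      rw [four_symm χ1 χ2 h3, fourA, ArithmeticFunction.mul_apply]
      refine Finset.sum_nonneg fun x hx => ?_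
      obtain ⟨hx1, -⟩ := Nat.mem_divisorsAntidiagonal.mp hx
      obtain ⟨j, -, hj⟩ := (Nat.dvd_prime_pow hp).mp (Dvd.intro_left _ hx1)
      refine mul_nonneg (zetaMul_nonneg hs2 _) ?_
      rw [ArithmeticFunction.pmul_apply, hj, tA_apply _ (hpk j)]
      refine mul_nonneg ?_ (zetaMul_nonneg hs2 _)
      rw [Nat.cast_pow, map_pow, h]
      exact pow_nonneg (by simp) _
  rcases eq_or_ne n 0 with rfl | hn
  · simp
  · rw [hmult.multiplicative_factorization _ hn]
    exact Finset.prod_nonneg fun p hp => key p (Nat.prime_of_mem_primeFactors hp) _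

lemma tA_summable {q : ℕ} (χ : DirichletCharacter ℂ q) {s : ℂ} (hs : 1 < s.re) :
    LSeriesSummable (tA χ) s := by
  refine (LSeriesSummable_congr s (fun {n} hn => ?_)).mp (LSeriesSummable_of_one_lt_re χ hs)
  rw [tA_apply _ hn]

lemma tA_LSeries {q : ℕ} [NeZero q] (χ : DirichletCharacter ℂ q) {s : ℂ} (hs : 1 < s.re) :
    LSeries (tA χ) s = LFunction χ s := by
  rw [LFunction_eq_LSeries χ hs]
  exact (LSeries_congr (fun {n} hn => tA_apply _ hn) s)

lemma four_LSeries [NeZero q1] [NeZero q2] [NeZero q3] {χ3 : DirichletCharacter ℂ q3}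
    (h3 : ∀ n : ℕ, χ3 n = χ1 n * χ2 n) {s : ℂ} (hs : 1 < s.re) :
    LSeriesSummable (fourA χ1 χ2) s ∧
    riemannZeta s * (LFunction χ1 s * LFunction χ2 s * LFunction χ3 s) =
      LSeries (fourA χ1 χ2) s := by
  rw [fourA, pmul_conv χ1 χ2 h3]
  have hA := LSeriesSummable_zetaMul χ1 hs
  have hB := ArithmeticFunction.LSeriesSummable_mul (tA_summable χ2 hs) (tA_summable χ3 hs)
  refine ⟨ArithmeticFunction.LSeriesSummable_mul hA hB, ?_⟩
  rw [ArithmeticFunction.LSeries_mul' hA hB, ← zetaMul_LSeries χ1 hs,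
    ArithmeticFunction.LSeries_mul' (tA_summable χ2 hs) (tA_summable χ3 hs),
    tA_LSeries χ2 hs, tA_LSeries χ3 hs]
  ring

lemma four_one : (fourA χ1 χ2) 1 = 1 :=
  ((isMultiplicative_zetaMul χ1).mul
      ((isMultiplicative_toArithmeticFunction χ2).pmul (isMultiplicative_zetaMul χ1))).map_one

end four

lemma E2 : ∃ K : ℝ, 1 ≤ K ∧ ∀ (q1 q2 q3 : ℕ) [NeZero q1] [NeZero q2] [NeZero q3]
    (χ1 : DirichletCharacter ℂ q1) (χ2 : DirichletCharacter ℂ q2) (χ3 : DirichletCharacter ℂ q3),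
    (∀ n : ℕ, χ3 n = χ1 n * χ2 n) → χ1 ^ 2 = 1 → χ1 ≠ 1 → χ2 ^ 2 = 1 → χ2 ≠ 1 → χ3 ≠ 1 →
    ∀ β : ℝ, 7 / 8 ≤ β → β < 1 → LFunction χ1 β = 0 →
    (1 - β) / 4 * (K * (q1 * q2 * q3)) ^ (-(4 * (1 - β))) ≤
      (LFunction χ1 1 * LFunction χ2 1 * LFunction χ3 1).re := by
  obtain ⟨K, hK, hE⟩ := estermann
  obtain ⟨C, hC, hB⟩ := L_disc_bound
  refine ⟨K * C ^ 3, by nlinarith [one_le_pow₀ hC (n := 3)], ?_⟩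
  intro q1 q2 q3 _ _ _ χ1 χ2 χ3 h3 hs1 hn1 hs2 hn2 hn3 β hβ hβ1 hz
  have hq1 : (1 : ℝ) ≤ q1 := by exact_mod_cast Nat.one_le_iff_ne_zero.mpr (NeZero.ne q1)
  have hq2 : (1 : ℝ) ≤ q2 := by exact_mod_cast Nat.one_le_iff_ne_zero.mpr (NeZero.ne q2)
  have hq3 : (1 : ℝ) ≤ q3 := by exact_mod_cast Nat.one_le_iff_ne_zero.mpr (NeZero.ne q3)
  have hone : ∀ x : ℝ, 1 ≤ x → 1 ≤ C * x := fun x hx => by nlinarith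
  have := hE (fun s => LFunction χ1 s * LFunction χ2 s * LFunction χ3 s)
    (((differentiable_LFunction hn1).mul (differentiable_LFunction hn2)).mul
      (differentiable_LFunction hn3)) ((C * q1) * (C * q2) * (C * q3))
    (one_le_mul_of_one_le_of_one_le (one_le_mul_of_one_le_of_one_le (hone _ hq1) (hone _ hq2)) (hone _ hq3))
    (fun s hs => by
      rw [norm_mul, norm_mul]
      gcongr
      · exact hB q1 χ1 hn1 s hs
      · exact hB q2 χ2 hn2 s hs
      · exact hB q3 χ3 hn3 s hs) _ (fun n => four_nonneg χ1 χ2 h3 hs1 hs2 n) (four_one χ1 χ2)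
    (by
      have := LSeries.abscissaOfAbsConv_le_of_forall_lt_LSeriesSummable
        (f := (fourA χ1 χ2)) (x := 1)
        (fun y hy => (four_LSeries χ1 χ2 h3 (by simpa using hy)).1)
      simpa using this) (fun s hs => (four_LSeries χ1 χ2 h3 hs).2) β hβ hβ1 (by simp [hz])
  convert this using 3
  ring

end

noncomputable section
open Complex Filter Topology DirichletCharacter

lemma pair_principal {q1 q2 : ℕ} [NeZero q1] [NeZero q2] (χ1 : DirichletCharacter ℂ q1)
    (χ2 : DirichletCharacter ℂ q2) (hs1 : χ1 ^ 2 = 1) (hn1 : χ1 ≠ 1) (hn2 : χ2 ≠ 1)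
    (h : changeLevel (dvd_mul_right q1 q2) χ1 * changeLevel (dvd_mul_left q2 q1) χ2 = 1)
    {β : ℝ} (hβ : 0 < β) (hz : LFunction χ1 β = 0) : LFunction χ2 β = 0 := by
  have he : changeLevel (dvd_mul_right q1 q2) χ1 = changeLevel (dvd_mul_left q2 q1) χ2 := by
    have hs : changeLevel (dvd_mul_right q1 q2) χ1 * changeLevel (dvd_mul_right q1 q2) χ1 = 1 := by
      rw [← map_mul, ← sq, hs1, map_one]
    exact mul_left_cancel (hs.trans h.symm)
  have e1 := LFunction_changeLevel (dvd_mul_right q1 q2) χ1 (s := β) (.inl hn1)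
  have e2 := LFunction_changeLevel (dvd_mul_left q2 q1) χ2 (s := β) (.inl hn2)
  rw [hz, zero_mul, he, e2] at e1
  rcases mul_eq_zero.mp e1 with h | h
  · exact h
  · exfalso
    obtain ⟨p, hp, hp0⟩ := Finset.prod_eq_zero_iff.mp h
    have hpp := Nat.prime_of_mem_primeFactors hp
    have : ‖χ2 p * (p : ℂ) ^ (-(β : ℂ))‖ < 1 := by
      rw [norm_mul]
      have h1 : ‖(p : ℂ) ^ (-(β : ℂ))‖ < 1 := by
        rw [Complex.norm_natCast_cpow_of_pos hpp.pos]
        simp only [neg_re, ofReal_re]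
        exact Real.rpow_lt_one_of_one_lt_of_neg (by exact_mod_cast hpp.one_lt) (by linarith)
      have h2 := χ2.norm_le_one (p : ZMod q2)
      nlinarith [norm_nonneg ((p : ℂ) ^ (-(β : ℂ)))]
    rw [sub_eq_zero] at hp0
    rw [← hp0, norm_one] at this
    exact lt_irrefl _ this

lemma pair_apply {q1 q2 : ℕ} [NeZero q1] [NeZero q2] (χ1 : DirichletCharacter ℂ q1)
    (χ2 : DirichletCharacter ℂ q2) (n : ℕ) :
    (changeLevel (dvd_mul_right q1 q2) χ1 * changeLevel (dvd_mul_left q2 q1) χ2) n = χ1 n * χ2 n := by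
  by_cases h : IsUnit (n : ZMod (q1 * q2))
  · have a := changeLevel_eq_cast_of_dvd χ1 (dvd_mul_right q1 q2) h.unit
    have b := changeLevel_eq_cast_of_dvd χ2 (dvd_mul_left q2 q1) h.unit
    simp only [IsUnit.unit_spec] at a b
    rw [MulChar.mul_apply, a, b, ZMod.cast_natCast (dvd_mul_right q1 q2),
      ZMod.cast_natCast (dvd_mul_left q2 q1)]
  · rw [MulChar.map_nonunit _ h]
    rw [ZMod.isUnit_iff_coprime, Nat.coprime_mul_iff_right, not_and_or] at h
    rcases h with h | h
    · rw [MulChar.map_nonunit χ1 (by rwa [ZMod.isUnit_iff_coprime]), zero_mul]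
    · rw [MulChar.map_nonunit χ2 (by rwa [ZMod.isUnit_iff_coprime]), mul_zero]

lemma siegel_pow {K Q e ε : ℝ} (hK : 1 ≤ K) (hQ : 1 ≤ Q) (he0 : 0 ≤ e) (he : e ≤ ε) :
    K ^ (-ε) * Q ^ (-ε) ≤ (K * Q) ^ (-e) := by
  rw [← Real.mul_rpow (by positivity) (by positivity)]
  exact Real.rpow_le_rpow_of_exponent_le (one_le_mul_of_one_le_of_one_le hK hQ) (by linarith)

theorem siegel {ε : ℝ} (hε : 0 < ε) (hε1 : ε ≤ 1) : ∃ c : ℝ, 0 < c ∧ ∀ (q : ℕ) [NeZero q]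
    (χ : DirichletCharacter ℂ q), χ ^ 2 = 1 → χ ≠ 1 →
    c * (q : ℝ) ^ (-ε) ≤ (LFunction χ 1).re := by
  obtain ⟨δ0, hδ0, hδ8, K, hK, hE⟩ := E1
  obtain ⟨K2, hK2, hE2⟩ := E2
  obtain ⟨C, hC, hLB⟩ := L_one_bound (ε / 2) (by linarith) (by linarith)
  have hqq : ∀ (q : ℕ) [NeZero q], (1 : ℝ) ≤ q := fun q _ => by
    exact_mod_cast Nat.one_le_iff_ne_zero.mpr (NeZero.ne q)
  set δ := min δ0 (ε / 16) with hδ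
  have hδpos : 0 < δ := by positivity
  have hδa : δ ≤ δ0 := min_le_left _ _
  have hδb : δ ≤ ε / 16 := min_le_right _ _
  by_cases hA : ∀ (q : ℕ) [NeZero q] (χ : DirichletCharacter ℂ q), χ ^ 2 = 1 → χ ≠ 1 →
    0 ≤ (LFunction χ ((1 - δ : ℝ) : ℂ)).re
  · refine ⟨δ / 4 * K ^ (-ε), by positivity, fun q _ χ h2 h1 => ?_⟩
    refine le_trans ?_ (hE q χ h2 h1 (1 - δ) (by linarith) (by linarith) (hA q χ h2 h1))
    have := siegel_pow hK (hqq q) (e := 4 * (1 - (1 - δ))) (ε := ε) (by linarith) (by linarith)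
    rw [mul_assoc, sub_sub_cancel] at *
    gcongr
  push Not at hA
  obtain ⟨q1, hq1, χ1, hs1, hn1, hneg⟩ := hA
  obtain ⟨β, hβ, hβz⟩ : ∃ β ∈ Set.Ioo (1 - δ) 1, (LFunction χ1 (β : ℂ)).re = 0 := by
    have hc : Continuous (fun x : ℝ => (LFunction χ1 x).re) :=
      continuous_re.comp ((differentiable_LFunction hn1).continuous.comp continuous_ofReal)
    have := intermediate_value_Ioo (show 1 - δ ≤ 1 by linarith) hc.continuousOn
    have h0 := this (show (0 : ℝ) ∈ _ from ⟨hneg, by simpa using L_one_pos χ1 hs1 hn1⟩)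
    obtain ⟨x, hx, h⟩ := h0
    exact ⟨x, hx, h⟩
  have hβ1 : 1 - δ < β := hβ.1
  have hβ2 : β < 1 := hβ.2
  have hz : LFunction χ1 β = 0 := Complex.ext (by simpa using hβz)
    (by simpa using L_real χ1 hn1 hs1 (by linarith))
  have hβp : 0 < 1 - β := by linarith
  have hq1p := hqq q1
  set c1 := (1 - β) / 4 * K ^ (-ε) with hc1
  set c2 := (1 - β) / 4 * (K2 * (q1 * q1)) ^ (-(ε / 4)) / (C * q1 ^ (ε / 2) * (C * q1 ^ (ε / 2))) with hc2
  have hc1p : 0 < c1 := by positivity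
  have hc2p : 0 < c2 := by positivity
  refine ⟨min c1 c2, by positivity, fun q _ χ h2 h1 => ?_⟩
  have hqp := hqq q
  by_cases hpr : changeLevel (dvd_mul_right q1 q) χ1 * changeLevel (dvd_mul_left q q1) χ = 1
  · have hz2 := pair_principal χ1 χ hs1 hn1 h1 hpr (by linarith) hz
    calc min c1 c2 * (q : ℝ) ^ (-ε) ≤ c1 * (q : ℝ) ^ (-ε) := by gcongr; exact min_le_left _ _
      _ ≤ (1 - β) / 4 * (K * q) ^ (-(4 * (1 - β))) := by
        rw [hc1, mul_assoc]; gcongr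
        exact siegel_pow hK hqp (by linarith) (by linarith)
      _ ≤ _ := hE q χ h2 h1 β (by linarith) hβ2 (by rw [hz2]; simp)
  · have hb := hE2 q1 q (q1 * q) χ1 χ _ (pair_apply χ1 χ) hs1 hn1 h2 h1 hpr β (by linarith) hβ2 hz
    set χ3 := changeLevel (dvd_mul_right q1 q) χ1 * changeLevel (dvd_mul_left q q1) χ with hχ3
    have hre : (LFunction χ1 1 * LFunction χ 1 * LFunction χ3 1).re ≤
        (C * q1 ^ (ε / 2)) * (LFunction χ 1).re * (C * ((q1 * q : ℕ) : ℝ) ^ (ε / 2)) := by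
      refine (re_le_norm _).trans ?_
      rw [norm_mul, norm_mul]
      have : ‖LFunction χ 1‖ = (LFunction χ 1).re := by
        have him := L_real χ h1 h2 (x := 1) one_pos
        have : LFunction χ 1 = ((LFunction χ 1).re : ℂ) := Complex.ext (by simp) (by simpa using him)
        rw [this, Complex.norm_real, ofReal_re, Real.norm_eq_abs, abs_of_pos (L_one_pos χ h2 h1)]
      rw [this]
      have := L_one_pos χ h2 h1
      gcongr
      · exact hLB q1 χ1 hn1
      · exact hLB (q1 * q) χ3 hpr
    have hb2 := hb.trans hre
    push_cast at hb2
    have hpw := siegel_pow (K := K2 * (q1 * q1)) (Q := (q : ℝ) * q) (e := 4 * (1 - β)) (ε := ε / 4)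
      (one_le_mul_of_one_le_of_one_le hK2 (one_le_mul_of_one_le_of_one_le hq1p hq1p))
      (one_le_mul_of_one_le_of_one_le hqp hqp) (by linarith) (by linarith)
    have e1 : K2 * ((q1 : ℝ) * q * (q1 * q)) = K2 * (q1 * q1) * (q * q) := by ring
    rw [e1] at hb2
    have e2 : ((q : ℝ) * q) ^ (-(ε / 4)) = (q : ℝ) ^ (-(ε / 2)) := by
      rw [Real.mul_rpow (by positivity) (by positivity), ← Real.rpow_add (by positivity)]; ring_nf
    rw [e2] at hpw
    have hb3 : (1 - β) / 4 * ((K2 * (q1 * q1)) ^ (-(ε / 4)) * (q : ℝ) ^ (-(ε / 2))) ≤ _ :=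
      le_trans (by gcongr) hb2
    have e3 : ((q1 : ℝ) * q) ^ (ε / 2) = (q1 : ℝ) ^ (ε / 2) * (q : ℝ) ^ (ε / 2) :=
      Real.mul_rpow (by positivity) (by positivity)
    have e4 : (q : ℝ) ^ (-ε) = (q : ℝ) ^ (-(ε / 2)) * ((q : ℝ) ^ (ε / 2))⁻¹ := by
      rw [← Real.rpow_neg (by positivity), ← Real.rpow_add (by positivity)]; ring_nf
    rw [e3] at hb3
    calc min c1 c2 * (q : ℝ) ^ (-ε) ≤ c2 * (q : ℝ) ^ (-ε) := by gcongr; exact min_le_right _ _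
      _ = (1 - β) / 4 * ((K2 * (q1 * q1)) ^ (-(ε / 4)) * (q : ℝ) ^ (-(ε / 2))) /
          (C * q1 ^ (ε / 2) * (C * (q1 ^ (ε / 2) * (q : ℝ) ^ (ε / 2)))) := by
        rw [hc2, e4]; field_simp
      _ ≤ _ := by
        rw [div_le_iff₀ (by positivity)]
        linarith
end

noncomputable section

lemma divisor_bound {ε : ℝ} (hε : 0 < ε) : ∃ C : ℝ, 1 ≤ C ∧ ∀ n : ℕ, n ≠ 0 →
    (n.divisors.card : ℝ) ≤ C * (n : ℝ) ^ ε := by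
  have h2 : (1 : ℝ) < 2 ^ ε := Real.one_lt_rpow (by norm_num) hε
  set b : ℝ := 2 ^ ε - 1 with hb
  have hb0 : 0 < b := by linarith
  set M : ℝ := max 1 (1 / b) with hM
  have hM1 : 1 ≤ M := le_max_left _ _
  have hMb : 1 ≤ M * b := by
    have : 1 / b ≤ M := le_max_right _ _
    rwa [div_le_iff₀ hb0] at this
  obtain ⟨N, hN⟩ := exists_nat_ge ((2 : ℝ) ^ (1 / ε))
  refine ⟨M ^ N, one_le_pow₀ hM1, fun n hn => ?_⟩
  have hpf : ∀ p ∈ n.primeFactors, ((n.factorization p + 1 : ℕ) : ℝ) ≤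
      (if p < N then M else 1) * (((p : ℝ) ^ n.factorization p) ^ ε) := by
    intro p hp
    have hpp := Nat.prime_of_mem_primeFactors hp
    set a := n.factorization p
    have e : ((p : ℝ) ^ a) ^ ε = ((p : ℝ) ^ ε) ^ a := by
      rw [← Real.rpow_natCast, ← Real.rpow_mul (by positivity), mul_comm, Real.rpow_mul (by positivity),
        Real.rpow_natCast]
    rw [e]
    split_ifs with h
    · have h3 : (2 : ℝ) ^ ε ≤ (p : ℝ) ^ ε := by
        gcongr; exact_mod_cast hpp.two_le
      have h4 : 1 + (a : ℝ) * b ≤ ((2 : ℝ) ^ ε) ^ a := by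
        have := one_add_mul_le_pow (show (-2 : ℝ) ≤ b by linarith) a
        simpa [hb] using this
      calc ((a + 1 : ℕ) : ℝ) ≤ M * (1 + a * b) := by
            push_cast
            have : (a : ℝ) * 1 ≤ a * (M * b) := by gcongr
            linarith
        _ ≤ M * ((2 : ℝ) ^ ε) ^ a := by gcongr
        _ ≤ _ := by gcongr
    · have h3 : (2 : ℝ) ≤ (p : ℝ) ^ ε := by
        calc (2 : ℝ) = ((2 : ℝ) ^ (1 / ε)) ^ ε := by
              rw [← Real.rpow_mul (by norm_num), one_div_mul_cancel hε.ne', Real.rpow_one]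
          _ ≤ (p : ℝ) ^ ε := by
              gcongr
              exact hN.trans (by exact_mod_cast not_lt.mp h)
      rw [one_mul]
      calc ((a + 1 : ℕ) : ℝ) ≤ ((2 ^ a : ℕ) : ℝ) := by
            exact_mod_cast Nat.lt_two_pow_self
        _ = (2 : ℝ) ^ a := by push_cast; rfl
        _ ≤ _ := by gcongr
  rw [Nat.card_divisors hn]
  push_cast
  calc ∏ p ∈ n.primeFactors, ((n.factorization p : ℝ) + 1)
      ≤ ∏ p ∈ n.primeFactors, ((if p < N then M else 1) * (((p : ℝ) ^ n.factorization p) ^ ε)) := by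
        refine Finset.prod_le_prod (fun _ _ => by positivity) fun p hp => ?_
        exact_mod_cast hpf p hp
    _ = (∏ p ∈ n.primeFactors, (if p < N then M else 1)) *
        ∏ p ∈ n.primeFactors, (((p : ℝ) ^ n.factorization p) ^ ε) := Finset.prod_mul_distrib
    _ ≤ M ^ N * (n : ℝ) ^ ε := by
        gcongr
        · rw [Finset.prod_ite, Finset.prod_const, Finset.prod_const_one, mul_one]
          refine pow_le_pow_right₀ hM1 ?_
          calc _ ≤ (Finset.range N).card := Finset.card_le_card fun x hx => by
                simpa using (Finset.mem_filter.mp hx).2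
            _ = N := Finset.card_range N
        · rw [Real.finsetProd_rpow _ _ (fun _ _ => by positivity)]
          have := Nat.prod_factorization_pow_eq_self hn
          conv_rhs => rw [← this]
          rw [Finsupp.prod]; push_cast; simp

end

noncomputable section

def S2 (m : ℕ) : Set GaussianInt := {z | z.norm = m}

lemma gi_norm_mul (z w : GaussianInt) : (z * w).norm = z.norm * w.norm := Zsqrtd.norm_mul z w

lemma gi_norm_star (z : GaussianInt) : (star z).norm = z.norm := Zsqrtd.norm_conj z

lemma gi_norm_def (z : GaussianInt) : z.norm = z.re * z.re + z.im * z.im := by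
  rw [Zsqrtd.norm_def]; ring

lemma S2_peel {p : ℕ} (hp : p.Prime) : ∃ π : GaussianInt, ∀ k m' : ℕ, ¬ p ∣ m' → ∀ z ∈ S2 (p ^ k * m'),
    ∃ a ∈ Finset.range (k + 1), ∃ b ∈ Finset.range (k + 1), ∃ z' ∈ S2 m', π ^ a * star π ^ b * z' = z := by
  have hnu : ¬ IsUnit (p : GaussianInt) := by
    rw [← Zsqrtd.norm_eq_one_iff, Zsqrtd.norm_natCast]
    have := hp.one_lt
    intro h
    rw [Int.natAbs_mul, Int.natAbs_natCast] at h
    have := Nat.eq_one_of_mul_eq_one_left h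
    omega
  have hp0 : (p : GaussianInt) ≠ 0 := by exact_mod_cast hp.ne_zero
  obtain ⟨π, hπ, hdvd⟩ := WfDvdMonoid.exists_irreducible_factor hnu hp0
  have hprime : Prime π := hπ.prime
  have hNpos : 0 ≤ π.norm := by rw [gi_norm_def]; nlinarith [mul_self_nonneg π.re, mul_self_nonneg π.im]
  obtain ⟨Nn, hNn⟩ := Int.eq_ofNat_of_zero_le hNpos
  have hN : Nn = p ∨ Nn = p ^ 2 := by
    have h1 : π.norm ∣ (p : GaussianInt).norm := map_dvd Zsqrtd.normMonoidHom hdvd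
    rw [Zsqrtd.norm_natCast, hNn] at h1
    have h2 : Nn ∣ p ^ 2 := by rw [sq]; exact_mod_cast h1
    obtain ⟨j, hj, rfl⟩ := (Nat.dvd_prime_pow hp).mp h2
    interval_cases j
    · exfalso; apply hπ.not_isUnit
      rw [← Zsqrtd.norm_eq_one_iff, hNn]; simp
    · left; simp
    · right; rfl
  refine ⟨π, ?_⟩
  intro k
  induction k using Nat.strong_induction_on with
  | _ k ih =>
  intro m' hm' z hz
  rcases Nat.eq_zero_or_pos k with rfl | hk
  · exact ⟨0, by simp, 0, by simp, z, by simpa using hz, by simp⟩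
  have hz' : z.norm = ((p ^ k * m' : ℕ) : ℤ) := hz
  -- divide lemma
  have hdiv : ∀ ρ w : GaussianInt, ρ.norm = Nn → (ρ * w).norm = ((p ^ k * m' : ℕ) : ℤ) →
      ∃ j < k, w ∈ S2 (p ^ j * m') := by
    intro ρ w hρ hw
    rw [gi_norm_mul, hρ] at hw
    rcases hN with h | h
    · refine ⟨k - 1, by omega, ?_⟩
      obtain ⟨k', rfl⟩ : ∃ k', k = k' + 1 := ⟨k - 1, by omega⟩
      have : (p : ℤ) ≠ 0 := by exact_mod_cast hp.ne_zero
      change w.norm = _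
      apply mul_left_cancel₀ this
      rw [h] at hw; rw [hw]; push_cast; ring
    · have hk2 : 2 ≤ k := by
        by_contra hlt
        have hk1 : k = 1 := by omega
        subst hk1
        apply hm'
        have hpz : (p : ℤ) ≠ 0 := by exact_mod_cast hp.ne_zero
        rw [h] at hw
        have : (m' : ℤ) = p * w.norm := by
          apply mul_left_cancel₀ hpz
          push_cast at hw; linear_combination -hw
        exact_mod_cast Dvd.intro _ this.symm
      refine ⟨k - 2, by omega, ?_⟩
      obtain ⟨k', rfl⟩ : ∃ k', k = k' + 2 := ⟨k - 2, by omega⟩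
      have : ((p : ℤ) ^ 2) ≠ 0 := pow_ne_zero _ (by exact_mod_cast hp.ne_zero)
      change w.norm = _
      apply mul_left_cancel₀ this
      rw [h] at hw; push_cast at hw ⊢; rw [hw]; ring
  have hzz : π ∣ z * star z := by
    rw [← Zsqrtd.norm_eq_mul_conj, hz']
    refine hdvd.trans ?_
    obtain ⟨k', rfl⟩ : ∃ k', k = k' + 1 := ⟨k - 1, by omega⟩
    refine ⟨((p ^ k' * m' : ℕ) : GaussianInt), ?_⟩
    push_cast; ring
  rcases hprime.dvd_or_dvd hzz with h | h
  · obtain ⟨w, rfl⟩ := h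
    obtain ⟨j, hj, hw⟩ := hdiv π w hNn hz'
    obtain ⟨a, ha, b, hb, z', h1, h2⟩ := ih j hj m' hm' w hw
    simp only [Finset.mem_range] at ha hb
    refine ⟨a + 1, by simp; omega, b, by simp; omega, z', h1, ?_⟩
    rw [← h2]; ring
  · obtain ⟨w, hw0⟩ := h
    have hz2 : z = star π * star w := by rw [← star_star z, hw0, star_mul, mul_comm]
    obtain ⟨j, hj, hw⟩ := hdiv (star π) (star w) (by rw [gi_norm_star, hNn]) (hz2 ▸ hz')
    obtain ⟨a, ha, b, hb, z', h1, h2⟩ := ih j hj m' hm' _ hw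
    simp only [Finset.mem_range] at ha hb
    refine ⟨a, by simp; omega, b + 1, by simp; omega, z', h1, ?_⟩
    rw [hz2, ← h2]; ring

lemma S2_bound (m : ℕ) (hm : m ≠ 0) : (S2 m).Finite ∧ (S2 m).ncard ≤ 9 * m.divisors.card ^ 2 := by
  induction m using Nat.recOnPrimePow with
  | zero => exact absurd rfl hm
  | one =>
    have hsub : S2 1 ⊆ (fun x : ℤ × ℤ => (⟨x.1, x.2⟩ : GaussianInt)) ''
        ((Finset.Icc (-1 : ℤ) 1 ×ˢ Finset.Icc (-1 : ℤ) 1 : Finset (ℤ × ℤ)) : Set (ℤ × ℤ)) := by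
      intro z hz
      have h : z.norm = 1 := by simpa [S2] using hz
      rw [gi_norm_def] at h
      refine ⟨(z.re, z.im), ?_, rfl⟩
      simp only [Finset.coe_product, Set.mem_prod, Finset.mem_coe, Finset.mem_Icc]
      refine ⟨⟨?_, ?_⟩, ?_, ?_⟩ <;> nlinarith
    have hf := (Finset.finite_toSet (Finset.Icc (-1 : ℤ) 1 ×ˢ Finset.Icc (-1 : ℤ) 1)).image
      (fun x : ℤ × ℤ => (⟨x.1, x.2⟩ : GaussianInt))
    refine ⟨hf.subset hsub, (Set.ncard_le_ncard hsub hf).trans ((Set.ncard_image_le (Finset.finite_toSet _)).trans ?_)⟩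
    rw [Set.ncard_coe_finset]; decide
  | prime_pow_mul a p n hp hpa hn ih =>
    have ha : a ≠ 0 := by rintro rfl; simp at hpa
    obtain ⟨hf, hc⟩ := ih ha
    obtain ⟨π, hπ⟩ := S2_peel hp
    set T : Set (ℕ × ℕ × GaussianInt) :=
      ((Finset.range (n + 1) : Finset ℕ) : Set ℕ) ×ˢ (((Finset.range (n + 1) : Finset ℕ) : Set ℕ) ×ˢ S2 a) with hT
    have hTf : T.Finite := (Finset.finite_toSet _).prod ((Finset.finite_toSet _).prod hf)
    have hsub : S2 (p ^ n * a) ⊆ (fun x : ℕ × ℕ × GaussianInt => π ^ x.1 * star π ^ x.2.1 * x.2.2) '' T := by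
      intro z hz
      obtain ⟨i, hi, j, hj, z', h1, h2⟩ := hπ n a hpa z hz
      exact ⟨(i, j, z'), ⟨hi, hj, h1⟩, h2⟩
    refine ⟨(hTf.image _).subset hsub,
      (Set.ncard_le_ncard hsub (hTf.image _)).trans ((Set.ncard_image_le hTf).trans ?_)⟩
    have hcop : (p ^ n).Coprime a := Nat.Coprime.pow_left _ ((Nat.Prime.coprime_iff_not_dvd hp).mpr hpa)
    rw [hcop.card_divisors_mul, hT, Set.ncard_prod, Set.ncard_prod, Set.ncard_coe_finset,
      Finset.card_range, Nat.divisors_prime_pow hp, Finset.card_map, Finset.card_range]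
    calc (n + 1) * ((n + 1) * (S2 a).ncard) ≤ (n + 1) * ((n + 1) * (9 * a.divisors.card ^ 2)) := by gcongr
      _ = _ := by ring

/-- integer vectors of norm `D` in `ℤ³` -/
def S3 (D : ℕ) : Set (ℤ × ℤ × ℤ) := {v | v.1 ^ 2 + v.2.1 ^ 2 + v.2.2 ^ 2 = D}

lemma S2_zero : S2 0 = {0} := by
  ext z
  simp only [S2, Nat.cast_zero, Set.mem_singleton_iff]
  constructor
  · intro h
    have h : z.norm = 0 := h
    rw [gi_norm_def] at h
    have h1 : z.re = 0 := by nlinarith [mul_self_nonneg z.re, mul_self_nonneg z.im]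
    have h2 : z.im = 0 := by nlinarith [mul_self_nonneg z.re, mul_self_nonneg z.im]
    exact Zsqrtd.ext h1 h2
  · rintro rfl; change Zsqrtd.norm 0 = 0; simp

lemma S2_fin (m : ℕ) : (S2 m).Finite := by
  rcases eq_or_ne m 0 with rfl | h
  · rw [S2_zero]; exact Set.finite_singleton _
  · exact (S2_bound m h).1

lemma S3_bound {ε : ℝ} (hε : 0 < ε) : ∃ C : ℝ, 0 < C ∧ ∀ D : ℕ, D ≠ 0 →
    (S3 D).Finite ∧ ((S3 D).ncard : ℝ) ≤ C * (D : ℝ) ^ (1 / 2 + ε) := by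
  obtain ⟨C, hC, hd⟩ := divisor_bound (ε := ε / 2) (by linarith)
  refine ⟨27 * C ^ 2, by positivity, fun D hD => ?_⟩
  have hD1 : (1 : ℝ) ≤ D := by exact_mod_cast Nat.one_le_iff_ne_zero.mpr hD
  set s : ℤ := ((Nat.sqrt D : ℕ) : ℤ) with hs
  have hsub : S3 D ⊆ ⋃ x ∈ Finset.Icc (-s) s,
      (fun z : GaussianInt => (x, z.re, z.im)) '' S2 (D - x.natAbs ^ 2) := by
    rintro ⟨x, y, z⟩ h
    have h : x ^ 2 + y ^ 2 + z ^ 2 = D := h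
    have hx : x.natAbs ^ 2 ≤ D := by
      zify; rw [sq_abs]; nlinarith
    have hx2 : x.natAbs ≤ Nat.sqrt D := Nat.le_sqrt'.mpr hx
    simp only [Set.mem_iUnion]
    refine ⟨x, by rw [Finset.mem_Icc]; omega, ⟨y, z⟩, ?_, rfl⟩
    change Zsqrtd.norm _ = _
    rw [gi_norm_def]; push_cast [Nat.cast_sub hx]; rw [sq_abs]; linarith
  have hfin : ∀ x : ℤ, ((fun z : GaussianInt => (x, z.re, z.im)) '' S2 (D - x.natAbs ^ 2)).Finite :=
    fun x => (S2_fin _).image _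
  have hF : (⋃ x ∈ Finset.Icc (-s) s,
      (fun z : GaussianInt => (x, z.re, z.im)) '' S2 (D - x.natAbs ^ 2)).Finite :=
    (Finset.finite_toSet _).biUnion fun x _ => hfin x
  refine ⟨hF.subset hsub, ?_⟩
  have h1 : ∀ x : ℤ, (((fun z : GaussianInt => (x, z.re, z.im)) '' S2 (D - x.natAbs ^ 2)).ncard : ℝ) ≤
      9 * C ^ 2 * (D : ℝ) ^ ε := by
    intro x
    have h2 : (((fun z : GaussianInt => (x, z.re, z.im)) '' S2 (D - x.natAbs ^ 2)).ncard : ℝ) ≤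
      (S2 (D - x.natAbs ^ 2)).ncard := by exact_mod_cast Set.ncard_image_le (S2_fin _)
    refine h2.trans ?_
    have hDε : 1 ≤ (D : ℝ) ^ ε := Real.one_le_rpow hD1 hε.le
    rcases eq_or_ne (D - x.natAbs ^ 2) 0 with h0 | h0
    · rw [h0, S2_zero, Set.ncard_singleton]
      have : 1 ≤ C ^ 2 := one_le_pow₀ hC
      push_cast; nlinarith
    · have h3 := (S2_bound _ h0).2
      calc ((S2 (D - x.natAbs ^ 2)).ncard : ℝ) ≤ 9 * ((D - x.natAbs ^ 2).divisors.card : ℝ) ^ 2 := by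
            exact_mod_cast h3
        _ ≤ 9 * (C * ((D - x.natAbs ^ 2 : ℕ) : ℝ) ^ (ε / 2)) ^ 2 := by gcongr; exact hd _ h0
        _ ≤ 9 * (C * (D : ℝ) ^ (ε / 2)) ^ 2 := by
            gcongr; exact Nat.sub_le _ _
        _ = 9 * C ^ 2 * (D : ℝ) ^ ε := by
            rw [mul_pow, ← Real.rpow_natCast ((D : ℝ) ^ (ε / 2)), ← Real.rpow_mul (by positivity)]
            norm_num; ring
  have h4 : (S3 D).ncard ≤ ∑ x ∈ Finset.Icc (-s) s,
      ((fun z : GaussianInt => (x, z.re, z.im)) '' S2 (D - x.natAbs ^ 2)).ncard :=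
    (Set.ncard_le_ncard hsub hF).trans (Finset.set_ncard_biUnion_le _ _)
  calc ((S3 D).ncard : ℝ) ≤ ∑ x ∈ Finset.Icc (-s) s,
      (((fun z : GaussianInt => (x, z.re, z.im)) '' S2 (D - x.natAbs ^ 2)).ncard : ℝ) := by exact_mod_cast h4
    _ ≤ ∑ x ∈ Finset.Icc (-s) s, 9 * C ^ 2 * (D : ℝ) ^ ε := Finset.sum_le_sum fun x _ => h1 x
    _ = (2 * Nat.sqrt D + 1 : ℝ) * (9 * C ^ 2 * (D : ℝ) ^ ε) := by
        rw [Finset.sum_const, nsmul_eq_mul, Int.card_Icc]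
        congr 1
        have : (s + 1 - -s).toNat = 2 * Nat.sqrt D + 1 := by omega
        rw [this]; push_cast; ring
    _ ≤ (3 * (D : ℝ) ^ (1 / 2 : ℝ)) * (9 * C ^ 2 * (D : ℝ) ^ ε) := by
        gcongr
        have h5 : (Nat.sqrt D : ℝ) ≤ (D : ℝ) ^ (1 / 2 : ℝ) := by
          rw [← Real.sqrt_eq_rpow]; exact Real.nat_sqrt_le_real_sqrt
        have h6 : 1 ≤ (D : ℝ) ^ (1 / 2 : ℝ) := Real.one_le_rpow hD1 (by norm_num)
        linarith
    _ = _ := by rw [Real.rpow_add (by positivity)]; ring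
end

noncomputable section
open Matrix

lemma shift_red (a f : ℤ) (ha : 0 < a) : ∃ k : ℤ, 2 * (f + k * a) ≤ a ∧ -a ≤ 2 * (f + k * a) := by
  refine ⟨-((2 * f + a) / (2 * a)), ?_⟩
  have h1 := Int.emod_add_mul_ediv (2 * f + a) (2 * a)
  have h2 := Int.emod_nonneg (2 * f + a) (show 2 * a ≠ 0 by omega)
  have h3 := Int.emod_lt_of_pos (2 * f + a) (show 0 < 2 * a by omega)
  constructor <;> nlinarith

lemma bin_one : ∀ (N : ℕ) (a b c : ℤ), b.natAbs ≤ N → 0 < a → a * c - b ^ 2 = 1 →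
    ∃ p q r s : ℤ, a = p ^ 2 + r ^ 2 ∧ b = p * q + r * s ∧ c = q ^ 2 + s ^ 2 := by
  intro N
  induction N with
  | zero =>
    intro a b c hb ha h
    have hb0 : b = 0 := by omega
    subst hb0
    have h1 : a * c = 1 := by linarith
    have h2 : a = 1 := Int.eq_one_of_mul_eq_one_right ha.le h1
    subst h2
    exact ⟨1, 0, 0, 1, by norm_num, by norm_num, by linarith⟩
  | succ N ih =>
    have key : ∀ a b c : ℤ, b.natAbs ≤ N + 1 → 0 < a → a ≤ c → a * c - b ^ 2 = 1 →
        ∃ p q r s : ℤ, a = p ^ 2 + r ^ 2 ∧ b = p * q + r * s ∧ c = q ^ 2 + s ^ 2 := by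
      intro a b c hb ha hac h
      rcases lt_trichotomy b 0 with hb0 | hb0 | hb0
      · have hab : a ≤ -b := by nlinarith
        obtain ⟨p, q, r, s, h1, h2, h3⟩ := ih a (b + a) (c + 2 * b + a) (by omega) ha (by nlinarith)
        exact ⟨p, q - p, r, s - r, h1, by linear_combination h2 - h1, by linear_combination h3 - 2 * h2 + h1⟩
      · exact ih a b c (by omega) ha h
      · have hab : a ≤ b := by nlinarith
        obtain ⟨p, q, r, s, h1, h2, h3⟩ := ih a (b - a) (c - 2 * b + a) (by omega) ha (by nlinarith)
        exact ⟨p, q + p, r, s + r, h1, by linear_combination h2 + h1, by linear_combination h3 + 2 * h2 + h1⟩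
    intro a b c hb ha h
    have hc : 0 < c := by
      by_contra hc
      nlinarith [sq_nonneg b]
    rcases le_total a c with hac | hac
    · exact key a b c hb ha hac h
    · obtain ⟨p, q, r, s, h1, h2, h3⟩ := key c b a hb hc hac (by linarith)
      exact ⟨q, p, s, r, h3, by linarith, h1⟩

lemma bin_red : ∀ (N : ℕ) (a b c : ℤ), a.natAbs ≤ N → 0 < a → 0 < a * c - b ^ 2 →
    ∃ y z : ℤ, IsCoprime y z ∧ 0 < a * y ^ 2 + 2 * b * y * z + c * z ^ 2 ∧
      3 * (a * y ^ 2 + 2 * b * y * z + c * z ^ 2) ^ 2 ≤ 4 * (a * c - b ^ 2) := by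
  intro N
  induction N with
  | zero => intro a b c h1 h2; omega
  | succ N ih =>
    intro a b c hN ha hD
    obtain ⟨k, hk1, hk2⟩ := shift_red a b ha
    set b' := b + k * a with hb'
    set c' := c + 2 * k * b + k ^ 2 * a with hc'
    have hdet : a * c' - b' ^ 2 = a * c - b ^ 2 := by rw [hb', hc']; ring
    have hc0 : 0 < c' := by
      by_contra hc
      nlinarith [sq_nonneg b']
    by_cases hac : a ≤ c'
    · refine ⟨1, 0, isCoprime_one_left, by linarith, ?_⟩
      rw [← hdet]
      have : 4 * b' ^ 2 ≤ a ^ 2 := by nlinarith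
      nlinarith
    · obtain ⟨y, z, h1, h2, h3⟩ := ih c' b' a (by omega) hc0 (by linarith)
      have e : a * (z + k * y) ^ 2 + 2 * b * (z + k * y) * y + c * y ^ 2
        = c' * y ^ 2 + 2 * b' * y * z + a * z ^ 2 := by rw [hb', hc']; ring
      refine ⟨z + k * y, y, ?_, by rw [e]; exact h2, by rw [e]; linarith⟩
      exact (IsCoprime.add_mul_right_left h1.symm k)

def T3 (a b c d e f : ℤ) : Matrix (Fin 3) (Fin 3) ℤ := !![a, f, e; f, b, d; e, d, c]

lemma gram_of_conj (A U : Matrix (Fin 3) (Fin 3) ℤ) (hU : IsUnit U.det)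
    (h : ∃ M : Matrix (Fin 3) (Fin 3) ℤ, Uᵀ * A * U = Mᵀ * M) : ∃ M : Matrix (Fin 3) (Fin 3) ℤ, A = Mᵀ * M := by
  obtain ⟨M, hM⟩ := h
  refine ⟨M * U⁻¹, ?_⟩
  have h1 : U * U⁻¹ = 1 := Matrix.mul_nonsing_inv _ hU
  have h2 : U⁻¹ᵀ * Uᵀ = 1 := by rw [← Matrix.transpose_mul, h1, Matrix.transpose_one]
  calc A = (U⁻¹ᵀ * Uᵀ) * A * (U * U⁻¹) := by rw [h1, h2]; simp
    _ = U⁻¹ᵀ * (Uᵀ * A * U) * U⁻¹ := by simp only [Matrix.mul_assoc]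
    _ = _ := by rw [hM]; simp only [Matrix.mul_assoc, Matrix.transpose_mul]

lemma tern_aux (a g G Q : ℤ) (h6 : 2 ≤ a) (haQ : a * Q = g ^ 2 + G) (hG2 : 3 * G ^ 2 ≤ 4 * a)
    (h4 : 4 * g ^ 2 ≤ a ^ 2) : Q < a := by
  by_contra h
  push Not at h
  have h0 : a * a ≤ a * Q := by gcongr
  have h5 : 3 * a ^ 2 ≤ 4 * G := by nlinarith
  have h7 : (3 * a ^ 2) ^ 2 ≤ (4 * G) ^ 2 := pow_le_pow_left₀ (by positivity) h5 2
  have h8 : a * (27 * a ^ 3) ≤ a * 64 := by linarith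
  have h9 : a ^ 3 ≥ 2 ^ 3 := pow_le_pow_left₀ (by norm_num) h6 3
  have h10 := le_of_mul_le_mul_left h8 (by omega)
  linarith

set_option maxHeartbeats 1000000 in
lemma tern : ∀ (N : ℕ) (a b c d e f : ℤ), a.natAbs ≤ N → 0 < a → 0 < a * b - f ^ 2 →
    a * b * c + 2 * d * e * f - a * d ^ 2 - b * e ^ 2 - c * f ^ 2 = 1 →
    ∃ M : Matrix (Fin 3) (Fin 3) ℤ, T3 a b c d e f = Mᵀ * M := by
  intro N
  induction N with
  | zero => intro a b c d e f h1 h2; omega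
  | succ N ih =>
    intro a b c d e f hN ha hG hdet
    by_cases ha1 : a = 1
    · subst ha1
      obtain ⟨p, q, r, s, h1, h2, h3⟩ := bin_one _ (b - f ^ 2) (d - e * f) (c - e ^ 2) le_rfl
        (by linarith) (by linear_combination hdet)
      refine ⟨!![1, f, e; 0, p, q; 0, r, s], ?_⟩
      ext i j
      fin_cases i <;> fin_cases j <;> simp [T3, Matrix.mul_apply, Fin.sum_univ_three] <;> linarith
    · have hGd : (a * b - f ^ 2) * (a * c - e ^ 2) - (a * d - e * f) ^ 2 = a := by
        linear_combination a * hdet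
      obtain ⟨y, z, hyz, hG1, hG2⟩ := bin_red _ (a * b - f ^ 2) (a * d - e * f) (a * c - e ^ 2) le_rfl hG
        (by linarith)
      rw [hGd] at hG2
      obtain ⟨z', y', hy'⟩ := hyz
      obtain ⟨k, hk1, hk2⟩ := shift_red a (f * y + e * z) ha
      set G := (a * b - f ^ 2) * y ^ 2 + 2 * (a * d - e * f) * y * z + (a * c - e ^ 2) * z ^ 2 with hGdef
      set g := f * y + e * z + k * a with hg
      set Q := a * k ^ 2 + b * y ^ 2 + c * z ^ 2 + 2 * d * y * z + 2 * e * k * z + 2 * f * k * y with hQ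
      have haQ : a * Q = g ^ 2 + G := by rw [hQ, hGdef, hg]; ring
      have hQ0 : 0 < Q := by
        by_contra h
        nlinarith [sq_nonneg g]
      have hQa : Q < a := by
        exact tern_aux a g G Q (by omega) haQ hG2 (by nlinarith)
      -- columns: (k,y,z), (1,0,0), (0,-y',z')
      set U : Matrix (Fin 3) (Fin 3) ℤ := !![k, 1, 0; y, 0, -y'; z, 0, z'] with hU
      have hUdet : U.det = -1 := by
        rw [hU, Matrix.det_fin_three]; simp; linarith
      apply gram_of_conj _ U (by rw [hUdet]; norm_num)
      set h1 := b * y * (-y') + c * z * z' + d * (y * z' - z * y') + e * k * z' + f * k * (-y') with hh1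
      set c1 := b * y' ^ 2 + c * z' ^ 2 - 2 * d * y' * z' with hc1
      set d1 := -f * y' + e * z' with hd1
      have hT : Uᵀ * T3 a b c d e f * U = T3 Q a c1 d1 h1 g := by
        ext i j
        fin_cases i <;> fin_cases j <;>
          simp [T3, hU, Matrix.mul_apply, Fin.sum_univ_three, Matrix.vecMul, Matrix.cons_mul] <;>
          simp only [hQ, hc1, hd1, hh1, hg] <;> ring
      rw [hT]
      refine ih Q a c1 d1 h1 g (by omega) hQ0 (by linarith) ?_
      have e1 : (T3 Q a c1 d1 h1 g).det = 1 := by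
        rw [← hT, Matrix.det_mul, Matrix.det_mul, Matrix.det_transpose, hUdet]
        rw [Matrix.det_fin_three]; simp [T3]; linarith
      rw [Matrix.det_fin_three] at e1
      simp [T3] at e1
      linarith

lemma three_of_sq (n b x a2 : ℤ) (hb : 0 < b) (hn : 0 < n) (ha : a2 = b * n - 1) (ha2 : 0 < a2)
    (hx : a2 ∣ x ^ 2 + b) :
    ∃ X Y Z : ℤ, X ^ 2 + Y ^ 2 + Z ^ 2 = n ∧ ∃ r s t : ℤ, r * X + s * Y + t * Z = 1 := by
  obtain ⟨a1, h1⟩ := hx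
  have ha1 : 0 < a1 := by
    by_contra h
    nlinarith [sq_nonneg x]
  obtain ⟨M, hM⟩ := tern _ a1 a2 n 0 1 x le_rfl ha1 (by linarith) (by linear_combination -n * h1 - ha)
  have hd : M.det * M.det = 1 := by
    have := congrArg Matrix.det hM
    rw [Matrix.det_mul, Matrix.det_transpose, Matrix.det_fin_three] at this
    simp [T3] at this
    rw [← this]
    linear_combination -n * h1 - ha
  refine ⟨M 0 2, M 1 2, M 2 2, ?_, ?_⟩
  · have := congrFun (congrFun hM 2) 2
    simp [T3, Matrix.mul_apply, Fin.sum_univ_three] at this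
    rw [this]; ring
  · refine ⟨M.det * (M 1 0 * M 2 1 - M 1 1 * M 2 0), M.det * (M 0 1 * M 2 0 - M 0 0 * M 2 1),
      M.det * (M 0 0 * M 1 1 - M 0 1 * M 1 0), ?_⟩
    rw [← hd]
    nth_rw 5 [Matrix.det_fin_three]
    ring
end

noncomputable section
open Matrix NumberTheorySymbols

lemma dvd_of_jac {p b : ℕ} (hp : p.Prime) (h : jacobiSym (-(b:ℤ)) p = 1) : ∃ x : ℤ, (p : ℤ) ∣ x ^ 2 + b := by
  have := Fact.mk hp
  obtain ⟨r, hr⟩ := ZMod.isSquare_of_jacobiSym_eq_one h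
  refine ⟨r.val, ?_⟩
  rw [← ZMod.intCast_zmod_eq_zero_iff_dvd]
  push_cast
  rw [ZMod.natCast_zmod_val]
  push_cast at hr
  linear_combination -hr

lemma three_sq_even (n : ℕ) (hn : n % 4 = 2) :
    ∃ X Y Z : ℤ, X ^ 2 + Y ^ 2 + Z ^ 2 = n ∧ ∃ r s t : ℤ, r * X + s * Y + t * Z = 1 := by
  have hco : (n - 1).Coprime (4 * n) := by
    apply Nat.Coprime.mul_right
    · have : Odd (n - 1) := by rw [Nat.odd_iff]; omega
      exact (Nat.Coprime.pow_right 2 (Nat.coprime_two_right.2 this) : (n-1).Coprime (2^2))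
    · obtain ⟨m, rfl⟩ : ∃ m, n = m + 1 := ⟨n - 1, by omega⟩
      simp
  obtain ⟨p, hpn, hp, hpm⟩ := Nat.forall_exists_prime_gt_and_modEq n (q := 4 * n) (by omega) hco
  obtain ⟨j, hj⟩ := (Nat.modEq_iff_dvd' (by omega)).1 hpm.symm
  have hp1 : p = (4 * j + 1) * n - 1 := by
    have : (4 * j + 1) * n = 4 * n * j + n := by ring
    omega
  have hpz : (p : ℤ) = ((4 * j + 1 : ℕ) : ℤ) * n - 1 := by
    rw [hp1, Nat.cast_sub]
    · push_cast; ring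
    · have : 0 < (4 * j + 1) * n := Nat.mul_pos (by omega) (by omega)
      omega
  have hp4 : p % 4 = 1 := by
    have e1 : (4 * j + 1) * n = 4 * (n * j) + n := by ring
    omega
  have hjac : jacobiSym (-((4 * j + 1 : ℕ):ℤ)) p = 1 := by
    have podd : Odd p := by rw [Nat.odd_iff]; omega
    have bodd : Odd (4 * j + 1) := by rw [Nat.odd_iff]; omega
    rw [neg_eq_neg_one_mul, jacobiSym.mul_left, jacobiSym.at_neg_one podd, ZMod.χ₄_nat_one_mod_four hp4,
      one_mul, jacobiSym.quadratic_reciprocity_one_mod_four (by omega) podd]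
    rw [jacobiSym.mod_left' (a₂ := -1), jacobiSym.at_neg_one bodd, ZMod.χ₄_nat_one_mod_four (by omega)]
    rw [hpz, sub_eq_add_neg, Int.mul_add_emod_self_left]
  obtain ⟨x, hx⟩ := dvd_of_jac hp hjac
  exact three_of_sq n ((4 * j + 1 : ℕ):ℤ) x p (by positivity) (by omega) hpz (by have := hp.pos; omega) hx

lemma three_sq_odd (n c : ℕ) (h : (n % 8 = 3 ∧ c = 1) ∨ (n % 8 = 1 ∧ c = 3) ∨ (n % 8 = 5 ∧ c = 3)) :
    ∃ X Y Z : ℤ, X ^ 2 + Y ^ 2 + Z ^ 2 = n ∧ ∃ r s t : ℤ, r * X + s * Y + t * Z = 1 := by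
  obtain ⟨u, hu⟩ : ∃ u, c * n = 2 * u + 1 := by
    refine ⟨(c * n - 1) / 2, ?_⟩
    rcases h with ⟨h, rfl⟩ | ⟨h, rfl⟩ | ⟨h, rfl⟩ <;> omega
  have hu2 : u % 2 = 1 := by
    rcases h with ⟨h, rfl⟩ | ⟨h, rfl⟩ | ⟨h, rfl⟩ <;> omega
  have hu4 : u % 4 = 1 ∨ (u % 4 = 3 ∧ c = 3) := by
    rcases h with ⟨h, rfl⟩ | ⟨h, rfl⟩ | ⟨h, rfl⟩ <;> omega
  have hco : u.Coprime (4 * n) := by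
    apply Nat.Coprime.mul_right
    · have : Odd u := by rw [Nat.odd_iff]; omega
      exact (Nat.Coprime.pow_right 2 (Nat.coprime_two_right.2 this) : u.Coprime (2^2))
    · rw [Nat.coprime_iff_gcd_eq_one, ← Nat.dvd_one]
      have h1 : u.gcd n ∣ 2 * u + 1 := hu ▸ (Nat.gcd_dvd_right u n).mul_left c
      exact (Nat.dvd_add_right ((Nat.gcd_dvd_left u n).mul_left 2)).1 h1
  obtain ⟨p, hpn, hp, hpm⟩ := Nat.forall_exists_prime_gt_and_modEq (u + 2) (q := 4 * n) (by omega) hco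
  obtain ⟨j, hj⟩ := (Nat.modEq_iff_dvd' (by omega)).1 hpm.symm
  have hp0 : p = u + 4 * (n * j) := by rw [← mul_assoc]; omega
  have hp1 : 2 * p + 1 = (8 * j + c) * n := by
    have : (8 * j + c) * n = 8 * (n * j) + c * n := by ring
    omega
  have hpz : 2 * (p : ℤ) = ((8 * j + c : ℕ) : ℤ) * n - 1 := by
    have : ((2 * p + 1 : ℕ) : ℤ) = ((8 * j + c : ℕ) : ℤ) * n := by rw [hp1]; push_cast; ring
    push_cast at this ⊢
    linarith
  set b := 8 * j + c with hb
  have podd : Odd p := by rw [Nat.odd_iff]; omega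
  have bodd : Odd b := by rw [Nat.odd_iff]; omega
  have hpb : jacobiSym p b = 1 := by
    have h2 : jacobiSym (-2) b = 1 := by
      rw [jacobiSym.at_neg_two bodd, ZMod.χ₈'_nat_eq_if_mod_eight]
      have : b % 8 = 1 ∨ b % 8 = 3 := by omega
      rcases this with h | h <;> simp [h] <;> omega
    have h3 : jacobiSym (-2 * p) b = 1 := by
      rw [jacobiSym.mod_left' (a₂ := 1), jacobiSym.one_left]
      have : -2 * (p:ℤ) = 1 + b * (-n) := by linarith
      rw [this, Int.add_mul_emod_self_left]
    rwa [jacobiSym.mul_left, h2, one_mul] at h3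
  have hjac : jacobiSym (-(b:ℤ)) p = 1 := by
    rw [neg_eq_neg_one_mul, jacobiSym.mul_left, jacobiSym.at_neg_one podd]
    rcases (by omega : p % 4 = 1 ∨ (p % 4 = 3 ∧ b % 4 = 3)) with h1 | ⟨h1, h2⟩
    · rw [ZMod.χ₄_nat_one_mod_four h1, one_mul, ← jacobiSym.quadratic_reciprocity_one_mod_four h1 bodd, hpb]
    · rw [ZMod.χ₄_nat_three_mod_four h1, jacobiSym.quadratic_reciprocity_three_mod_four h2 h1, hpb]; norm_num
  obtain ⟨x, hx⟩ := dvd_of_jac hp hjac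
  obtain ⟨x, hx, hxo⟩ : ∃ x : ℤ, (p:ℤ) ∣ x ^ 2 + b ∧ Odd x := by
    rcases Int.even_or_odd x with h | h
    · refine ⟨x + p, ?_, h.add_odd (by exact_mod_cast podd)⟩
      have : (x + p) ^ 2 + (b:ℤ) = (x ^ 2 + b) + p * (2 * x + p) := by ring
      rw [this]
      exact dvd_add hx (dvd_mul_right _ _)
    · exact ⟨x, hx, h⟩
  have h2x : (2:ℤ) ∣ x ^ 2 + b := by
    have : Odd (b:ℤ) := by exact_mod_cast bodd
    exact even_iff_two_dvd.1 (hxo.pow.add_odd this)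
  have h2p : IsCoprime (2:ℤ) p := by
    rw [Int.isCoprime_iff_gcd_eq_one]
    exact_mod_cast Nat.coprime_two_left.2 podd
  refine three_of_sq n b x (2 * p) (by have := bodd.pos; omega) (by omega) hpz (by have := hp.pos; omega) (h2p.mul_dvd h2x hx)

/-- primitive three squares theorem -/
theorem three_sq (n : ℕ) (h : n % 8 = 1 ∨ n % 8 = 2 ∨ n % 8 = 3 ∨ n % 8 = 5 ∨ n % 8 = 6) :
    ∃ X Y Z : ℤ, X ^ 2 + Y ^ 2 + Z ^ 2 = n ∧ ∃ r s t : ℤ, r * X + s * Y + t * Z = 1 := by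
  rcases h with h | h | h | h | h
  · exact three_sq_odd n 3 (by omega)
  · exact three_sq_even n (by omega)
  · exact three_sq_odd n 1 (by omega)
  · exact three_sq_odd n 3 (by omega)
  · exact three_sq_even n (by omega)
end

noncomputable section
open Quaternion

def P3 (n : ℕ) : Set (ℤ × ℤ × ℤ) := {v | v ∈ S3 n ∧ ∃ r s t : ℤ, r * v.1 + s * v.2.1 + t * v.2.2 = 1}

def vq (v : ℤ × ℤ × ℤ) : ℍ[ℤ] := ⟨0, v.1, v.2.1, v.2.2⟩

lemma prim_of (x y z : ℤ) (h : ∀ d : ℤ, d ∣ x → d ∣ y → d ∣ z → d ∣ 1) :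
    ∃ r s t : ℤ, r * x + s * y + t * z = 1 := by
  have h1 : ((Int.gcd x (Int.gcd y z) : ℕ) : ℤ) ∣ 1 := by
    have e := Int.gcd_dvd_right x (Int.gcd y z : ℤ)
    exact h _ (Int.gcd_dvd_left x _) (e.trans (Int.gcd_dvd_left y z)) (e.trans (Int.gcd_dvd_right y z))
  have h2 : Int.gcd x (Int.gcd y z) = 1 := by
    have : Int.gcd x (Int.gcd y z) ∣ 1 := by exact_mod_cast h1
    exact Nat.dvd_one.1 this
  have e1 := Int.gcd_eq_gcd_ab x (Int.gcd y z)
  have e2 := Int.gcd_eq_gcd_ab y z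
  rw [h2] at e1
  set a := Int.gcdA x (Int.gcd y z)
  set b := Int.gcdB x (Int.gcd y z)
  set c := Int.gcdA y z
  set d := Int.gcdB y z
  refine ⟨a, c * b, d * b, ?_⟩
  push_cast at e1
  rw [e1]
  linear_combination -b * e2

lemma pigeon (m : ℕ) (hm : 0 < m) (a b : Fin 4 → ℤ) : ∃ q : Fin 4 → ℤ, q ≠ 0 ∧ (∀ i, (q i).natAbs ≤ Nat.sqrt m) ∧
    (m : ℤ) ∣ ∑ i, a i * q i ∧ (m : ℤ) ∣ ∑ i, b i * q i := by
  have : NeZero m := ⟨hm.ne'⟩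
  let F : (Fin 4 → Fin (Nat.sqrt m + 1)) → ZMod m × ZMod m :=
    fun x => (((∑ i, a i * ((x i : ℕ) : ℤ) : ℤ) : ZMod m), ((∑ i, b i * ((x i : ℕ) : ℤ) : ℤ) : ZMod m))
  obtain ⟨x, y, hxy, hF⟩ := Fintype.exists_ne_map_eq_of_card_lt F (by
    simp [ZMod.card]
    have := Nat.lt_succ_sqrt m
    calc m * m < (Nat.succ m.sqrt * Nat.succ m.sqrt) * (Nat.succ m.sqrt * Nat.succ m.sqrt) :=
          Nat.mul_lt_mul'' this this
      _ = _ := by rw [Nat.succ_eq_add_one]; ring)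
  refine ⟨fun i => (x i : ℕ) - (y i : ℕ), ?_, ?_, ?_, ?_⟩
  · intro h
    apply hxy
    funext i
    have := congrFun h i
    simp at this
    ext
    omega
  · intro i
    have h1 := (x i).2
    have h2 := (y i).2
    simp only
    omega
  · have := congrArg Prod.fst hF
    simp only [F] at this
    rw [ZMod.intCast_eq_intCast_iff_dvd_sub] at this
    rw [dvd_sub_comm] at this
    rw [← Finset.sum_sub_distrib] at this
    simpa [mul_sub] using this
  · have := congrArg Prod.snd hF
    simp only [F] at this
    rw [ZMod.intCast_eq_intCast_iff_dvd_sub] at this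
    rw [dvd_sub_comm] at this
    rw [← Finset.sum_sub_distrib] at this
    simpa [mul_sub] using this

/-- integer `m` divides quaternion `q` -/
def QD (m : ℤ) (q : ℍ[ℤ]) : Prop := m ∣ q.re ∧ m ∣ q.imI ∧ m ∣ q.imJ ∧ m ∣ q.imK

lemma QD_iff (m : ℤ) (q : ℍ[ℤ]) : QD m q ↔ ∃ t : ℍ[ℤ], q = (m : ℍ[ℤ]) * t := by
  constructor
  · rintro ⟨⟨a, ha⟩, ⟨b, hb⟩, ⟨c, hc⟩, ⟨d, hd⟩⟩
    obtain ⟨t, h1, h2, h3, h4⟩ : ∃ t : ℍ[ℤ], t.re = a ∧ t.imI = b ∧ t.imJ = c ∧ t.imK = d := ⟨⟨a, b, c, d⟩, rfl, rfl, rfl, rfl⟩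
    refine ⟨t, ?_⟩
    ext <;> simp [*]
  · rintro ⟨t, rfl⟩
    refine ⟨?_, ?_, ?_, ?_⟩ <;> simp

lemma QD_mul_left {m : ℤ} {q : ℍ[ℤ]} (h : QD m q) (r : ℍ[ℤ]) : QD m (r * q) := by
  rw [QD_iff] at *
  obtain ⟨t, rfl⟩ := h
  exact ⟨r * t, by rw [← mul_assoc, ← mul_assoc, (Int.cast_commute m r).eq]⟩

lemma QD_mul_right {m : ℤ} {q : ℍ[ℤ]} (h : QD m q) (r : ℍ[ℤ]) : QD m (q * r) := by
  rw [QD_iff] at *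
  obtain ⟨t, rfl⟩ := h
  exact ⟨t * r, by rw [mul_assoc]⟩

lemma QD_sub {m : ℤ} {q r : ℍ[ℤ]} (h : QD m q) (h' : QD m r) : QD m (q - r) := by
  rw [QD_iff] at *
  obtain ⟨t, rfl⟩ := h
  obtain ⟨t', rfl⟩ := h'
  exact ⟨t - t', by rw [mul_sub]⟩

lemma QD_of_coprime {m k : ℤ} {q : ℍ[ℤ]} (hk : IsCoprime m k) (h : QD m ((k : ℍ[ℤ]) * q)) : QD m q := by
  obtain ⟨h1, h2, h3, h4⟩ := h
  simp at h1 h2 h3 h4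
  exact ⟨hk.dvd_of_dvd_mul_left h1, hk.dvd_of_dvd_mul_left h2, hk.dvd_of_dvd_mul_left h3, hk.dvd_of_dvd_mul_left h4⟩

lemma small_rep (k : ℤ) (hk : k = 2 ∨ k = 3) (x : ℤ) : ∃ r : ℤ, k ∣ r - x ∧ ((k = 2 ∧ (r = 0 ∨ r = 1)) ∨ (k = 3 ∧ (r = 0 ∨ r = 1 ∨ r = -1))) := by
  rcases hk with rfl | rfl
  · rcases (by omega : x % 2 = 0 ∨ x % 2 = 1) with h | h
    · exact ⟨0, by omega, by omega⟩
    · exact ⟨1, by omega, by omega⟩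
  · rcases (by omega : x % 3 = 0 ∨ x % 3 = 1 ∨ x % 3 = 2) with h | h | h
    · exact ⟨0, by omega, by omega⟩
    · exact ⟨1, by omega, by omega⟩
    · exact ⟨-1, by omega, by omega⟩

lemma descent (k m : ℤ) (hk : k = 2 ∨ k = 3) (hkm : IsCoprime m k) (q : ℍ[ℤ]) (hN : normSq q = k * m) (hm : 0 < m) :
    ∃ α q' : ℍ[ℤ], α * q = (k : ℍ[ℤ]) * q' ∧ normSq q' = m := by
  obtain ⟨r0, h0, g0⟩ := small_rep k hk q.re
  obtain ⟨r1, h1, g1⟩ := small_rep k hk q.imI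
  obtain ⟨r2, h2, g2⟩ := small_rep k hk q.imJ
  obtain ⟨r3, h3, g3⟩ := small_rep k hk q.imK
  set β : ℍ[ℤ] := ⟨r0, r1, r2, r3⟩ with hβ
  have hβq : QD k (β - q) := ⟨h0, h1, h2, h3⟩
  have hβN : normSq β = k := by
    rw [normSq_def'] at hN ⊢
    simp only [hβ]
    obtain ⟨u, hu⟩ := hkm
    obtain ⟨s0, h0⟩ := h0
    obtain ⟨s1, h1⟩ := h1
    obtain ⟨s2, h2⟩ := h2
    obtain ⟨s3, h3⟩ := h3
    have e0 : q.re = r0 - k * s0 := by linarith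
    have e1 : q.imI = r1 - k * s1 := by linarith
    have e2 : q.imJ = r2 - k * s2 := by linarith
    have e3 : q.imK = r3 - k * s3 := by linarith
    rw [e0, e1, e2, e3] at hN
    have hN' : r0 ^ 2 + r1 ^ 2 + r2 ^ 2 + r3 ^ 2 = k * (m + 2 * (r0 * s0 + r1 * s1 + r2 * s2 + r3 * s3) - k * (s0 ^ 2 + s1 ^ 2 + s2 ^ 2 + s3 ^ 2)) := by
      linear_combination hN
    obtain ⟨v, hv⟩ := hu
    rcases hk with rfl | rfl
    · have q0 : r0 ^ 2 = r0 := by rcases g0 with ⟨_, rfl | rfl⟩ | ⟨h, _⟩ <;> norm_num at *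
      have q1 : r1 ^ 2 = r1 := by rcases g1 with ⟨_, rfl | rfl⟩ | ⟨h, _⟩ <;> norm_num at *
      have q2 : r2 ^ 2 = r2 := by rcases g2 with ⟨_, rfl | rfl⟩ | ⟨h, _⟩ <;> norm_num at *
      have q3 : r3 ^ 2 = r3 := by rcases g3 with ⟨_, rfl | rfl⟩ | ⟨h, _⟩ <;> norm_num at *
      have hmo : m % 2 = 1 := by
        rcases Int.emod_two_eq_zero_or_one m with h | h
        · obtain ⟨w, hw⟩ := Int.dvd_of_emod_eq_zero h
          rw [hw] at hv
          have : 2 * (u * w + v) = 1 := by linarith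
          omega
        · exact h
      have ev2 : ∀ r x s : ℤ, x = r - 2 * s → (r = 0 ∨ r = 1) → ∃ w, x ^ 2 = 4 * w + r := by
        rintro r x s rfl (rfl | rfl)
        · exact ⟨s ^ 2, by ring⟩
        · exact ⟨s ^ 2 - s, by ring⟩
      have f : ∀ r : ℤ, (2:ℤ) = 2 ∧ (r = 0 ∨ r = 1) ∨ (2:ℤ) = 3 ∧ (r = 0 ∨ r = 1 ∨ r = -1) → r = 0 ∨ r = 1 := by
        intro r h; omega
      obtain ⟨w0, z0⟩ := ev2 r0 _ s0 rfl (f _ g0)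
      obtain ⟨w1, z1⟩ := ev2 r1 _ s1 rfl (f _ g1)
      obtain ⟨w2, z2⟩ := ev2 r2 _ s2 rfl (f _ g2)
      obtain ⟨w3, z3⟩ := ev2 r3 _ s3 rfl (f _ g3)
      rw [q0, q1, q2, q3]
      rw [z0, z1, z2, z3] at hN
      omega
    · have f : ∀ r : ℤ, (3:ℤ) = 2 ∧ (r = 0 ∨ r = 1) ∨ (3:ℤ) = 3 ∧ (r = 0 ∨ r = 1 ∨ r = -1) → (r = 0 ∧ r ^ 2 = 0) ∨ r ^ 2 = 1 := by
        intro r h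
        rcases h with ⟨h, _⟩ | ⟨_, rfl | rfl | rfl⟩ <;> norm_num at *
      have z0 := f _ g0
      have z1 := f _ g1
      have z2 := f _ g2
      have z3 := f _ g3
      by_cases hz : r0 = 0 ∧ r1 = 0 ∧ r2 = 0 ∧ r3 = 0
      · obtain ⟨rfl, rfl, rfl, rfl⟩ := hz
        have : m = 3 * (s0 ^ 2 + s1 ^ 2 + s2 ^ 2 + s3 ^ 2) := by linarith
        rw [this] at hv
        have : 3 * (u * (s0 ^ 2 + s1 ^ 2 + s2 ^ 2 + s3 ^ 2) + v) = 1 := by linarith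
        omega
      · omega
  have hs : QD k (star β * q) := by
    have e : star β * q = ((k * m : ℤ) : ℍ[ℤ]) + star (β - q) * q := by
      rw [star_sub, sub_mul, Quaternion.star_mul_self, hN]
      show _ = ((k * m : ℤ) : ℍ[ℤ]) + (star β * q - ((k * m : ℤ) : ℍ[ℤ]))
      rw [add_sub_cancel]
    obtain ⟨t, ht⟩ := (QD_iff _ _).1 hβq
    rw [QD_iff, e, ht]
    refine ⟨m + star t * q, ?_⟩
    rw [star_mul, star_intCast, mul_add, ← mul_assoc, ← (Int.cast_commute k (star t)).eq]
    push_cast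
    rfl
  obtain ⟨q', hq'⟩ := (QD_iff _ _).1 hs
  refine ⟨star β, q', hq', ?_⟩
  have := congrArg normSq hq'
  rw [map_mul, map_mul, normSq_star, hβN, hN, normSq_intCast] at this
  have hk0 : k ≠ 0 := by rcases hk with rfl | rfl <;> norm_num
  simp only [Int.cast_id] at this
  have h2 : k ^ 2 * m = k ^ 2 * normSq q' := by linarith
  exact (mul_left_cancel₀ (pow_ne_zero 2 hk0) h2).symm

@[simp] lemma vq_re (v : ℤ × ℤ × ℤ) : (vq v).re = 0 := rfl
@[simp] lemma vq_imI (v : ℤ × ℤ × ℤ) : (vq v).imI = v.1 := rfl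
@[simp] lemma vq_imJ (v : ℤ × ℤ × ℤ) : (vq v).imJ = v.2.1 := rfl
@[simp] lemma vq_imK (v : ℤ × ℤ × ℤ) : (vq v).imK = v.2.2 := rfl

lemma vq_sq {n : ℕ} {v : ℤ × ℤ × ℤ} (hv : v ∈ S3 n) : vq v * vq v = ((-n : ℤ) : ℍ[ℤ]) := by
  have h : v.1 ^ 2 + v.2.1 ^ 2 + v.2.2 ^ 2 = n := hv
  ext
  · simp; linarith
  · simp; ring
  · simp; ring
  · simp; ring

lemma vq_normSq {n : ℕ} {v : ℤ × ℤ × ℤ} (hv : v ∈ S3 n) : normSq (vq v) = n := by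
  have h : v.1 ^ 2 + v.2.1 ^ 2 + v.2.2 ^ 2 = n := hv
  rw [normSq_def']; simp; linarith

lemma prim_dvd {n : ℕ} {v : ℤ × ℤ × ℤ} (hv : v ∈ P3 n) (d k : ℤ) (h : QD d ((k : ℍ[ℤ]) * vq v)) : d ∣ k := by
  obtain ⟨_, r, s, t, e⟩ := hv
  obtain ⟨h1, h2, h3, h4⟩ := h
  simp at h2 h3 h4
  have : k = r * (k * v.1) + s * (k * v.2.1) + t * (k * v.2.2) := by linear_combination -k * e
  rw [this]
  exact dvd_add (dvd_add (h2.mul_left _) (h3.mul_left _)) (h4.mul_left _)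

/-- the ideal-generator existence -/
lemma exists_q {n m : ℕ} {v : ℤ × ℤ × ℤ} (hv : v ∈ P3 n) (hm : Squarefree m)
    (hco : m.Coprime (6 * n * (v.1 ^ 2 + v.2.1 ^ 2).natAbs)) (b : ℤ) (hb : (m : ℤ) ∣ b ^ 2 + n) :
    ∃ q : ℍ[ℤ], normSq q = m ∧ QD m (q * (b + vq v)) := by
  have hm0 : 0 < m := Nat.pos_of_ne_zero hm.ne_zero
  by_cases hm1 : m = 1
  · subst hm1
    exact ⟨1, by simp, by simp [QD]⟩
  have hM : IsCoprime (m : ℤ) (v.1 ^ 2 + v.2.1 ^ 2) := by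
    rw [Int.isCoprime_iff_gcd_eq_one]
    exact Nat.Coprime.coprime_mul_left_right hco
  have h6 : m.Coprime 6 := by
    rw [mul_assoc] at hco
    exact Nat.Coprime.coprime_mul_right_right hco
  have h2 : IsCoprime (m : ℤ) 2 := by
    rw [Int.isCoprime_iff_gcd_eq_one]
    exact Nat.Coprime.coprime_dvd_right (by norm_num) h6
  have h3 : IsCoprime (m : ℤ) 3 := by
    rw [Int.isCoprime_iff_gcd_eq_one]
    exact Nat.Coprime.coprime_dvd_right (by norm_num) h6
  obtain ⟨x, hx0, hxs, hx1, hx2⟩ := pigeon m hm0 ![b, -v.1, -v.2.1, -v.2.2] ![v.2.2, v.2.1, -v.1, b]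
  simp [Fin.sum_univ_four] at hx1 hx2
  obtain ⟨q, e0, e1, e2, e3⟩ : ∃ q : ℍ[ℤ], q.re = x 0 ∧ q.imI = x 1 ∧ q.imJ = x 2 ∧ q.imK = x 3 :=
    ⟨⟨x 0, x 1, x 2, x 3⟩, rfl, rfl, rfl, rfl⟩
  have hqn : normSq q = x 0 ^ 2 + x 1 ^ 2 + x 2 ^ 2 + x 3 ^ 2 := by rw [normSq_def', e0, e1, e2, e3]
  have hq0 : q ≠ 0 := by
    rintro rfl
    apply hx0
    funext i
    fin_cases i
    · exact e0.symm
    · exact e1.symm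
    · exact e2.symm
    · exact e3.symm
  have hlt : Nat.sqrt m * Nat.sqrt m < m := by
    refine lt_of_le_of_ne (Nat.sqrt_le m) ?_
    intro h
    have := hm (Nat.sqrt m) ⟨1, by rw [mul_one, h]⟩
    rw [Nat.isUnit_iff] at this
    rw [this] at h
    omega
  have hlt2 : ∀ i, x i ^ 2 < m := by
    intro i
    have h1 := Nat.mul_le_mul (hxs i) (hxs i)
    have h2 : ((x i).natAbs * (x i).natAbs : ℕ) < m := lt_of_le_of_lt h1 hlt
    have h3 : (((x i).natAbs * (x i).natAbs : ℕ) : ℤ) < m := by exact_mod_cast h2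
    rw [Int.natAbs_mul_self] at h3
    linarith [sq (x i)]
  have hQD : QD m (q * (b + vq v)) := by
    set t := q * (b + vq v) with ht
    have ht0 : (m : ℤ) ∣ t.re := by
      have : t.re = b * x 0 + -(v.1 * x 1) + -(v.2.1 * x 2) + -(v.2.2 * x 3) := by
        rw [ht]; simp [e0, e1, e2, e3]; ring
      rwa [this]
    have ht3 : (m : ℤ) ∣ t.imK := by
      have : t.imK = v.2.2 * x 0 + v.2.1 * x 1 + -(v.1 * x 2) + b * x 3 := by
        rw [ht]; simp [e0, e1, e2, e3]; ring
      rwa [this]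
    have hz : QD m (t * (b - vq v)) := by
      have : t * (b - vq v) = ((b ^ 2 + n : ℤ) : ℍ[ℤ]) * q := by
        rw [ht, mul_assoc]
        have : ((b : ℍ[ℤ]) + vq v) * (b - vq v) = ((b ^ 2 + n : ℤ) : ℍ[ℤ]) := by
          rw [add_mul, mul_sub, mul_sub, (Int.cast_commute b (vq v)).eq, vq_sq hv.1]
          push_cast
          rw [sq]
          abel
        rw [this, (Int.cast_commute _ q).eq]
      rw [this]
      obtain ⟨c, hc⟩ := hb
      rw [hc, QD_iff]
      exact ⟨c * q, by push_cast; rw [mul_assoc]⟩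
    obtain ⟨z0, -, -, z3⟩ := hz
    simp at z0 z3
    have y0 : (m : ℤ) ∣ t.imI * v.1 + t.imJ * v.2.1 := by
      have e : t.imI * v.1 + t.imJ * v.2.1 = (t.re * b + t.imI * v.1 + t.imJ * v.2.1 + t.imK * v.2.2) - (t.re * b + t.imK * v.2.2) := by ring
      rw [e]
      exact dvd_sub z0 (dvd_add (ht0.mul_right _) (ht3.mul_right _))
    have y3 : (m : ℤ) ∣ t.imJ * v.1 - t.imI * v.2.1 := by
      have e : t.imJ * v.1 - t.imI * v.2.1 = (-(t.re * v.2.2) - t.imI * v.2.1 + t.imJ * v.1 + t.imK * b) - (t.imK * b - t.re * v.2.2) := by ring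
      rw [e]
      refine dvd_sub ?_ (dvd_sub (ht3.mul_right _) (ht0.mul_right _))
      rw [sub_eq_add_neg (-(t.re * v.2.2))]
      exact z3
    refine ⟨ht0, ?_, ?_, ht3⟩
    · apply hM.dvd_of_dvd_mul_left
      have : (v.1 ^ 2 + v.2.1 ^ 2) * t.imI = v.1 * (t.imI * v.1 + t.imJ * v.2.1) - v.2.1 * (t.imJ * v.1 - t.imI * v.2.1) := by ring
      rw [this]
      exact dvd_sub (y0.mul_left _) (y3.mul_left _)
    · apply hM.dvd_of_dvd_mul_left
      have : (v.1 ^ 2 + v.2.1 ^ 2) * t.imJ = v.2.1 * (t.imI * v.1 + t.imJ * v.2.1) + v.1 * (t.imJ * v.1 - t.imI * v.2.1) := by ring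
      rw [this]
      exact dvd_add (y0.mul_left _) (y3.mul_left _)
  have hdvd : (m : ℤ) ∣ normSq q := by
    apply prim_dvd hv
    have h1 := QD_mul_left hQD (star q)
    rw [← mul_assoc, Quaternion.star_mul_self] at h1
    obtain ⟨-, h2, h3, h4⟩ := h1
    simp at h2 h3 h4
    refine ⟨by simp, ?_, ?_, ?_⟩ <;> simpa
  obtain ⟨k, hk⟩ := hdvd
  have hpos : 0 < normSq q := lt_of_le_of_ne normSq_nonneg (Ne.symm (normSq_ne_zero.2 hq0))
  have hk0 : 0 < k := by
    by_contra h
    nlinarith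
  have hk4 : k < 4 := by
    by_contra h
    have := hlt2 0
    have := hlt2 1
    have := hlt2 2
    have := hlt2 3
    nlinarith
  by_cases hk1 : k = 1
  · exact ⟨q, by rw [hk, hk1, mul_one], hQD⟩
  · have hk23 : k = 2 ∨ k = 3 := by omega
    have hcop : IsCoprime (m : ℤ) k := by rcases hk23 with rfl | rfl <;> assumption
    obtain ⟨α, q', h1, h2⟩ := descent k m hk23 hcop q (by rw [hk, mul_comm]) (by omega)
    refine ⟨q', h2, ?_⟩
    apply QD_of_coprime hcop
    rw [← mul_assoc, ← h1, mul_assoc]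
    exact QD_mul_left hQD α

lemma exists_wq {n m : ℕ} {v : ℤ × ℤ × ℤ} (hv : v ∈ P3 n) (hm : Squarefree m)
    (hco : m.Coprime (6 * n * (v.1 ^ 2 + v.2.1 ^ 2).natAbs)) (b : ℤ) (hb : (m : ℤ) ∣ b ^ 2 + n) :
    ∃ q : ℍ[ℤ], ∃ w ∈ P3 n, normSq q = m ∧ QD m (q * (b + vq v)) ∧ q * vq v = vq w * q := by
  obtain ⟨q, hq, hQD⟩ := exists_q hv hm hco b hb
  have hm0 : (m : ℤ) ≠ 0 := by exact_mod_cast hm.ne_zero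
  have hmn : m.Coprime n := by
    apply Nat.Coprime.coprime_dvd_right _ hco
    exact ⟨6 * (v.1 ^ 2 + v.2.1 ^ 2).natAbs, by ring⟩
  have h1 : QD m (q * vq v * star q) := by
    have h2 := QD_mul_right hQD (star q)
    have h3 : QD m ((b : ℍ[ℤ]) * (q * star q)) := by
      rw [Quaternion.self_mul_star, hq]
      simp [QD]
    have h4 := QD_sub h2 h3
    rw [mul_add, add_mul, ← (Int.cast_commute b q).eq, mul_assoc (b : ℍ[ℤ])] at h4
    rwa [add_sub_cancel_left] at h4
  obtain ⟨w, hw⟩ := (QD_iff _ _).1 h1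
  have hwre : w.re = 0 := by
    have := congrArg QuaternionAlgebra.re hw
    simp at this
    have h0 : (m : ℤ) * w.re = 0 := by rw [← this]; ring
    exact (mul_eq_zero.1 h0).resolve_left hm0
  have hwv : w = vq (w.imI, w.imJ, w.imK) := by
    ext <;> simp [hwre]
  have cancel : ∀ x y : ℍ[ℤ], ((m : ℤ) : ℍ[ℤ]) * x = ((m : ℤ) : ℍ[ℤ]) * y → x = y := by
    intro x y h
    have hne : ((m : ℤ) : ℍ[ℤ]) ≠ 0 := by
      intro h
      have := congrArg QuaternionAlgebra.re h
      simp at this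
      omega
    exact mul_left_cancel₀ hne h
  have hqm : star q * q = ((m : ℤ) : ℍ[ℤ]) := by rw [Quaternion.star_mul_self, hq]; rfl
  have hwq : q * vq v = w * q := by
    apply cancel
    rw [← mul_assoc _ w q, ← hw, mul_assoc _ (star q), hqm, (Int.cast_commute _ (q * vq v)).eq]
  have hwn : normSq w = n := by
    have := congrArg normSq hwq
    rw [map_mul, map_mul, vq_normSq hv.1, hq, mul_comm] at this
    exact (mul_right_cancel₀ hm0 this).symm
  refine ⟨q, (w.imI, w.imJ, w.imK), ⟨?_, ?_⟩, hq, hQD, by rw [← hwv]; exact hwq⟩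
  · show w.imI ^ 2 + w.imJ ^ 2 + w.imK ^ 2 = n
    rw [normSq_def', hwre] at hwn
    linarith
  · apply prim_of
    intro d d1 d2 d3
    simp only at d1 d2 d3
    have hd : QD d w := ⟨by rw [hwre]; simp, d1, d2, d3⟩
    have hdm : d ∣ (m : ℤ) := by
      apply prim_dvd hv
      have := QD_mul_left (QD_mul_right hd q) (star q)
      rwa [← hwq, ← mul_assoc, hqm] at this
    have hdn : d ∣ (n : ℤ) := by
      rw [← hwn, normSq_def', hwre]
      exact dvd_add (dvd_add (dvd_add (by simp) (dvd_pow d1 two_ne_zero)) (dvd_pow d2 two_ne_zero)) (dvd_pow d3 two_ne_zero)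
    have hc : IsCoprime (m : ℤ) n := Int.isCoprime_iff_gcd_eq_one.2 hmn
    exact isUnit_iff_dvd_one.1 (hc.isUnit_of_dvd' hdm hdn)

lemma b_inj {m : ℕ} {v : ℤ × ℤ × ℤ} (hm : Squarefree m) (b b' : ℤ) (q : ℍ[ℤ]) (hq : normSq q = m)
    (h : QD m (q * (b + vq v))) (h' : QD m (q * (b' + vq v))) : (m : ℤ) ∣ b - b' := by
  have h1 : QD m (((b - b' : ℤ) : ℍ[ℤ]) * q) := by
    have := QD_sub h h'
    rw [← mul_sub, add_sub_add_right_eq_sub] at this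
    rw [(Int.cast_commute _ q).eq]
    push_cast
    exact this
  have hm' : Squarefree (m : ℤ) := Int.squarefree_natCast.2 hm
  set g : ℤ := (Int.gcd m (b - b') : ℤ) with hg
  obtain ⟨m1, hm1⟩ : g ∣ m := Int.gcd_dvd_left _ _
  obtain ⟨c1, hc1⟩ : g ∣ b - b' := Int.gcd_dvd_right _ _
  have hg0 : g ≠ 0 := by
    intro h0
    rw [h0, zero_mul] at hm1
    exact hm'.ne_zero hm1
  have hcop : IsCoprime m1 c1 := by
    have := Int.gcd_eq_gcd_ab m (b - b')
    rw [← hg, hm1, hc1] at this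
    refine ⟨_, _, mul_left_cancel₀ hg0 (?_ : g * (Int.gcdA (g * m1) (g * c1) * m1 + Int.gcdB (g * m1) (g * c1) * c1) = g * 1)⟩
    rw [mul_one]
    rw [← hm1, ← hc1] at this ⊢
    linear_combination -this - (Int.gcdA (↑m) (b - b')) * hm1 - (Int.gcdB (↑m) (b - b')) * hc1
  have h2 : QD m1 q := by
    obtain ⟨a0, a1, a2, a3⟩ := h1
    simp at a0 a1 a2 a3
    have key : ∀ x : ℤ, (m : ℤ) ∣ (b - b') * x → m1 ∣ x := by
      intro x hx
      rw [hm1, hc1, mul_assoc] at hx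
      exact hcop.dvd_of_dvd_mul_left (Int.dvd_of_mul_dvd_mul_left hg0 hx)
    exact ⟨key _ a0, key _ a1, key _ a2, key _ a3⟩
  obtain ⟨t, ht⟩ := (QD_iff _ _).1 h2
  have : m1 * m1 ∣ (m : ℤ) := by
    rw [← hq, ht, map_mul, normSq_intCast, sq]
    exact dvd_mul_right _ _
  have hu := hm' _ this
  rw [hm1]
  rw [hc1]
  exact mul_dvd_mul_left g (hu.dvd)
end

noncomputable section
open Quaternion

lemma comm_form {n : ℕ} {v : ℤ × ℤ × ℤ} (hv : v ∈ P3 n) (t : ℍ[ℤ]) (h : t * vq v = vq v * t) :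
    ∃ y : ℤ, t.imI = y * v.1 ∧ t.imJ = y * v.2.1 ∧ t.imK = y * v.2.2 := by
  obtain ⟨_, r, s, u, e⟩ := hv
  have h1 := congrArg QuaternionAlgebra.imI h
  have h2 := congrArg QuaternionAlgebra.imJ h
  have h3 := congrArg QuaternionAlgebra.imK h
  simp at h1 h2 h3
  have g1 : t.imJ * v.2.2 = t.imK * v.2.1 := by linarith
  have g2 : t.imI * v.2.2 = t.imK * v.1 := by linarith
  have g3 : t.imI * v.2.1 = t.imJ * v.1 := by linarith
  refine ⟨r * t.imI + s * t.imJ + u * t.imK, ?_, ?_, ?_⟩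
  · linear_combination -t.imI * e + s * g3 + u * g2
  · linear_combination -t.imJ * e - r * g3 + u * g1
  · linear_combination -t.imK * e - r * g2 - s * g1

lemma lattice_count {n : ℕ} (hn : 0 < n) {v : ℤ × ℤ × ℤ} (hv : v ∈ P3 n) (w : ℤ × ℤ × ℤ) :
    ∃ K : ℝ, 0 ≤ K ∧ ∀ X : ℕ, 1 ≤ X → ∀ F : Finset ℍ[ℤ],
      (∀ q ∈ F, q * vq v = vq w * q ∧ normSq q ≤ X) → (F.card : ℝ) ≤ 4 / √n * X + K * √X := by
  classical
  by_cases hz : ∃ q : ℍ[ℤ], q * vq v = vq w * q ∧ q ≠ 0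
  swap
  · push Not at hz
    refine ⟨1, zero_le_one, fun X hX F hF => ?_⟩
    have h1 : F ⊆ {0} := fun q hq => Finset.mem_singleton.2 (hz q (hF q hq).1)
    have h2 : (F.card : ℝ) ≤ 1 := by exact_mod_cast (Finset.card_le_card h1)
    have h3 : (1 : ℝ) ≤ √X := Real.one_le_sqrt.2 (by exact_mod_cast hX)
    have h4 : (0 : ℝ) ≤ 4 / √n * X := by positivity
    linarith
  -- minimal element
  have hex : ∃ N : ℕ, ∃ q : ℍ[ℤ], q * vq v = vq w * q ∧ q ≠ 0 ∧ normSq q = N := by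
    obtain ⟨q, h1, h2⟩ := hz
    exact ⟨(normSq q).toNat, q, h1, h2, (Int.toNat_of_nonneg normSq_nonneg).symm⟩
  set N := Nat.find hex with hN
  obtain ⟨q1, h1, h10, h1N⟩ := Nat.find_spec hex
  rw [← hN] at h1N
  have hmin : ∀ q : ℍ[ℤ], q * vq v = vq w * q → normSq q < N → q = 0 := by
    intro q hq hlt
    by_contra h0
    have := Nat.find_min hex (m := (normSq q).toNat) (by
      have := normSq_nonneg (a := q)
      omega)
    exact this ⟨q, hq, h0, (Int.toNat_of_nonneg normSq_nonneg).symm⟩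
  have hN0 : 0 < N := by
    have : normSq q1 ≠ 0 := normSq_ne_zero.2 h10
    rw [h1N] at this
    exact Nat.pos_of_ne_zero (by exact_mod_cast this)
  have hstar : ∀ z : ℤ × ℤ × ℤ, star (vq z) = -vq z := by
    intro z; ext <;> simp
  have h1' : vq v * star q1 = star q1 * vq w := by
    have := congrArg star h1
    rw [star_mul, star_mul, hstar, hstar, neg_mul, mul_neg] at this
    exact neg_injective this
  have hcomm : ∀ q : ℍ[ℤ], q * vq v = vq w * q → (star q1 * q) * vq v = vq v * (star q1 * q) := by
    intro q hq
    rw [mul_assoc, hq, ← mul_assoc, ← mul_assoc, h1']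
  have hy : ∀ q : ℍ[ℤ], ∃ y : ℤ, q * vq v = vq w * q → ((star q1 * q).imI = y * v.1 ∧ (star q1 * q).imJ = y * v.2.1 ∧ (star q1 * q).imK = y * v.2.2) := by
    intro q
    by_cases hq : q * vq v = vq w * q
    · obtain ⟨y, hy⟩ := comm_form hv _ (hcomm q hq)
      exact ⟨y, fun _ => hy⟩
    · exact ⟨0, fun h => absurd h hq⟩
  choose y hy using hy
  set x : ℍ[ℤ] → ℤ := fun q => (star q1 * q).re with hx
  have hnorm : ∀ q : ℍ[ℤ], q * vq v = vq w * q → x q ^ 2 + n * y q ^ 2 = N * normSq q := by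
    intro q hq
    obtain ⟨a, b, c⟩ := hy q hq
    have e : normSq (star q1 * q) = N * normSq q := by rw [map_mul, normSq_star, h1N]
    rw [normSq_def', a, b, c] at e
    have hvn : v.1 ^ 2 + v.2.1 ^ 2 + v.2.2 ^ 2 = n := hv.1
    rw [← e]
    simp only [hx]
    linear_combination -(y q ^ 2) * hvn
  refine ⟨4 * √N + 4, by positivity, fun X hX F hF => ?_⟩
  set A : ℕ := ⌊√((X : ℝ) / N)⌋₊ with hA
  set B : ℕ := ⌊√((N : ℝ) * X / n)⌋₊ with hB
  have hNr : (0 : ℝ) < N := by exact_mod_cast hN0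
  have hnr : (0 : ℝ) < n := by exact_mod_cast hn
  have hXr : (1 : ℝ) ≤ X := by exact_mod_cast hX
  have hcard : F.card ≤ ((Finset.Icc (-(A : ℤ) - 1) A) ×ˢ (Finset.Icc (-(B : ℤ)) B)).card := by
    apply Finset.card_le_card_of_injOn (fun q => (x q / N, y q))
    · intro q hq
      obtain ⟨g1, g2⟩ := hF q hq
      have g3 := hnorm q g1
      have g4 : x q ^ 2 + n * y q ^ 2 ≤ N * X := by
        rw [g3]; gcongr
      have g4r : (x q : ℝ) ^ 2 + n * (y q : ℝ) ^ 2 ≤ N * X := by exact_mod_cast g4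
      have gx : |(x q : ℝ) / N| ≤ √((X : ℝ) / N) := by
        apply Real.abs_le_sqrt
        rw [div_pow, div_le_div_iff₀ (by positivity) hNr]
        have : 0 ≤ (n : ℝ) * (y q : ℝ) ^ 2 := by positivity
        nlinarith
      have gy : |(y q : ℝ)| ≤ √((N : ℝ) * X / n) := by
        apply Real.abs_le_sqrt
        rw [le_div_iff₀ hnr]
        nlinarith [sq_nonneg (x q : ℝ)]
      have hAlt := Nat.lt_floor_add_one (√((X : ℝ) / N))
      have hBlt := Nat.lt_floor_add_one (√((N : ℝ) * X / n))
      rw [← hA] at hAlt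
      rw [← hB] at hBlt
      have gx' := abs_lt.1 (lt_of_le_of_lt gx hAlt)
      have gy' := abs_lt.1 (lt_of_le_of_lt gy hBlt)
      rw [Finset.mem_coe, Finset.mem_product, Finset.mem_Icc, Finset.mem_Icc]
      have hNz : (0 : ℤ) < N := by exact_mod_cast hN0
      refine ⟨⟨?_, ?_⟩, ?_, ?_⟩
      · simp only
        rw [Int.le_ediv_iff_mul_le hNz]
        have := gx'.1
        rw [lt_div_iff₀ hNr] at this
        have h5 : ((-(A : ℤ) - 1) * N : ℝ) < x q := by push_cast at this ⊢; linarith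
        exact_mod_cast h5.le
      · simp only
        rw [← Int.lt_add_one_iff, Int.ediv_lt_iff_lt_mul hNz]
        have := gx'.2
        rw [div_lt_iff₀ hNr] at this
        exact_mod_cast this
      · have := gy'.1
        have h5 : ((-(B + 1 : ℤ) : ℤ) : ℝ) < y q := by push_cast; linarith
        have h6 : (-(B + 1 : ℤ)) < y q := by exact_mod_cast h5
        simp only
        omega
      · have := gy'.2
        have h6 : y q < B + 1 := by exact_mod_cast this
        simp only
        omega
    · intro q hq q' hq' heq
      obtain ⟨g1, -⟩ := hF q hq
      obtain ⟨g1', -⟩ := hF q' hq'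
      simp only [Prod.mk.injEq] at heq
      have gs : (q - q') * vq v = vq w * (q - q') := by rw [sub_mul, mul_sub, g1, g1']
      obtain ⟨a, b, c⟩ := hy q g1
      obtain ⟨a', b', c'⟩ := hy q' g1'
      have e : normSq (star q1 * (q - q')) = N * normSq (q - q') := by rw [map_mul, normSq_star, h1N]
      have e2 : normSq (star q1 * (q - q')) = (x q - x q') ^ 2 := by
        rw [mul_sub, normSq_def', Quaternion.re_sub, Quaternion.imI_sub, Quaternion.imJ_sub, Quaternion.imK_sub, a, b, c, a', b', c', heq.2]
        ring
      have hNz : (0 : ℤ) < N := by exact_mod_cast hN0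
      have d1 := Int.emod_add_mul_ediv (x q) N
      have d2 := Int.emod_add_mul_ediv (x q') N
      have d3 := Int.emod_nonneg (x q) hNz.ne'
      have d4 := Int.emod_nonneg (x q') hNz.ne'
      have d5 := Int.emod_lt_of_pos (x q) hNz
      have d6 := Int.emod_lt_of_pos (x q') hNz
      rw [heq.1] at d1
      have d7 : |x q - x q'| < N := by
        rw [abs_lt]; constructor <;> linarith
      have d8 : (x q - x q') ^ 2 < N * N := by
        rw [← sq_abs]
        nlinarith [abs_nonneg (x q - x q')]
      have d9 : normSq (q - q') < N := by
        rw [e2] at e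
        rw [e] at d8
        exact lt_of_mul_lt_mul_left d8 hNz.le
      exact sub_eq_zero.1 (hmin _ gs d9)
  have hA' : (A : ℝ) ≤ √((X : ℝ) / N) := Nat.floor_le (by positivity)
  have hB' : (B : ℝ) ≤ √((N : ℝ) * X / n) := Nat.floor_le (by positivity)
  have hAB : (A : ℝ) * B ≤ X / √n := by
    calc (A : ℝ) * B ≤ √((X : ℝ) / N) * √((N : ℝ) * X / n) := by gcongr
      _ = √((X : ℝ) ^ 2 / n) := by
        rw [← Real.sqrt_mul (by positivity)]
        congr 1
        field_simp
      _ = X / √n := by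
        rw [Real.sqrt_div (by positivity), Real.sqrt_sq (by positivity)]
  have hA2 : (A : ℝ) ≤ √X := by
    refine hA'.trans (Real.sqrt_le_sqrt ?_)
    exact div_le_self (by positivity) (by exact_mod_cast hN0)
  have hB2 : (B : ℝ) ≤ √N * √X := by
    refine hB'.trans ?_
    rw [← Real.sqrt_mul (by positivity)]
    exact Real.sqrt_le_sqrt (div_le_self (by positivity) (by exact_mod_cast hn))
  have hX1 : (1 : ℝ) ≤ √X := Real.one_le_sqrt.2 hXr
  rw [Finset.card_product, Int.card_Icc, Int.card_Icc] at hcard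
  have e1 : ((A : ℤ) + 1 - (-(A : ℤ) - 1)).toNat = 2 * A + 2 := by omega
  have e2 : ((B : ℤ) + 1 - (-(B : ℤ))).toNat = 2 * B + 1 := by omega
  rw [e1, e2] at hcard
  have hc : (F.card : ℝ) ≤ (2 * A + 2) * (2 * B + 1) := by exact_mod_cast hcard
  have : (4 : ℝ) / √n * X = 4 * (X / √n) := by ring
  rw [this]
  nlinarith
end

noncomputable section
open Quaternion

lemma P3_finite {n : ℕ} (hn : n ≠ 0) : (P3 n).Finite := by
  obtain ⟨C, _, h⟩ := S3_bound (ε := 1) one_pos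
  exact (h n hn).1.subset fun v hv => hv.1

def rtF (n m : ℕ) : Finset ℕ := (Finset.range m).filter (fun b => m ∣ b ^ 2 + n)

open Classical in
def ff (Q n m : ℕ) : ℕ := if Squarefree m ∧ m.Coprime Q then (rtF n m).card else 0

lemma partial_sums {n : ℕ} (hn : 0 < n) {v : ℤ × ℤ × ℤ} (hv : v ∈ P3 n) :
    ∃ K : ℝ, 0 ≤ K ∧ ∀ X : ℕ, 1 ≤ X →
      ∑ m ∈ Finset.Icc 1 X, (ff (6 * n * (v.1 ^ 2 + v.2.1 ^ 2).natAbs) n m : ℝ) ≤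
        (P3 n).ncard * (4 / √n) * X + K * √X := by
  classical
  set Q := 6 * n * (v.1 ^ 2 + v.2.1 ^ 2).natAbs with hQ
  choose K hK0 hK using fun w => lattice_count hn hv w
  have hfin := P3_finite hn.ne'
  refine ⟨∑ w ∈ hfin.toFinset, K w, Finset.sum_nonneg fun w _ => hK0 w, fun X hX => ?_⟩
  set I : Finset (Σ _ : ℕ, ℕ) := ((Finset.Icc 1 X).filter (fun m => Squarefree m ∧ m.Coprime Q)).sigma (fun m => rtF n m) with hI
  have hsum : ∑ m ∈ Finset.Icc 1 X, (ff Q n m : ℝ) = I.card := by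
    rw [hI, Finset.card_sigma, Finset.sum_filter]
    push_cast
    apply Finset.sum_congr rfl
    intro m _
    unfold ff
    split_ifs <;> simp
  have hmem : ∀ i ∈ I, (1 ≤ i.1 ∧ i.1 ≤ X) ∧ Squarefree i.1 ∧ i.1.Coprime Q ∧ i.2 < i.1 ∧ (i.1 : ℤ) ∣ (i.2 : ℤ) ^ 2 + n := by
    intro i hi
    rw [hI, Finset.mem_sigma, Finset.mem_filter, Finset.mem_Icc, rtF, Finset.mem_filter, Finset.mem_range] at hi
    refine ⟨hi.1.1, hi.1.2.1, hi.1.2.2, hi.2.1, ?_⟩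
    exact_mod_cast hi.2.2
  have hex : ∀ i : (Σ _ : ℕ, ℕ), ∃ q : ℍ[ℤ], ∃ w : ℤ × ℤ × ℤ, i ∈ I → (w ∈ P3 n ∧ normSq q = i.1 ∧
      QD i.1 (q * ((i.2 : ℤ) + vq v)) ∧ q * vq v = vq w * q) := by
    intro i
    by_cases hi : i ∈ I
    · obtain ⟨_, h1, h2, _, h3⟩ := hmem i hi
      obtain ⟨q, w, hw, h⟩ := exists_wq hv h1 h2 _ h3
      exact ⟨q, w, fun _ => ⟨hw, h⟩⟩
    · exact ⟨0, 0, fun h => absurd h hi⟩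
  choose q w hqw using hex
  have hcard : I.card = ∑ u ∈ hfin.toFinset, (I.filter (fun i => w i = u)).card :=
    Finset.card_eq_sum_card_fiberwise (fun i hi => by
      simp only [Finset.mem_coe, Set.Finite.mem_toFinset]
      exact (hqw i hi).1)
  have hfib : ∀ u ∈ hfin.toFinset, ((I.filter (fun i => w i = u)).card : ℝ) ≤ 4 / √n * X + K u * √X := by
    intro u _
    have hinj : Set.InjOn q (I.filter (fun i => w i = u)) := by
      intro i hi j hj hij
      rw [Finset.mem_coe, Finset.mem_filter] at hi hj
      obtain ⟨_, a1, a2, a3⟩ := hqw i hi.1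
      obtain ⟨_, b1, b2, b3⟩ := hqw j hj.1
      obtain ⟨i1, i2⟩ := i
      obtain ⟨j1, j2⟩ := j
      simp only at *
      have e1 : i1 = j1 := by
        rw [hij, b1] at a1
        exact_mod_cast a1.symm
      subst e1
      obtain ⟨_, c1, c2, c3, c4⟩ := hmem _ hi.1
      obtain ⟨_, d1, d2, d3, d4⟩ := hmem _ hj.1
      simp only at *
      rw [← hij] at b2
      have := b_inj c1 _ _ _ a1 a2 b2
      have e2 : i2 = j2 := by
        have h5 := Int.eq_zero_of_abs_lt_dvd this (by rw [abs_lt]; omega)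
        omega
      rw [e2]
    rw [← Finset.card_image_of_injOn hinj]
    apply hK u X hX
    intro r hr
    obtain ⟨i, hi, rfl⟩ := Finset.mem_image.1 hr
    rw [Finset.mem_filter] at hi
    obtain ⟨_, a1, a2, a3⟩ := hqw i hi.1
    rw [hi.2] at a3
    refine ⟨a3, ?_⟩
    rw [a1]
    exact_mod_cast (hmem i hi.1).1.2
  rw [hsum, hcard]
  push_cast
  refine (Finset.sum_le_sum hfib).trans (le_of_eq ?_)
  rw [Finset.sum_add_distrib, Finset.sum_const, ← Finset.sum_mul, Set.ncard_eq_toFinset_card _ hfin]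
  simp only [nsmul_eq_mul]
  ring

/-- Abel domination -/
lemma abel_dom (f h g : ℕ → ℝ) (hg : Antitone g) (hg0 : ∀ k, 0 ≤ g k)
    (hfh : ∀ N, ∑ k ∈ Finset.range N, f k ≤ ∑ k ∈ Finset.range N, h k) (N : ℕ) :
    ∑ k ∈ Finset.range N, f k * g k ≤ ∑ k ∈ Finset.range N, h k * g k := by
  have key : ∀ N, ∑ k ∈ Finset.range N, (h k - f k) * g k ≥ (∑ k ∈ Finset.range N, (h k - f k)) * g (N - 1) := by
    intro N
    induction N with
    | zero => simp
    | succ N ih =>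
      rw [Finset.sum_range_succ, Finset.sum_range_succ, Nat.add_sub_cancel, add_mul]
      have h1 : 0 ≤ ∑ k ∈ Finset.range N, (h k - f k) := by
        rw [Finset.sum_sub_distrib]; linarith [hfh N]
      have h2 := mul_le_mul_of_nonneg_left (hg (Nat.sub_le N 1)) h1
      linarith
  have h3 := key N
  have h1 : 0 ≤ ∑ k ∈ Finset.range N, (h k - f k) := by
    rw [Finset.sum_sub_distrib]; linarith [hfh N]
  have h4 := mul_nonneg h1 (hg0 (N - 1))
  simp only [sub_mul] at h3
  rw [Finset.sum_sub_distrib] at h3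
  linarith

end

noncomputable section

def Zr (s : ℝ) : ℝ := ∑' k : ℕ, ((k + 1 : ℕ) : ℝ) ^ (-s)

lemma Zr_summable {s : ℝ} (hs : 1 < s) : Summable (fun k : ℕ => ((k + 1 : ℕ) : ℝ) ^ (-s)) :=
  (summable_nat_add_iff (f := fun k : ℕ => (k : ℝ) ^ (-s)) 1).2 (Real.summable_nat_rpow.2 (by linarith))

lemma sum_inv_sqrt (N : ℕ) : √N ≤ ∑ k ∈ Finset.range N, ((k + 1 : ℕ) : ℝ) ^ (-(1/2) : ℝ) := by
  induction N with
  | zero => simp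
  | succ N ih =>
    rw [Finset.sum_range_succ]
    have h1 : ((N + 1 : ℕ) : ℝ) ^ (-(1/2) : ℝ) = 1 / √((N + 1 : ℕ) : ℝ) := by
      rw [Real.rpow_neg (by positivity), Real.sqrt_eq_rpow, one_div, one_div]
    rw [h1]
    have h2 : 0 < √((N + 1 : ℕ) : ℝ) := Real.sqrt_pos.2 (by positivity)
    have h3 : √((N + 1 : ℕ) : ℝ) - √N ≤ 1 / √((N + 1 : ℕ) : ℝ) := by
      rw [le_div_iff₀ h2, sub_mul, Real.mul_self_sqrt (by positivity)]
      have h4 : √(N : ℝ) * √(N : ℝ) = N := Real.mul_self_sqrt (by positivity)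
      have h5 : √(N : ℝ) ≤ √((N + 1 : ℕ) : ℝ) := Real.sqrt_le_sqrt (by push_cast; linarith)
      push_cast at *
      nlinarith [Real.sqrt_nonneg (N : ℝ)]
    linarith

lemma dir_bound (f : ℕ → ℝ) (a K : ℝ) (ha : 0 ≤ a) (hK : 0 ≤ K)
    (h : ∀ X : ℕ, 1 ≤ X → ∑ m ∈ Finset.Icc 1 X, f m ≤ a * X + K * √X) {s : ℝ} (hs : 1 < s) (N : ℕ) :
    ∑ m ∈ Finset.Icc 1 N, f m * (m : ℝ) ^ (-s) ≤ a * Zr s + K * Zr (3 / 2) := by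
  have key : ∀ (F : ℕ → ℝ) (N : ℕ), ∑ m ∈ Finset.Icc 1 N, F m = ∑ k ∈ Finset.range N, F (k + 1) := by
    intro F N
    rw [Finset.range_eq_Ico, Finset.sum_Ico_add' F 0 N 1]
    rfl
  rw [key]
  have h1 := abel_dom (fun k => f (k + 1)) (fun k => a + K * ((k + 1 : ℕ) : ℝ) ^ (-(1/2) : ℝ)) (fun k => ((k + 1 : ℕ) : ℝ) ^ (-s))
    (by
      intro i j hij
      exact Real.rpow_le_rpow_of_nonpos (by positivity) (by exact_mod_cast Nat.succ_le_succ hij) (by linarith))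
    (fun k => by positivity)
    (by
      intro X
      rw [← key, Finset.sum_add_distrib, ← Finset.mul_sum]
      rcases Nat.eq_zero_or_pos X with rfl | hX
      · simp
      · refine (h X hX).trans ?_
        have := mul_le_mul_of_nonneg_left (sum_inv_sqrt X) hK
        simp only [Finset.sum_const, Finset.card_range, nsmul_eq_mul]
        linarith) N
  refine h1.trans ?_
  simp only [add_mul]
  rw [Finset.sum_add_distrib, ← Finset.mul_sum]
  have h2 : ∑ k ∈ Finset.range N, ((k + 1 : ℕ) : ℝ) ^ (-s) ≤ Zr s :=
    (Zr_summable hs).sum_le_tsum _ (fun k _ => by positivity)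
  have h3 : ∑ k ∈ Finset.range N, K * ((k + 1 : ℕ) : ℝ) ^ (-(1/2) : ℝ) * ((k + 1 : ℕ) : ℝ) ^ (-s) ≤ K * Zr (3/2) := by
    have h4 : ∑ k ∈ Finset.range N, ((k + 1 : ℕ) : ℝ) ^ (-(3/2) : ℝ) ≤ Zr (3/2) :=
      (Zr_summable (by norm_num)).sum_le_tsum _ (fun k _ => by positivity)
    refine le_trans ?_ (mul_le_mul_of_nonneg_left h4 hK)
    rw [Finset.mul_sum]
    apply Finset.sum_le_sum
    intro k _
    rw [mul_assoc, ← Real.rpow_add (by positivity)]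
    gcongr
    · push_cast; linarith [(Nat.cast_nonneg k : (0:ℝ) ≤ k)]
    · linarith
  have := mul_le_mul_of_nonneg_left h2 ha
  linarith

lemma rtF_card (n m : ℕ) [NeZero m] : (rtF n m).card = Nat.card {x : ZMod m // x ^ 2 + (n : ZMod m) = 0} := by
  classical
  rw [Nat.card_eq_fintype_card, Fintype.card_subtype]
  apply Finset.card_bij (fun (b : ℕ) _ => (b : ZMod m))
  · intro b hb
    rw [rtF, Finset.mem_filter] at hb
    rw [Finset.mem_filter]
    refine ⟨Finset.mem_univ _, ?_⟩
    have := (ZMod.natCast_eq_zero_iff (b ^ 2 + n) m).2 hb.2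
    push_cast at this
    exact this
  · intro b hb c hc h
    rw [rtF, Finset.mem_filter, Finset.mem_range] at hb hc
    rw [ZMod.natCast_eq_natCast_iff'] at h
    rwa [Nat.mod_eq_of_lt hb.1, Nat.mod_eq_of_lt hc.1] at h
  · intro x hx
    rw [Finset.mem_filter] at hx
    refine ⟨x.val, ?_, ZMod.natCast_zmod_val x⟩
    rw [rtF, Finset.mem_filter, Finset.mem_range]
    refine ⟨ZMod.val_lt x, ?_⟩
    rw [← ZMod.natCast_eq_zero_iff]
    push_cast
    rw [ZMod.natCast_zmod_val]
    exact hx.2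

lemma rtF_mul (n : ℕ) {a b : ℕ} (ha : a ≠ 0) (hb : b ≠ 0) (h : a.Coprime b) :
    (rtF n (a * b)).card = (rtF n a).card * (rtF n b).card := by
  have : NeZero a := ⟨ha⟩
  have : NeZero b := ⟨hb⟩
  have : NeZero (a * b) := ⟨mul_ne_zero ha hb⟩
  rw [rtF_card, rtF_card, rtF_card, ← Nat.card_prod]
  have e := ZMod.chineseRemainder h
  apply Nat.card_congr
  refine Equiv.trans (Equiv.subtypeEquiv e.toEquiv (q := fun y => (y.1 ^ 2 + (n : ZMod a) = 0) ∧ (y.2 ^ 2 + (n : ZMod b) = 0)) ?_)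
    (Equiv.subtypeProdEquivProd (p := fun x : ZMod a => x ^ 2 + (n : ZMod a) = 0) (q := fun x : ZMod b => x ^ 2 + (n : ZMod b) = 0))
  intro x
  rw [← (map_eq_zero_iff e e.injective), map_add, map_pow, map_natCast]
  rw [Prod.ext_iff]
  rfl

lemma ff_prod (Q n : ℕ) (T : Finset ℕ) (hT : ∀ p ∈ T, p.Prime ∧ p.Coprime Q) :
    ff Q n (∏ p ∈ T, p) = ∏ p ∈ T, (rtF n p).card ∧ Squarefree (∏ p ∈ T, p) := by
  classical
  have hsq : Squarefree (∏ p ∈ T, p) := by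
    apply Finset.squarefree_prod_of_pairwise_isCoprime
    · intro p hp q hq hpq
      exact Nat.coprime_iff_isRelPrime.1 ((Nat.coprime_primes (hT p hp).1 (hT q hq).1).2 hpq)
    · intro p hp
      exact (hT p hp).1.squarefree
  refine ⟨?_, hsq⟩
  have hco : (∏ p ∈ T, p).Coprime Q := Nat.Coprime.prod_left fun p hp => (hT p hp).2
  rw [ff, if_pos ⟨hsq, hco⟩]
  clear hsq hco
  induction T using Finset.induction_on with
  | empty => simp [rtF]
  | insert p T hp ih =>
    rw [Finset.prod_insert hp, Finset.prod_insert hp]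
    have hT' : ∀ q ∈ T, q.Prime ∧ q.Coprime Q := fun q hq => hT q (Finset.mem_insert_of_mem hq)
    rw [rtF_mul, ih hT']
    · exact (hT p (Finset.mem_insert_self p T)).1.ne_zero
    · exact Finset.prod_ne_zero_iff.2 fun q hq => (hT' q hq).1.ne_zero
    · apply Nat.Coprime.prod_right
      intro q hq
      rw [Nat.coprime_primes (hT p (Finset.mem_insert_self p T)).1 (hT' q hq).1]
      rintro rfl
      exact hp hq

lemma euler_le (Q n : ℕ) (S : Finset ℕ) (hS : ∀ p ∈ S, p.Prime ∧ p.Coprime Q) (s B : ℝ)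
    (hB : ∀ N : ℕ, ∑ m ∈ Finset.Icc 1 N, (ff Q n m : ℝ) * (m : ℝ) ^ (-s) ≤ B) :
    ∏ p ∈ S, (1 + ((rtF n p).card : ℝ) * (p : ℝ) ^ (-s)) ≤ B := by
  classical
  rw [Finset.prod_one_add]
  have hsub : ∀ T ∈ S.powerset, ∀ p ∈ T, p.Prime ∧ p.Coprime Q := fun T hT p hp => hS p (Finset.mem_powerset.1 hT hp)
  have h1 : ∀ T ∈ S.powerset, ∏ p ∈ T, ((rtF n p).card : ℝ) * (p : ℝ) ^ (-s) =
      (ff Q n (∏ p ∈ T, p) : ℝ) * ((∏ p ∈ T, p : ℕ) : ℝ) ^ (-s) := by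
    intro T hT
    rw [(ff_prod Q n T (hsub T hT)).1, Finset.prod_mul_distrib]
    push_cast
    rw [Real.finsetProd_rpow]
    intro i _
    positivity
  rw [Finset.sum_congr rfl h1]
  have hinj : Set.InjOn (fun T : Finset ℕ => ∏ p ∈ T, p) (S.powerset : Set (Finset ℕ)) := by
    intro T hT T' hT' h
    have e : ∀ T ∈ S.powerset, (∏ p ∈ T, p).primeFactors = T := by
      intro T hT
      exact Nat.primeFactors_prod fun p hp => (hsub T hT p hp).1
    have := congrArg Nat.primeFactors h
    simp only at this
    rwa [e T hT, e T' hT'] at this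
  rw [← Finset.sum_image (f := fun m : ℕ => (ff Q n m : ℝ) * (m : ℝ) ^ (-s)) hinj]
  refine le_trans ?_ (hB ((S.powerset.image (fun T : Finset ℕ => ∏ p ∈ T, p)).sup id))
  apply Finset.sum_le_sum_of_subset_of_nonneg
  · intro m hm
    rw [Finset.mem_Icc]
    refine ⟨?_, Finset.le_sup (f := id) hm⟩
    obtain ⟨T, hT, rfl⟩ := Finset.mem_image.1 hm
    exact Nat.pos_of_ne_zero (Finset.prod_ne_zero_iff.2 fun q hq => (hsub T hT q hq).1.ne_zero)
  · intro i _ _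
    positivity
end

noncomputable section
open Filter Topology

lemma jac_val {n : ℕ} (m : ℕ) (hm : m.Coprime (4 * n)) :
    jacobiSym (-(n : ℤ)) ((m : ZMod (4 * n)).val) = jacobiSym (-(n : ℤ)) m := by
  have hodd : Odd m := by
    rw [← Nat.coprime_two_right]
    exact Nat.Coprime.coprime_dvd_right ⟨2 * n, by ring⟩ hm
  rw [ZMod.val_natCast, jacobiSym.mod_right _ hodd]
  simp

open Classical in
def chiN (n : ℕ) [NeZero n] : DirichletCharacter ℂ (4 * n) where
  toFun a := if IsUnit a then ((jacobiSym (-(n : ℤ)) a.val : ℤ) : ℂ) else 0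
  map_one' := by
    have h := jac_val (n := n) 1 (by simp)
    rw [Nat.cast_one] at h
    rw [if_pos isUnit_one, h]
    simp
  map_mul' a b := by
    by_cases ha : IsUnit a
    · by_cases hb : IsUnit b
      · simp only [ha, hb, ha.mul hb, if_true]
        have h1 : a.val.Coprime (4 * n) := by
          obtain ⟨u, rfl⟩ := ha
          exact ZMod.val_coe_unit_coprime u
        have h2 : b.val.Coprime (4 * n) := by
          obtain ⟨u, rfl⟩ := hb
          exact ZMod.val_coe_unit_coprime u
        have h := jac_val (n := n) (a.val * b.val) (Nat.Coprime.mul_left h1 h2)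
        have : NeZero (4 * n) := ⟨mul_ne_zero (by norm_num) (NeZero.ne n)⟩
        push_cast at h
        rw [ZMod.natCast_zmod_val, ZMod.natCast_zmod_val] at h
        have hva : NeZero a.val := ⟨by
          intro h0; rw [h0, Nat.coprime_zero_left] at h1; omega⟩
        have hvb : NeZero b.val := ⟨by
          intro h0; rw [h0, Nat.coprime_zero_left] at h2; omega⟩
        rw [h, jacobiSym.mul_right]
        push_cast
        rfl
      · have : ¬ IsUnit (a * b) := fun h => hb (isUnit_of_mul_isUnit_right h)
        simp [this, hb]
    · have : ¬ IsUnit (a * b) := fun h => ha (isUnit_of_mul_isUnit_left h)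
      simp [this, ha]
  map_nonunit' a ha := by simp [ha]

lemma chiN_apply (n : ℕ) [NeZero n] (m : ℕ) (hm : m.Coprime (4 * n)) :
    chiN n (m : ZMod (4 * n)) = ((jacobiSym (-(n : ℤ)) m : ℤ) : ℂ) := by
  have hu : IsUnit (m : ZMod (4 * n)) := (ZMod.isUnit_iff_coprime _ _).2 hm
  have : chiN n (m : ZMod (4 * n)) = if IsUnit (m : ZMod (4 * n)) then ((jacobiSym (-(n : ℤ)) (m : ZMod (4 * n)).val : ℤ) : ℂ) else 0 := rfl
  rw [this, if_pos hu, jac_val m hm]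

lemma chiN_pm (n : ℕ) [NeZero n] (m : ℕ) : ∃ e : ℤ, chiN n (m : ZMod (4 * n)) = (e : ℂ) ∧ (e = 0 ∨ e = 1 ∨ e = -1) := by
  by_cases hm : m.Coprime (4 * n)
  · refine ⟨_, chiN_apply n m hm, ?_⟩
    right
    apply jacobiSym.eq_one_or_neg_one
    have h2 : Nat.gcd n m = 1 := (Nat.Coprime.coprime_mul_left_right hm).symm
    rw [Int.gcd_def, Int.natAbs_neg, Int.natAbs_natCast, Int.natAbs_natCast]
    exact h2
  · refine ⟨0, ?_, Or.inl rfl⟩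
    rw [MulChar.map_nonunit _ (by rwa [ZMod.isUnit_iff_coprime])]
    simp

lemma chiN_sq (n : ℕ) [NeZero n] : (chiN n) ^ 2 = 1 := by
  have : NeZero (4 * n) := ⟨mul_ne_zero (by norm_num) (NeZero.ne n)⟩
  apply MulChar.ext
  intro u
  rw [MulChar.pow_apply_coe, MulChar.one_apply_coe]
  obtain ⟨e, h1, h2⟩ := chiN_pm n (u : ZMod (4 * n)).val
  rw [ZMod.natCast_zmod_val] at h1
  have h0 : chiN n u ≠ 0 := (u.isUnit.map (chiN n)).ne_zero
  rw [h1] at h0 ⊢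
  rcases h2 with rfl | rfl | rfl
  · simp at h0
  · simp
  · simp

lemma chiN_ne_one (n : ℕ) [NeZero n] : chiN n ≠ 1 := by
  intro h
  have hn : 0 < n := Nat.pos_of_ne_zero (NeZero.ne n)
  have hco : (4 * n - 1).Coprime (4 * n) := by
    obtain ⟨k, hk⟩ : ∃ k, 4 * n = k + 1 := ⟨4 * n - 1, by omega⟩
    rw [hk]; simp
  have h1 := chiN_apply n (4 * n - 1) hco
  rw [h, MulChar.one_apply ((ZMod.isUnit_iff_coprime _ _).2 hco)] at h1
  have hodd : Odd (4 * n - 1) := by rw [Nat.odd_iff]; omega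
  have h2 : jacobiSym (-(n : ℤ)) (4 * n - 1) = -1 := by
    rw [neg_eq_neg_one_mul, jacobiSym.mul_left, jacobiSym.at_neg_one hodd, ZMod.χ₄_nat_three_mod_four (by omega)]
    have h3 : jacobiSym (2 ^ 2 * n) (4 * n - 1) = 1 := by
      rw [jacobiSym.mod_left' (a₂ := 1), jacobiSym.one_left]
      have : (2 : ℤ) ^ 2 * n = 1 + ((4 * n - 1 : ℕ) : ℤ) * 1 := by
        push_cast [Nat.cast_sub (show 1 ≤ 4 * n by omega)]; ring
      rw [this, Int.add_mul_emod_self_left]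
    rw [jacobiSym.mul_left, jacobiSym.sq_one'] at h3
    · rw [one_mul] at h3
      rw [h3]; norm_num
    · have : Int.gcd 2 ((4 * n - 1 : ℕ) : ℤ) = Nat.gcd 2 (4 * n - 1) := rfl
      rw [this]
      exact Nat.coprime_two_left.2 hodd
  rw [h2] at h1
  norm_num at h1

lemma rtF_prime (n p : ℕ) (hp : p.Prime) (hp2 : p ≠ 2) : ((rtF n p).card : ℤ) = jacobiSym (-(n : ℤ)) p + 1 := by
  classical
  have : Fact p.Prime := ⟨hp⟩
  rw [← jacobiSym.legendreSym.to_jacobiSym, ← legendreSym.card_sqrts p hp2, rtF_card, Nat.card_eq_fintype_card, Fintype.card_subtype]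
  congr 2
  ext x
  simp [eq_neg_iff_add_eq_zero]

lemma loc_ineq (x y e c : ℝ) (hx0 : 0 < x) (hx : x ≤ 1 / 5) (hy : x ^ 2 ≤ y) (hy1 : y < 1) (he : e = 1 ∨ e = -1) (hc : c = e + 1) :
    (1 - x)⁻¹ * (1 - e * x)⁻¹ ≤ (1 + c * x) * ((1 - y)⁻¹) ^ 4 := by
  have h1 : (1 - y) ^ 4 ≤ (1 - x ^ 2) ^ 4 := pow_le_pow_left₀ (by linarith) (by linarith) 4
  have hy0 : 0 < (1 - y) ^ 4 := pow_pos (by linarith) 4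
  have hx1 : 0 < 1 - x := by linarith
  have ht : x ^ 2 ≤ 1 / 25 := by nlinarith
  have ht0 : 0 < x ^ 2 := by positivity
  rw [inv_pow, ← mul_inv, ← div_eq_mul_inv, inv_le_iff_one_le_mul₀' (by rcases he with rfl | rfl <;> nlinarith), ← mul_div_assoc, le_div_iff₀ hy0, one_mul]
  refine h1.trans ?_
  rcases he with rfl | rfl
  · subst hc
    have : (1 - x ^ 2) ^ 4 ≤ 1 - 3 * x ^ 2 := by nlinarith [mul_pos ht0 ht0, mul_pos (mul_pos ht0 ht0) ht0]
    nlinarith [mul_pos ht0 hx0]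
  · subst hc
    have h3 : (1 - x ^ 2) ^ 4 ≤ (1 - x ^ 2) ^ 1 := pow_le_pow_of_le_one (by nlinarith) (by nlinarith) (by norm_num)
    nlinarith

end

noncomputable section
open Filter Topology

lemma cpow_real (p : ℕ) (s : ℝ) : (p : ℂ) ^ (-(s : ℂ)) = (((p : ℝ) ^ (-s) : ℝ) : ℂ) := by
  rw [Complex.ofReal_cpow (by positivity)]
  push_cast
  rfl

lemma Zr_eq {s : ℝ} (hs : 1 < s) : Zr s = ‖riemannZeta s‖ := by
  have h : riemannZeta s = ((Zr s : ℝ) : ℂ) := by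
    rw [zeta_eq_tsum_one_div_nat_add_one_cpow (by simpa using hs), Zr, Complex.ofReal_tsum]
    apply tsum_congr
    intro k
    have := cpow_real (k + 1) s
    rw [← this, Complex.cpow_neg]
    simp
  rw [h, Complex.norm_real, Real.norm_of_nonneg]
  exact tsum_nonneg fun k => by positivity

lemma Zr_tendsto : Tendsto (fun s : ℝ => (s - 1) * Zr s) (𝓝[>] 1) (𝓝 1) := by
  refine tendsto_sub_mul_tsum_nat_rpow.congr' ?_
  filter_upwards [self_mem_nhdsWithin] with s hs
  have hs : 1 < s := hs
  congr 1
  rw [Zr, Summable.tsum_eq_zero_add (by simpa using Real.summable_one_div_nat_rpow.2 hs)]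
  rw [Nat.cast_zero, Real.zero_rpow (by linarith)]
  simp only [div_zero, zero_add]
  apply tsum_congr
  intro k
  rw [Real.rpow_neg (by positivity), one_div]

lemma exists_Z0 : ∃ Z : ℝ, 0 < Z ∧ ∀ N : ℕ, ∏ p ∈ N.primesBelow, ((1 - ((p : ℝ) ^ 2)⁻¹)⁻¹) ^ 4 ≤ Z := by
  have h := (riemannZeta_eulerProduct (s := ((2 : ℝ) : ℂ)) (by norm_num)).norm
  obtain ⟨B, hB⟩ := h.bddAbove_range
  refine ⟨(max B 1) ^ 4, by positivity, fun N => ?_⟩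
  have := hB ⟨N, rfl⟩
  rw [Finset.prod_pow]
  have hpr : ∀ p ∈ N.primesBelow, 0 ≤ (1 - ((p : ℝ) ^ 2)⁻¹)⁻¹ := by
    intro p hp
    have hp := (Nat.prime_of_mem_primesBelow hp).one_le
    have : (1 : ℝ) ≤ p := by exact_mod_cast hp
    rw [inv_nonneg, sub_nonneg]
    exact inv_le_one_of_one_le₀ (by nlinarith)
  refine pow_le_pow_left₀ (Finset.prod_nonneg hpr) (le_trans ?_ (le_max_left _ _)) 4
  refine le_trans (le_of_eq ?_) this
  simp only [norm_prod]
  apply Finset.prod_congr rfl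
  intro p hp
  rw [cpow_real]
  have h2 : (p : ℝ) ^ (-2 : ℝ) = ((p : ℝ) ^ 2)⁻¹ := by
    rw [Real.rpow_neg (by positivity)]; norm_num
  rw [h2, norm_inv, ← Complex.ofReal_one, ← Complex.ofReal_sub, Complex.norm_real, ← norm_inv, Real.norm_of_nonneg (hpr p hp)]

lemma fac_bound (n Q p : ℕ) [NeZero n] (hQ : 6 * n ∣ Q) (hp : p.Prime) (s : ℝ) (hs : 1 < s) :
    ‖(1 - (p : ℂ) ^ (-(s : ℂ)))⁻¹‖ * ‖(1 - chiN n (p : ZMod (4 * n)) * (p : ℂ) ^ (-(s : ℂ)))⁻¹‖ ≤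
      (if p ∣ Q then 4 else 1) * (if p ∣ Q then 1 else 1 + ((rtF n p).card : ℝ) * (p : ℝ) ^ (-s)) *
        ((1 - ((p : ℝ) ^ 2)⁻¹)⁻¹) ^ 4 := by
  have hp2 : (2 : ℝ) ≤ p := by exact_mod_cast hp.two_le
  set x : ℝ := (p : ℝ) ^ (-s) with hx
  have hx0 : 0 < x := by positivity
  have hxp : x ≤ (p : ℝ)⁻¹ := by
    rw [hx, ← Real.rpow_neg_one]
    exact Real.rpow_le_rpow_of_exponent_le (by linarith) (by linarith)
  have hx2 : x ≤ 1 / 2 := hxp.trans (by rw [one_div]; exact inv_anti₀ (by norm_num) hp2)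
  have hy1 : ((p : ℝ) ^ 2)⁻¹ < 1 := inv_lt_one_of_one_lt₀ (by nlinarith)
  have hxy : x ^ 2 ≤ ((p : ℝ) ^ 2)⁻¹ := by
    rw [← inv_pow]; exact pow_le_pow_left₀ hx0.le hxp 2
  have hD : 1 ≤ ((1 - ((p : ℝ) ^ 2)⁻¹)⁻¹) ^ 4 := by
    apply one_le_pow₀
    rw [one_le_inv₀ (by linarith)]
    have : 0 < ((p : ℝ) ^ 2)⁻¹ := by positivity
    linarith
  obtain ⟨e, he, he3⟩ := chiN_pm n p
  rw [cpow_real, he, ← hx]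
  have e1 : ‖(1 - (x : ℂ))⁻¹‖ = (1 - x)⁻¹ := by
    rw [norm_inv, ← Complex.ofReal_one, ← Complex.ofReal_sub, Complex.norm_real, Real.norm_of_nonneg (by linarith)]
  have habs : (e : ℝ) * x ≤ x := by
    rcases he3 with rfl | rfl | rfl <;> simp <;> linarith
  have e2 : ‖(1 - (e : ℂ) * (x : ℂ))⁻¹‖ = (1 - e * x)⁻¹ := by
    rw [norm_inv]
    have : (1 : ℂ) - (e : ℂ) * x = ((1 - (e : ℝ) * x : ℝ) : ℂ) := by push_cast; ring
    rw [this, Complex.norm_real, Real.norm_of_nonneg (by linarith)]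
  rw [e1, e2]
  split_ifs with hpQ
  · have h1 : (1 - x)⁻¹ ≤ 2 := by
      rw [inv_le_comm₀ (by linarith) (by norm_num)]; linarith
    have h2 : (1 - (e : ℝ) * x)⁻¹ ≤ 2 := by
      rw [inv_le_comm₀ (by linarith) (by norm_num)]; linarith
    have h3 : 0 ≤ (1 - (e : ℝ) * x)⁻¹ := inv_nonneg.2 (by linarith)
    nlinarith
  · have hp6 : p.Coprime (6 * n) := (Nat.Prime.coprime_iff_not_dvd hp).2 fun h => hpQ (h.trans hQ)
    have hpn : p.Coprime n := hp6.coprime_mul_left_right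
    have hp2' : p ≠ 2 := by
      rintro rfl
      exact hpQ (dvd_trans ⟨3 * n, by ring⟩ hQ)
    have hp3' : p ≠ 3 := by
      rintro rfl
      exact hpQ (dvd_trans ⟨2 * n, by ring⟩ hQ)
    have hp4' : p ≠ 4 := by
      rintro rfl
      norm_num at hp
    have hp5 : (5 : ℝ) ≤ p := by
      have := hp.two_le
      have : 5 ≤ p := by omega
      exact_mod_cast this
    have hp4 : p.Coprime (4 * n) := by
      apply Nat.Coprime.mul_right _ hpn
      rw [show 4 = 2 ^ 2 by norm_num]
      exact Nat.Coprime.pow_right 2 ((Nat.coprime_primes hp Nat.prime_two).2 hp2')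
    have hje : e = jacobiSym (-(n : ℤ)) p := by
      have := chiN_apply n p hp4
      rw [he] at this
      exact_mod_cast this
    have hc := rtF_prime n p hp hp2'
    rw [← hje] at hc
    have hc' : ((rtF n p).card : ℝ) = e + 1 := by exact_mod_cast hc
    have he2 : (e : ℝ) = 1 ∨ (e : ℝ) = -1 := by
      have : IsUnit (chiN n (p : ZMod (4 * n))) := ((ZMod.isUnit_iff_coprime _ _).2 hp4).map _
      rcases he3 with rfl | rfl | rfl
      · rw [he] at this; simp at this
      · left; simp
      · right; simp
    have := loc_ineq x _ e _ hx0 (hxp.trans (by rw [one_div]; exact inv_anti₀ (by norm_num) hp5)) hxy hy1 he2 hc'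
    rw [one_mul]
    exact this

lemma prod_bound : ∃ Z : ℝ, 0 < Z ∧ ∀ (n Q : ℕ) [NeZero n], 6 * n ∣ Q → Q ≠ 0 → ∀ s : ℝ, 1 < s → ∀ B : ℝ,
    (∀ N, ∑ m ∈ Finset.Icc 1 N, (ff Q n m : ℝ) * (m : ℝ) ^ (-s) ≤ B) →
    Zr s * ‖DirichletCharacter.LFunction (chiN n) s‖ ≤ 4 ^ Q.primeFactors.card * Z * B := by
  obtain ⟨Z, hZ, hZb⟩ := exists_Z0
  refine ⟨Z, hZ, fun n Q _ hQ hQ0 s hs B hB => ?_⟩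
  have : NeZero (4 * n) := ⟨mul_ne_zero (by norm_num) (NeZero.ne n)⟩
  have hs' : 1 < (s : ℂ).re := by simpa using hs
  rw [Zr_eq hs, DirichletCharacter.LFunction_eq_LSeries _ hs']
  refine le_of_tendsto' (((riemannZeta_eulerProduct hs').norm).mul ((DirichletCharacter.LSeries_eulerProduct (chiN n) hs').norm)) fun N => ?_
  simp only [norm_prod]
  rw [← Finset.prod_mul_distrib]
  have hB0 : 0 ≤ B := le_trans (by simp) (hB 0)
  calc _ ≤ ∏ p ∈ N.primesBelow, ((if p ∣ Q then (4:ℝ) else 1) * (if p ∣ Q then 1 else 1 + ((rtF n p).card : ℝ) * (p : ℝ) ^ (-s)) *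
        ((1 - ((p : ℝ) ^ 2)⁻¹)⁻¹) ^ 4) := by
        apply Finset.prod_le_prod
        · intro p hp; positivity
        · intro p hp
          exact fac_bound n Q p hQ (Nat.prime_of_mem_primesBelow hp) s hs
    _ = (∏ p ∈ N.primesBelow, (if p ∣ Q then (4:ℝ) else 1)) * (∏ p ∈ N.primesBelow, (if p ∣ Q then 1 else 1 + ((rtF n p).card : ℝ) * (p : ℝ) ^ (-s))) *
        ∏ p ∈ N.primesBelow, ((1 - ((p : ℝ) ^ 2)⁻¹)⁻¹) ^ 4 := by
        rw [Finset.prod_mul_distrib, Finset.prod_mul_distrib]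
    _ ≤ 4 ^ Q.primeFactors.card * B * Z := by
        have hP2 : ∏ p ∈ N.primesBelow, (if p ∣ Q then (1:ℝ) else 1 + ((rtF n p).card : ℝ) * (p : ℝ) ^ (-s)) ≤ B := by
          have := euler_le Q n (N.primesBelow.filter fun p => ¬ p ∣ Q) (by
            intro p hp
            rw [Finset.mem_filter] at hp
            have hpp := Nat.prime_of_mem_primesBelow hp.1
            exact ⟨hpp, (Nat.Prime.coprime_iff_not_dvd hpp).2 hp.2⟩) s B hB
          rw [Finset.prod_filter] at this
          refine le_trans (le_of_eq ?_) this
          apply Finset.prod_congr rfl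
          intro p _
          split_ifs <;> simp_all
        have hP1 : ∏ p ∈ N.primesBelow, (if p ∣ Q then (4:ℝ) else 1) ≤ 4 ^ Q.primeFactors.card := by
          rw [← Finset.prod_filter, Finset.prod_const]
          apply pow_le_pow_right₀ (by norm_num)
          apply Finset.card_le_card
          intro p hp
          rw [Finset.mem_filter] at hp
          rw [Nat.mem_primeFactors]
          exact ⟨Nat.prime_of_mem_primesBelow hp.1, hp.2, hQ0⟩
        have n2 : 0 ≤ ∏ p ∈ N.primesBelow, (if p ∣ Q then (1:ℝ) else 1 + ((rtF n p).card : ℝ) * (p : ℝ) ^ (-s)) := by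
          apply Finset.prod_nonneg
          intro p _
          split_ifs <;> positivity
        have n3 : 0 ≤ ∏ p ∈ N.primesBelow, ((1 - ((p : ℝ) ^ 2)⁻¹)⁻¹) ^ 4 := by
          apply Finset.prod_nonneg
          intro p _
          positivity
        have n1 : (0 : ℝ) ≤ 4 ^ Q.primeFactors.card := by positivity
        exact mul_le_mul (mul_le_mul hP1 hP2 n2 n1) (hZb N) n3 (mul_nonneg n1 hB0)
    _ = _ := by ring

lemma L1_bound : ∃ Z : ℝ, 0 < Z ∧ ∀ (n : ℕ) [NeZero n] (v : ℤ × ℤ × ℤ), v ∈ P3 n → v.1 ^ 2 + v.2.1 ^ 2 ≠ 0 →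
    ‖DirichletCharacter.LFunction (chiN n) 1‖ ≤
      4 ^ (6 * n * (v.1 ^ 2 + v.2.1 ^ 2).natAbs).primeFactors.card * Z * ((P3 n).ncard * (4 / √n)) := by
  obtain ⟨Z, hZ, hZb⟩ := prod_bound
  refine ⟨Z, hZ, fun n _ v hv hv0 => ?_⟩
  have : NeZero (4 * n) := ⟨mul_ne_zero (by norm_num) (NeZero.ne n)⟩
  have hn : 0 < n := Nat.pos_of_ne_zero (NeZero.ne n)
  obtain ⟨K, hK, hps⟩ := partial_sums hn hv
  set Q := 6 * n * (v.1 ^ 2 + v.2.1 ^ 2).natAbs with hQ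
  set a : ℝ := (P3 n).ncard * (4 / √n) with ha
  have ha0 : 0 ≤ a := by positivity
  have hQ0 : Q ≠ 0 := by
    have := Int.natAbs_ne_zero.2 hv0
    positivity
  have key : ∀ s : ℝ, 1 < s → ((s - 1) * Zr s) * ‖DirichletCharacter.LFunction (chiN n) s‖ ≤
      4 ^ Q.primeFactors.card * Z * (a * ((s - 1) * Zr s) + (s - 1) * (K * Zr (3 / 2))) := by
    intro s hs
    have := hZb n Q ⟨_, rfl⟩ hQ0 s hs _ (fun N => dir_bound (fun m => (ff Q n m : ℝ)) a K ha0 hK hps hs N)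
    have h2 := mul_le_mul_of_nonneg_left this (show 0 ≤ s - 1 by linarith)
    calc _ = _ := by ring
      _ ≤ _ := h2
      _ = _ := by ring
  have hcont : Tendsto (fun s : ℝ => ‖DirichletCharacter.LFunction (chiN n) s‖) (𝓝[>] 1) (𝓝 ‖DirichletCharacter.LFunction (chiN n) 1‖) := by
    have h1 : Continuous fun s : ℝ => ‖DirichletCharacter.LFunction (chiN n) s‖ :=
      ((DirichletCharacter.differentiable_LFunction (chiN_ne_one n)).continuous.comp Complex.continuous_ofReal).norm
    have := (h1.tendsto 1).mono_left (nhdsWithin_le_nhds (s := Set.Ioi 1))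
    simpa using this
  have hsub : Tendsto (fun s : ℝ => s - 1) (𝓝[>] 1) (𝓝 0) := by
    have h1 : Continuous fun s : ℝ => s - 1 := by fun_prop
    have := (h1.tendsto 1).mono_left (nhdsWithin_le_nhds (s := Set.Ioi 1))
    simpa using this
  have hlim := le_of_tendsto_of_tendsto (Zr_tendsto.mul hcont)
    (((Zr_tendsto.const_mul a).add (hsub.mul_const (K * Zr (3 / 2)))).const_mul (4 ^ Q.primeFactors.card * Z))
    (by filter_upwards [self_mem_nhdsWithin] with s hs; exact key s hs)
  simpa using hlim

end

noncomputable section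
open Filter Topology

lemma two_pow_omega_le {Q : ℕ} (hQ : Q ≠ 0) : 2 ^ Q.primeFactors.card ≤ Q.divisors.card := by
  rw [Nat.card_divisors hQ, ← Finset.prod_const]
  apply Finset.prod_le_prod'
  intro p hp
  have : Q.factorization p ≠ 0 := by
    rw [← Finsupp.mem_support_iff]; simpa using hp
  omega

lemma exists_good {n : ℕ} (h : n % 8 = 1 ∨ n % 8 = 2 ∨ n % 8 = 3 ∨ n % 8 = 5 ∨ n % 8 = 6) :
    ∃ v ∈ P3 n, v.1 ^ 2 + v.2.1 ^ 2 ≠ 0 ∧ (v.1 ^ 2 + v.2.1 ^ 2).natAbs ≤ n := by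
  obtain ⟨X, Y, Z, h1, r, s, t, h2⟩ := three_sq n h
  have key : ∀ A B C : ℤ, A ^ 2 + B ^ 2 + C ^ 2 = n → (A ^ 2 + B ^ 2).natAbs ≤ n := by
    intro A B C hh
    have := sq_nonneg A
    have := sq_nonneg B
    have := sq_nonneg C
    omega
  by_cases h0 : X ^ 2 + Y ^ 2 = 0
  · have hX : X = 0 := by nlinarith [sq_nonneg X, sq_nonneg Y]
    have hY : Y = 0 := by nlinarith [sq_nonneg X, sq_nonneg Y]
    refine ⟨(Z, X, Y), ⟨?_, t, r, s, ?_⟩, ?_, key Z X Y ?_⟩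
    · simp only [S3, Set.mem_ofPred_eq]; linarith
    · simp only; linarith
    · simp only [hX]
      intro h3
      have : Z = 0 := by nlinarith
      subst hX hY this
      simp at h2
    · linarith
  · exact ⟨(X, Y, Z), ⟨h1, r, s, t, h2⟩, h0, key X Y Z h1⟩

lemma P3_lower_aux {ε : ℝ} (hε : 0 < ε) (hε1 : ε ≤ 1) : ∃ c : ℝ, 0 < c ∧ ∀ n : ℕ,
    (n % 8 = 1 ∨ n % 8 = 2 ∨ n % 8 = 3 ∨ n % 8 = 5 ∨ n % 8 = 6) →
    c * (n : ℝ) ^ (1 / 2 - ε) ≤ ((P3 n).ncard : ℝ) := by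
  obtain ⟨c1, hc1, hsie⟩ := siegel (ε := ε / 2) (by linarith) (by linarith)
  obtain ⟨C, hC, hdiv⟩ := divisor_bound (ε := ε / 8) (by linarith)
  obtain ⟨Z, hZ, hL⟩ := L1_bound
  have hC0 : 0 < C := by linarith
  refine ⟨c1 * 4 ^ (-(ε / 2)) / (4 * Z * (C ^ 2 * 6 ^ (ε / 4))), by positivity, fun n hn => ?_⟩
  have hn0 : n ≠ 0 := by omega
  have : NeZero n := ⟨hn0⟩
  have : NeZero (4 * n) := ⟨by omega⟩
  obtain ⟨v, hv, hv0, hvn⟩ := exists_good hn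
  have h1 := hL n v hv hv0
  have h2 := hsie (4 * n) (chiN n) (chiN_sq n) (chiN_ne_one n)
  have h3 : c1 * ((4 * n : ℕ) : ℝ) ^ (-(ε / 2)) ≤ ‖DirichletCharacter.LFunction (chiN n) 1‖ :=
    h2.trans (Complex.re_le_norm _)
  set Q := 6 * n * (v.1 ^ 2 + v.2.1 ^ 2).natAbs with hQ
  have hQ0 : Q ≠ 0 := by
    have := Int.natAbs_ne_zero.2 hv0
    positivity
  have hnR : (0 : ℝ) < n := by exact_mod_cast Nat.pos_of_ne_zero hn0
  have hQle : (Q : ℝ) ≤ 6 * (n : ℝ) ^ 2 := by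
    have : Q ≤ 6 * n ^ 2 := by
      rw [hQ]
      calc 6 * n * _ ≤ 6 * n * n := Nat.mul_le_mul_left _ hvn
        _ = _ := by ring
    exact_mod_cast this
  have h4 : (4 : ℝ) ^ Q.primeFactors.card ≤ C ^ 2 * 6 ^ (ε / 4) * (n : ℝ) ^ (ε / 2) := by
    have h5 : (2 : ℝ) ^ Q.primeFactors.card ≤ C * (Q : ℝ) ^ (ε / 8) :=
      le_trans (by exact_mod_cast two_pow_omega_le hQ0) (hdiv Q hQ0)
    have h6 : (Q : ℝ) ^ (ε / 8) ≤ (6 * (n : ℝ) ^ 2) ^ (ε / 8) := Real.rpow_le_rpow (by positivity) hQle (by linarith)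
    have h7 : (2 : ℝ) ^ Q.primeFactors.card ≤ C * (6 * (n : ℝ) ^ 2) ^ (ε / 8) := h5.trans (by gcongr)
    calc (4 : ℝ) ^ Q.primeFactors.card = (2 ^ Q.primeFactors.card) ^ 2 := by
          rw [← pow_mul, mul_comm, pow_mul]; norm_num
      _ ≤ (C * (6 * (n : ℝ) ^ 2) ^ (ε / 8)) ^ 2 := pow_le_pow_left₀ (by positivity) h7 2
      _ = _ := by
          rw [mul_pow, mul_assoc]
          congr 1
          rw [← Real.rpow_natCast, ← Real.rpow_mul (by positivity), Real.mul_rpow (by positivity) (by positivity), ← Real.rpow_natCast, ← Real.rpow_mul (by positivity)]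
          congr 2 <;> push_cast <;> ring
  have h8 : c1 * ((4 * n : ℕ) : ℝ) ^ (-(ε / 2)) ≤ (C ^ 2 * 6 ^ (ε / 4) * (n : ℝ) ^ (ε / 2)) * Z * ((P3 n).ncard * (4 / √n)) := by
    refine h3.trans (h1.trans ?_)
    gcongr
  have e1 : ((4 * n : ℕ) : ℝ) ^ (-(ε / 2)) = 4 ^ (-(ε / 2)) * (n : ℝ) ^ (-(ε / 2)) := by
    push_cast
    rw [Real.mul_rpow (by norm_num) hnR.le]
  have e2 : (n : ℝ) ^ (1 / 2 - ε) = (n : ℝ) ^ (-(ε / 2)) * √n * (n : ℝ) ^ (-(ε / 2)) := by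
    rw [Real.sqrt_eq_rpow, ← Real.rpow_add hnR, ← Real.rpow_add hnR]
    congr 1; ring
  have e3 : (n : ℝ) ^ (ε / 2) * (n : ℝ) ^ (-(ε / 2)) = 1 := by
    rw [← Real.rpow_add hnR]; simp
  rw [e1] at h8
  have hsq : 0 < √(n : ℝ) := Real.sqrt_pos.2 hnR
  rw [e2, div_mul_eq_mul_div, div_le_iff₀ (by positivity)]
  have h9 := mul_le_mul_of_nonneg_right h8 (show 0 ≤ √(n : ℝ) * (n : ℝ) ^ (-(ε / 2)) by positivity)
  calc _ = _ := by ring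
    _ ≤ _ := h9
    _ = (P3 n).ncard * (4 * Z * (C ^ 2 * 6 ^ (ε / 4))) * ((n : ℝ) ^ (ε / 2) * (n : ℝ) ^ (-(ε / 2))) := by
      field_simp
    _ = _ := by rw [e3, mul_one]

lemma P3_lower {ε : ℝ} (hε : 0 < ε) : ∃ c : ℝ, 0 < c ∧ ∀ n : ℕ,
    (n % 8 = 1 ∨ n % 8 = 2 ∨ n % 8 = 3 ∨ n % 8 = 5 ∨ n % 8 = 6) →
    c * (n : ℝ) ^ (1 / 2 - ε) ≤ ((P3 n).ncard : ℝ) := by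
  obtain ⟨c, hc, h⟩ := P3_lower_aux (ε := min ε 1) (by positivity) (min_le_right _ _)
  refine ⟨c, hc, fun n hn => le_trans ?_ (h n hn)⟩
  have hn1 : (1 : ℝ) ≤ n := by
    have : 1 ≤ n := by omega
    exact_mod_cast this
  gcongr
  exact min_le_left _ _

end

noncomputable section

def plQ (v w : Fin 4 → ℚ) (i j : Fin 4) : ℚ := v i * w j - v j * w i
def plZ (v w : Fin 4 → ℤ) (i j : Fin 4) : ℤ := v i * w j - v j * w i
def toQ (v : Fin 4 → ℤ) : Fin 4 → ℚ := fun i => (v i : ℚ)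

lemma plQ_toQ (v w : Fin 4 → ℤ) (i j : Fin 4) : plQ (toQ v) (toQ w) i j = plZ v w i j := by
  simp [plQ, plZ, toQ]

lemma toQ_of_int {x : Fin 4 → ℚ} (hx : IsIntVec x) : ∃ v, x = toQ v := by
  choose f hf using hx
  exact ⟨f, funext hf⟩

lemma toQ_int (v : Fin 4 → ℤ) : IsIntVec (toQ v) := fun i => ⟨v i, rfl⟩

lemma exists_pl_ne {v w : Fin 4 → ℚ} (h : LinearIndependent ℚ ![v, w]) : ∃ i j, plQ v w i j ≠ 0 := by
  by_contra! hc
  rw [LinearIndependent.pair_iff] at h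
  have hv : ∀ i, v i = 0 := by
    intro i
    have := h (w i) (-(v i)) (by
      ext j
      have := hc i j
      simp only [plQ] at this
      simp only [Pi.add_apply, Pi.smul_apply, smul_eq_mul, Pi.zero_apply]
      linarith)
    simpa using this.2
  have := h 1 0 (by ext j; simp [hv])
  simp at this

lemma indep_of_pl {v w : Fin 4 → ℚ} {i j : Fin 4} (h : plQ v w i j ≠ 0) : LinearIndependent ℚ ![v, w] := by
  rw [LinearIndependent.pair_iff]
  intro s t hst
  have h1 := congrFun hst i
  have h2 := congrFun hst j
  simp only [Pi.add_apply, Pi.smul_apply, smul_eq_mul, Pi.zero_apply] at h1 h2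
  have h3 : s * plQ v w i j = 0 := by
    simp only [plQ]; linear_combination w j * h1 - w i * h2
  have h4 : t * plQ v w i j = 0 := by
    simp only [plQ]; linear_combination v i * h2 - v j * h1
  exact ⟨(mul_eq_zero.1 h3).resolve_right h, (mul_eq_zero.1 h4).resolve_right h⟩

lemma mem_of_wedge {v w x : Fin 4 → ℚ} {i j : Fin 4} (h : plQ v w i j ≠ 0)
    (hx : ∀ k, x i * plQ v w j k - x j * plQ v w i k + x k * plQ v w i j = 0) :
    x ∈ Submodule.span ℚ {v, w} := by
  rw [Submodule.mem_span_pair]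
  refine ⟨(x i * w j - x j * w i) / plQ v w i j, (v i * x j - v j * x i) / plQ v w i j, ?_⟩
  ext k
  simp only [Pi.add_apply, Pi.smul_apply, smul_eq_mul]
  have := hx k
  field_simp
  simp only [plQ] at this ⊢
  linear_combination -this

lemma basis_span {L : Submodule ℚ (Fin 4 → ℚ)} {v w : Fin 4 → ℚ} (h : Module.finrank ℚ L = 2)
    (hb : IsZBasisOf L v w) : Submodule.span ℚ {v, w} = L := by
  obtain ⟨h1, h2, -, -, h5, -⟩ := hb
  apply Submodule.eq_of_le_of_finrank_eq
  · rw [Submodule.span_le]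
    rintro x (rfl | rfl)
    · exact h1
    · exact h2
  · have := finrank_span_eq_card h5
    have hr : Set.range ![v, w] = {v, w} := by
      ext z; simp [eq_comm, or_comm]
    rw [h]
    rw [hr] at this
    simpa using this

lemma span_le_of_pl {v w v' w' : Fin 4 → ℚ} (hi : LinearIndependent ℚ ![v, w])
    (h : ∀ i j, plQ v w i j = plQ v' w' i j) : Submodule.span ℚ {v', w'} ≤ Submodule.span ℚ {v, w} := by
  obtain ⟨i, j, hij⟩ := exists_pl_ne hi
  rw [Submodule.span_le]
  rintro x (rfl | rfl) <;>
  · apply mem_of_wedge hij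
    intro k
    simp only [h]
    simp only [plQ]
    ring

lemma exists_int_basis {D : ℕ} {L : Submodule ℚ (Fin 4 → ℚ)} (h : L ∈ RD D) :
    ∃ v w : Fin 4 → ℤ, IsZBasisOf L (toQ v) (toQ w) ∧ gramDet (toQ v) (toQ w) = D ∧
      Submodule.span ℚ {toQ v, toQ w} = L := by
  obtain ⟨hf, v, w, hb, hg⟩ := h
  obtain ⟨v, rfl⟩ := toQ_of_int hb.2.2.1
  obtain ⟨w, rfl⟩ := toQ_of_int hb.2.2.2.1
  exact ⟨v, w, hb, hg, basis_span hf hb⟩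

lemma gram_pl (v w : Fin 4 → ℤ) : gramDet (toQ v) (toQ w) =
    ((plZ v w 0 1 ^ 2 + plZ v w 0 2 ^ 2 + plZ v w 0 3 ^ 2 + plZ v w 1 2 ^ 2 + plZ v w 1 3 ^ 2 + plZ v w 2 3 ^ 2 : ℤ) : ℚ) := by
  simp only [gramDet, innerQ4, Fin.sum_univ_four, toQ, plZ]
  push_cast
  ring

def xv (v w : Fin 4 → ℤ) : ℤ × ℤ × ℤ := (plZ v w 0 1, plZ v w 0 2, plZ v w 0 3)
def yv (v w : Fin 4 → ℤ) : ℤ × ℤ × ℤ := (plZ v w 2 3, - plZ v w 1 3, plZ v w 1 2)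

lemma pl_eq_of_xy {v w v' w' : Fin 4 → ℤ} (hx : xv v w = xv v' w') (hy : yv v w = yv v' w') (i j : Fin 4) :
    plZ v w i j = plZ v' w' i j := by
  simp only [xv, yv, Prod.mk.injEq, neg_inj] at hx hy
  obtain ⟨a1, a2, a3⟩ := hx
  obtain ⟨b1, b2, b3⟩ := hy
  simp only [plZ] at *
  fin_cases i <;> fin_cases j <;> simp <;> linarith

lemma sum_mem_S3 {D : ℕ} {v w : Fin 4 → ℤ} (h : gramDet (toQ v) (toQ w) = D) :
    xv v w + yv v w ∈ S3 D ∧ xv v w - yv v w ∈ S3 D := by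
  rw [gram_pl] at h
  have h : (plZ v w 0 1 ^ 2 + plZ v w 0 2 ^ 2 + plZ v w 0 3 ^ 2 + plZ v w 1 2 ^ 2 + plZ v w 1 3 ^ 2 + plZ v w 2 3 ^ 2 : ℤ) = D := by
    exact_mod_cast h
  simp only [S3, Set.mem_ofPred_eq, xv, yv, Prod.mk_add_mk, Prod.mk_sub_mk, ← h, plZ]
  constructor <;> ring

lemma RD_upper {D : ℕ} (hS : (S3 D).Finite) : (RD D).Finite ∧ (RD D).ncard ≤ (S3 D).ncard ^ 2 := by
  classical
  choose! V W hb hg hsp using fun L (h : L ∈ RD D) => exists_int_basis h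
  let F : Submodule ℚ (Fin 4 → ℚ) → (ℤ × ℤ × ℤ) × (ℤ × ℤ × ℤ) := fun L => (xv (V L) (W L) + yv (V L) (W L), xv (V L) (W L) - yv (V L) (W L))
  have hmaps : Set.MapsTo F (RD D) (S3 D ×ˢ S3 D) := fun L hL => ⟨(sum_mem_S3 (hg L hL)).1, (sum_mem_S3 (hg L hL)).2⟩
  have hinj : Set.InjOn F (RD D) := by
    intro L hL L' hL' he
    simp only [F, Prod.mk.injEq] at he
    obtain ⟨h1, h2⟩ := he
    have hx : xv (V L) (W L) = xv (V L') (W L') := by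
      simp only [Prod.ext_iff, Prod.fst_add, Prod.snd_add, Prod.fst_sub, Prod.snd_sub] at h1 h2 ⊢
      omega
    have hy : yv (V L) (W L) = yv (V L') (W L') := by
      rw [hx] at h1; exact add_left_cancel h1
    have hpl : ∀ i j, plQ (toQ (V L)) (toQ (W L)) i j = plQ (toQ (V L')) (toQ (W L')) i j := by
      intro i j
      rw [plQ_toQ, plQ_toQ, pl_eq_of_xy hx hy]
    rw [← hsp L hL, ← hsp L' hL']
    exact le_antisymm (span_le_of_pl (hb L' hL').2.2.2.2.1 fun i j => (hpl i j).symm) (span_le_of_pl (hb L hL).2.2.2.2.1 hpl)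
  have hfin := hS.prod hS
  refine ⟨Set.Finite.of_injOn hmaps hinj hfin, ?_⟩
  have := Set.ncard_le_ncard_of_injOn F hmaps hinj hfin
  rwa [Set.ncard_prod, ← sq] at this

end

noncomputable section

def mkP (x y : ℤ × ℤ × ℤ) : Fin 4 → Fin 4 → ℤ :=
  ![![0, x.1, x.2.1, x.2.2], ![-x.1, 0, y.2.2, -y.2.1], ![-x.2.1, -y.2.2, 0, y.1], ![-x.2.2, y.2.1, -y.1, 0]]

lemma mkP_plucker {x y : ℤ × ℤ × ℤ} (h : x.1 * y.1 + x.2.1 * y.2.1 + x.2.2 * y.2.2 = 0) (i j k l : Fin 4) :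
    mkP x y l i * mkP x y k j - mkP x y l j * mkP x y k i = mkP x y l k * mkP x y i j := by
  fin_cases i <;> fin_cases j <;> fin_cases k <;> fin_cases l <;> simp [mkP] <;>
    first | ring1 | linear_combination h | linear_combination -h

def WD (D : ℕ) : Set ((ℤ × ℤ × ℤ) × (ℤ × ℤ × ℤ)) :=
  {w | w.1.1 * w.2.1 + w.1.2.1 * w.2.2.1 + w.1.2.2 * w.2.2.2 = 0 ∧
    w.1.1 ^ 2 + w.1.2.1 ^ 2 + w.1.2.2 ^ 2 + w.2.1 ^ 2 + w.2.2.1 ^ 2 + w.2.2.2 ^ 2 = D ∧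
    ∃ r s : ℤ × ℤ × ℤ, r.1 * w.1.1 + r.2.1 * w.1.2.1 + r.2.2 * w.1.2.2 +
      (s.1 * w.2.1 + s.2.1 * w.2.2.1 + s.2.2 * w.2.2.2) = 1}

lemma exists_prim (u : Fin 4 → ℤ) (hu : ∃ i, u i ≠ 0) : ∃ (g : ℤ) (v f : Fin 4 → ℤ), g ≠ 0 ∧ (∀ i, u i = g * v i) ∧ ∑ i, f i * v i = 1 := by
  obtain ⟨g, hg⟩ := (IsPrincipalIdealRing.principal (Ideal.span (Set.range u))).principal
  have h1 : ∀ i, ∃ c, u i = g * c := by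
    intro i
    have : u i ∈ Ideal.span (Set.range u) := Ideal.subset_span ⟨i, rfl⟩
    rw [hg] at this
    obtain ⟨c, hc⟩ := Ideal.mem_span_singleton.1 this
    exact ⟨c, hc⟩
  choose v hv using h1
  have hg0 : g ≠ 0 := by
    rintro rfl
    obtain ⟨i, hi⟩ := hu
    exact hi (by rw [hv i, zero_mul])
  have h2 : g ∈ Ideal.span (Set.range u) := by rw [hg]; exact Ideal.mem_span_singleton_self g
  obtain ⟨f, hf⟩ := (Submodule.mem_span_range_iff_exists_fun ℤ).1 h2
  refine ⟨g, v, f, hg0, hv, ?_⟩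
  have : g * ∑ i, f i * v i = g * 1 := by
    rw [Finset.mul_sum, mul_one]
    conv_rhs => rw [← hf]
    apply Finset.sum_congr rfl
    intro i _
    rw [hv i, smul_eq_mul]; ring
  exact mul_left_cancel₀ hg0 this

lemma exists_factor {x y : ℤ × ℤ × ℤ} (h : x.1 * y.1 + x.2.1 * y.2.1 + x.2.2 * y.2.2 = 0)
    (h0 : ∃ i j, mkP x y i j ≠ 0) : ∃ v w : Fin 4 → ℤ, ∀ i j, plZ v w i j = mkP x y i j := by
  obtain ⟨l, j, hlj⟩ := h0
  obtain ⟨g, v, f, hg, hv, hf⟩ := exists_prim (mkP x y l) ⟨j, hlj⟩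
  refine ⟨v, fun j => ∑ k, f k * mkP x y k j, fun i j => ?_⟩
  apply mul_left_cancel₀ hg
  have h1 : g * plZ v (fun j => ∑ k, f k * mkP x y k j) i j = ∑ k, f k * (mkP x y l i * mkP x y k j - mkP x y l j * mkP x y k i) := by
    simp only [plZ, hv i, hv j, mul_sub, Finset.sum_sub_distrib, Finset.mul_sum]
    congr 1 <;> exact Finset.sum_congr rfl fun k _ => by ring
  rw [h1]
  simp only [mkP_plucker h]
  calc _ = ∑ k, f k * v k * (g * mkP x y i j) := Finset.sum_congr rfl fun k _ => by rw [hv k]; ring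
    _ = _ := by rw [← Finset.sum_mul, hf, one_mul]

lemma xv_of_pl {x y : ℤ × ℤ × ℤ} {v w : Fin 4 → ℤ} (h : ∀ i j, plZ v w i j = mkP x y i j) : xv v w = x ∧ yv v w = y := by
  simp [xv, yv, h, mkP]

lemma WD_basis {D : ℕ} {p : (ℤ × ℤ × ℤ) × (ℤ × ℤ × ℤ)} (hp : p ∈ WD D) :
    ∃ (L : Submodule ℚ (Fin 4 → ℚ)) (v w : Fin 4 → ℤ), L ∈ RD D ∧ IsZBasisOf L (toQ v) (toQ w) ∧ xv v w = p.1 ∧ yv v w = p.2 := by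
  obtain ⟨h1, h2, r, s, h3⟩ := hp
  have h0 : ∃ i j, mkP p.1 p.2 i j ≠ 0 := by
    by_contra! hc
    have a1 := hc 0 1
    have a2 := hc 0 2
    have a3 := hc 0 3
    have b1 := hc 1 2
    have b2 := hc 3 1
    have b3 := hc 2 3
    simp [mkP] at a1 a2 a3 b1 b2 b3
    simp [a1, a2, a3, b1, b2, b3] at h3
  obtain ⟨v, w, hvw⟩ := exists_factor h1 h0
  obtain ⟨hx, hy⟩ := xv_of_pl hvw
  obtain ⟨i, j, hij⟩ := h0
  have hne : plQ (toQ v) (toQ w) i j ≠ 0 := by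
    rw [plQ_toQ, hvw]; exact_mod_cast hij
  have hind := indep_of_pl hne
  have hfr : Module.finrank ℚ (Submodule.span ℚ {toQ v, toQ w}) = 2 := by
    have := finrank_span_eq_card hind
    have hr : Set.range ![toQ v, toQ w] = {toQ v, toQ w} := by
      ext z; simp [eq_comm, or_comm]
    rw [hr] at this
    simpa using this
  have hgram : gramDet (toQ v) (toQ w) = D := by
    rw [gram_pl]
    simp only [hvw, mkP]
    have : (p.1.1 ^ 2 + p.1.2.1 ^ 2 + p.1.2.2 ^ 2 + p.2.2.2 ^ 2 + (-p.2.2.1) ^ 2 + p.2.1 ^ 2 : ℤ) = D := by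
      rw [← h2]; ring
    exact_mod_cast this
  have hbez : r.1 * plZ v w 0 1 + r.2.1 * plZ v w 0 2 + r.2.2 * plZ v w 0 3 +
      (s.1 * plZ v w 2 3 - s.2.1 * plZ v w 1 3 + s.2.2 * plZ v w 1 2) = 1 := by
    rw [← h3, ← hx, ← hy]
    simp only [xv, yv]; ring
  have hb : IsZBasisOf (Submodule.span ℚ {toQ v, toQ w}) (toQ v) (toQ w) := by
    refine ⟨Submodule.subset_span (by simp), Submodule.subset_span (by simp), toQ_int v, toQ_int w, hind, ?_⟩
    intro z hz hzi
    obtain ⟨z, rfl⟩ := toQ_of_int hzi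
    obtain ⟨α, β, hab⟩ := Submodule.mem_span_pair.1 hz
    have hz' : ∀ k, (z k : ℚ) = α * v k + β * w k := by
      intro k
      have := congrFun hab k
      simp only [toQ, Pi.add_apply, Pi.smul_apply, smul_eq_mul] at this
      exact this.symm
    have hbq : ((r.1 * plZ v w 0 1 + r.2.1 * plZ v w 0 2 + r.2.2 * plZ v w 0 3 +
      (s.1 * plZ v w 2 3 - s.2.1 * plZ v w 1 3 + s.2.2 * plZ v w 1 2) : ℤ) : ℚ) = 1 := by exact_mod_cast hbez
    have hα : ((r.1 * plZ z w 0 1 + r.2.1 * plZ z w 0 2 + r.2.2 * plZ z w 0 3 +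
      (s.1 * plZ z w 2 3 - s.2.1 * plZ z w 1 3 + s.2.2 * plZ z w 1 2) : ℤ) : ℚ) = α := by
      rw [← mul_one α, ← hbq]
      simp only [plZ]
      push_cast
      simp only [hz']
      ring
    have hβ : ((r.1 * plZ v z 0 1 + r.2.1 * plZ v z 0 2 + r.2.2 * plZ v z 0 3 +
      (s.1 * plZ v z 2 3 - s.2.1 * plZ v z 1 3 + s.2.2 * plZ v z 1 2) : ℤ) : ℚ) = β := by
      rw [← mul_one β, ← hbq]
      simp only [plZ]
      push_cast
      simp only [hz']
      ring
    have hab' := hab.symm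
    rw [← hα, ← hβ] at hab'
    exact ⟨_, _, hab'⟩
  exact ⟨_, v, w, ⟨hfr, _, _, hb, hgram⟩, hb, hx, hy⟩

lemma basis_det {L : Submodule ℚ (Fin 4 → ℚ)} {v w v' w' : Fin 4 → ℤ} (h : IsZBasisOf L (toQ v) (toQ w))
    (h' : IsZBasisOf L (toQ v') (toQ w')) : ∃ d : ℤ, ∀ i j, plZ v' w' i j = d * plZ v w i j := by
  obtain ⟨m, n, hm⟩ := h.2.2.2.2.2 _ h'.1 (toQ_int _)
  obtain ⟨m', n', hm'⟩ := h.2.2.2.2.2 _ h'.2.1 (toQ_int _)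
  refine ⟨m * n' - n * m', fun i j => ?_⟩
  have e1 : ∀ k, v' k = m * v k + n * w k := by
    intro k
    have := congrFun hm k
    simp only [toQ, Pi.add_apply, Pi.smul_apply, smul_eq_mul] at this
    exact_mod_cast this
  have e2 : ∀ k, w' k = m' * v k + n' * w k := by
    intro k
    have := congrFun hm' k
    simp only [toQ, Pi.add_apply, Pi.smul_apply, smul_eq_mul] at this
    exact_mod_cast this
  simp only [plZ, e1, e2]
  ring

lemma basis_pm {L : Submodule ℚ (Fin 4 → ℚ)} {v w v' w' : Fin 4 → ℤ} (h : IsZBasisOf L (toQ v) (toQ w))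
    (h' : IsZBasisOf L (toQ v') (toQ w')) : (xv v' w', yv v' w') = (xv v w, yv v w) ∨ (xv v' w', yv v' w') = -(xv v w, yv v w) := by
  obtain ⟨d, hd⟩ := basis_det h h'
  obtain ⟨e, he⟩ := basis_det h' h
  obtain ⟨i, j, hij⟩ := exists_pl_ne h.2.2.2.2.1
  rw [plQ_toQ] at hij
  have hij : plZ v w i j ≠ 0 := by exact_mod_cast hij
  have hde : e * d = 1 := by
    have := he i j
    rw [hd i j] at this
    apply mul_right_cancel₀ hij
    linarith
  rcases Int.eq_one_or_neg_one_of_mul_eq_one' hde with ⟨-, rfl⟩ | ⟨-, rfl⟩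
  · left; simp [xv, yv, hd]
  · right; simp [xv, yv, hd]

lemma WD_finite {D : ℕ} (hS : (S3 D).Finite) : (WD D).Finite := by
  refine Set.Finite.of_injOn (f := fun p => (p.1 + p.2, p.1 - p.2)) (t := S3 D ×ˢ S3 D) ?_ ?_ (hS.prod hS)
  · rintro p ⟨h1, h2, -⟩
    simp only [S3, Set.mem_prod, Set.mem_ofPred_eq, Prod.fst_add, Prod.snd_add, Prod.fst_sub, Prod.snd_sub]
    constructor <;> nlinarith
  · intro p _ q _ h
    simp only [Prod.ext_iff, Prod.fst_add, Prod.snd_add, Prod.fst_sub, Prod.snd_sub] at h ⊢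
    omega

lemma WD_le {D : ℕ} (hS : (S3 D).Finite) : (WD D).ncard ≤ 2 * (RD D).ncard := by
  classical
  have hR := (RD_upper hS).1
  choose! L V W hL hb hx hy using fun p (hp : p ∈ WD D) => WD_basis hp
  have hW := WD_finite hS
  rw [Set.ncard_eq_toFinset_card _ hW, Set.ncard_eq_toFinset_card _ hR]
  have h1 := Finset.card_le_mul_card_image (f := L) hW.toFinset 2 (by
    intro M hM
    obtain ⟨p, hp, rfl⟩ := Finset.mem_image.1 hM
    rw [Set.Finite.mem_toFinset] at hp
    refine le_trans (Finset.card_le_card (t := {p, -p}) ?_) Finset.card_le_two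
    intro q hq
    rw [Finset.mem_filter, Set.Finite.mem_toFinset] at hq
    have hbq := hb q hq.1
    rw [hq.2] at hbq
    have := basis_pm (hb p hp) hbq
    rw [hx p hp, hy p hp, hx q hq.1, hy q hq.1] at this
    simpa using this)
  refine h1.trans (Nat.mul_le_mul_left _ (Finset.card_le_card ?_))
  intro M hM
  obtain ⟨p, hp, rfl⟩ := Finset.mem_image.1 hM
  rw [Set.Finite.mem_toFinset] at hp ⊢
  exact hL p hp

end

noncomputable section

def sg (v : ℤ × ℤ × ℤ) : ℤ × ℤ × ℤ := (v.2.1, v.2.2, v.1)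

def sgk (k : Fin 3) (v : ℤ × ℤ × ℤ) : ℤ × ℤ × ℤ := if k = 0 then v else if k = 1 then sg v else sg (sg v)

lemma sg_P3 {n : ℕ} {v : ℤ × ℤ × ℤ} (h : v ∈ P3 n) : sg v ∈ P3 n := by
  obtain ⟨h1, r, s, t, h2⟩ := h
  simp only [S3, Set.mem_ofPred_eq] at h1
  refine ⟨?_, s, t, r, ?_⟩
  · simp only [S3, sg, Set.mem_ofPred_eq]; linarith
  · simp only [sg]; linarith

lemma sgk_P3 {n : ℕ} {v : ℤ × ℤ × ℤ} (k : Fin 3) (h : v ∈ P3 n) : sgk k v ∈ P3 n := by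
  unfold sgk
  split_ifs
  · exact h
  · exact sg_P3 h
  · exact sg_P3 (sg_P3 h)

lemma sgk_inj (k : Fin 3) : Function.Injective (sgk k) := by
  rintro ⟨a, b, c⟩ ⟨a', b', c'⟩ h
  fin_cases k <;> simp [sgk, sg] at h ⊢ <;> tauto

lemma count_pairs {P : Set (ℤ × ℤ × ℤ)} {W : Set ((ℤ × ℤ × ℤ) × (ℤ × ℤ × ℤ))} (hW : W.Finite) (m : ℤ) (hm : m ≠ 0)
    (h : ∀ a ∈ P, ∀ b ∈ P, ∃ w ∈ W, ∃ k : Fin 3, w.1 + w.2 = m • a ∧ w.1 - w.2 = m • sgk k b) :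
    P.ncard ^ 2 ≤ 3 * W.ncard := by
  classical
  have h' : ∀ p : (ℤ × ℤ × ℤ) × (ℤ × ℤ × ℤ), p ∈ P ×ˢ P → ∃ q : ((ℤ × ℤ × ℤ) × (ℤ × ℤ × ℤ)) × Fin 3, q.1 ∈ W ∧ q.1.1 + q.1.2 = m • p.1 ∧ q.1.1 - q.1.2 = m • sgk q.2 p.2 := by
    intro p hp
    obtain ⟨w, hw, k, h1, h2⟩ := h p.1 hp.1 p.2 hp.2
    exact ⟨(w, k), hw, h1, h2⟩
  choose! F hF1 hF2 hF3 using h'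
  have hsm : Function.Injective fun v : ℤ × ℤ × ℤ => m • v := smul_right_injective _ hm
  have := Set.ncard_le_ncard_of_injOn (s := P ×ˢ P) (t := W ×ˢ (Set.univ : Set (Fin 3))) F (fun p hp => ⟨hF1 p hp, trivial⟩)
    (by
      intro p hp q hq he
      have a1 := hF2 p hp
      have a2 := hF3 p hp
      rw [he] at a1 a2
      have b1 := hF2 q hq
      have b2 := hF3 q hq
      have c1 : p.1 = q.1 := hsm (a1.symm.trans b1)
      have c2 : p.2 = q.2 := sgk_inj _ (hsm (a2.symm.trans b2))
      exact Prod.ext c1 c2) (hW.prod Set.finite_univ)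
  rw [Set.ncard_prod, Set.ncard_prod, Set.ncard_univ, Nat.card_eq_fintype_card, Fintype.card_fin] at this
  rw [sq]; linarith

lemma sq4 (x : ℤ) : x ^ 2 % 4 = x % 2 := by
  rcases Int.even_or_odd' x with ⟨k, rfl | rfl⟩
  · have : (2 * k) ^ 2 = 4 * k ^ 2 := by ring
    omega
  · have : (2 * k + 1) ^ 2 = 4 * (k ^ 2 + k) + 1 := by ring
    omega

lemma par_match {n : ℕ} {a b : ℤ × ℤ × ℤ} (ha : a ∈ S3 n) (hb : b ∈ S3 n) :
    ∃ k : Fin 3, a.1 % 2 = (sgk k b).1 % 2 ∧ a.2.1 % 2 = (sgk k b).2.1 % 2 ∧ a.2.2 % 2 = (sgk k b).2.2 % 2 := by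
  obtain ⟨a1, a2, a3⟩ := a
  obtain ⟨b1, b2, b3⟩ := b
  simp only [S3, Set.mem_ofPred_eq] at ha hb
  have := sq4 a1
  have := sq4 a2
  have := sq4 a3
  have := sq4 b1
  have := sq4 b2
  have := sq4 b3
  have key : (a1 % 2 = b1 % 2 ∧ a2 % 2 = b2 % 2 ∧ a3 % 2 = b3 % 2) ∨ (a1 % 2 = b2 % 2 ∧ a2 % 2 = b3 % 2 ∧ a3 % 2 = b1 % 2) ∨
    (a1 % 2 = b3 % 2 ∧ a2 % 2 = b1 % 2 ∧ a3 % 2 = b2 % 2) := by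
    have hs : (a1 % 2 + a2 % 2 + a3 % 2) % 4 = (b1 % 2 + b2 % 2 + b3 % 2) % 4 := by omega
    rcases Int.emod_two_eq_zero_or_one a1 with h1 | h1 <;> rcases Int.emod_two_eq_zero_or_one a2 with h2 | h2 <;>
    rcases Int.emod_two_eq_zero_or_one a3 with h3 | h3 <;> rcases Int.emod_two_eq_zero_or_one b1 with h4 | h4 <;>
    rcases Int.emod_two_eq_zero_or_one b2 with h5 | h5 <;> rcases Int.emod_two_eq_zero_or_one b3 with h6 | h6 <;>
    simp [h1, h2, h3, h4, h5, h6] at hs ⊢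
  rcases key with h | h | h
  · exact ⟨0, by simpa [sgk] using h⟩
  · exact ⟨1, by simpa [sgk, sg] using h⟩
  · exact ⟨2, by simpa [sgk, sg] using h⟩

lemma par_mismatch {n : ℕ} (hn : n % 4 = 1 ∨ n % 4 = 2) {a b : ℤ × ℤ × ℤ} (ha : a ∈ S3 n) (hb : b ∈ S3 n) :
    ∃ k : Fin 3, (a.1 + (sgk k b).1) % 2 = 1 ∨ (a.2.1 + (sgk k b).2.1) % 2 = 1 ∨ (a.2.2 + (sgk k b).2.2) % 2 = 1 := by
  obtain ⟨a1, a2, a3⟩ := a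
  obtain ⟨b1, b2, b3⟩ := b
  simp only [S3, Set.mem_ofPred_eq] at ha hb
  have := sq4 b1
  have := sq4 b2
  have := sq4 b3
  by_contra! hc
  have h0 := hc 0
  have h1 := hc 1
  have h2 := hc 2
  simp [sgk, sg] at h0 h1 h2
  omega

lemma W_case1 {n : ℕ} (hn : n ≠ 0) : (P3 n).ncard ^ 2 ≤ 3 * (WD n).ncard := by
  have hS : (S3 n).Finite := by
    obtain ⟨C, _, h⟩ := S3_bound (ε := 1) one_pos
    exact (h n hn).1
  refine count_pairs (WD_finite hS) 1 one_ne_zero ?_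
  intro a ha b hb
  obtain ⟨k, p1, p2, p3⟩ := par_match ha.1 hb.1
  have hc := sgk_P3 k hb
  set c := sgk k b with hcd
  obtain ⟨ha1, r, s, t, hr⟩ := ha
  have hc1 := hc.1
  obtain ⟨a1, a2, a3⟩ := a
  clear_value c
  obtain ⟨c1, c2, c3⟩ := c
  simp only [S3, Set.mem_ofPred_eq] at ha1 hc1 hr p1 p2 p3
  obtain ⟨y1, rfl⟩ : ∃ y, a1 = c1 + 2 * y := ⟨(a1 - c1) / 2, by omega⟩
  obtain ⟨y2, rfl⟩ : ∃ y, a2 = c2 + 2 * y := ⟨(a2 - c2) / 2, by omega⟩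
  obtain ⟨y3, rfl⟩ : ∃ y, a3 = c3 + 2 * y := ⟨(a3 - c3) / 2, by omega⟩
  refine ⟨((c1 + y1, c2 + y2, c3 + y3), (y1, y2, y3)), ⟨?_, ?_, (r, s, t), (r, s, t), ?_⟩, k, ?_, ?_⟩
  · simp only; linarith
  · simp only; linarith
  · simp only; linarith
  · simp only [Prod.mk_add_mk, one_smul, Prod.mk.injEq]; refine ⟨?_, ?_, ?_⟩ <;> ring
  · rw [← hcd]
    simp only [Prod.mk_sub_mk, one_smul, Prod.mk.injEq]; refine ⟨?_, ?_, ?_⟩ <;> ring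

lemma W_case2 {n : ℕ} (hn : n % 4 = 1 ∨ n % 4 = 2) : (P3 n).ncard ^ 2 ≤ 3 * (WD (4 * n)).ncard := by
  have hS : (S3 (4 * n)).Finite := by
    obtain ⟨C, _, h⟩ := S3_bound (ε := 1) one_pos
    exact (h (4 * n) (by omega)).1
  refine count_pairs (WD_finite hS) 2 two_ne_zero ?_
  intro a ha b hb
  obtain ⟨k, hpar⟩ := par_mismatch hn ha.1 hb.1
  have hc := sgk_P3 k hb
  set c := sgk k b with hcd
  obtain ⟨ha1, r, s, t, hr⟩ := ha
  have hc1 := hc.1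
  obtain ⟨a1, a2, a3⟩ := a
  clear_value c
  obtain ⟨c1, c2, c3⟩ := c
  simp only [S3, Set.mem_ofPred_eq] at ha1 hc1 hr hpar
  have hbez : ∃ r s : ℤ × ℤ × ℤ, r.1 * (a1 + c1) + r.2.1 * (a2 + c2) + r.2.2 * (a3 + c3) +
      (s.1 * (a1 - c1) + s.2.1 * (a2 - c2) + s.2.2 * (a3 - c3)) = 1 := by
    rcases hpar with h | h | h
    · obtain ⟨q, hq⟩ : ∃ q, a1 + c1 = 2 * q + 1 := ⟨(a1 + c1) / 2, by omega⟩
      refine ⟨(1 - q * r, - q * s, - q * t), (- q * r, - q * s, - q * t), ?_⟩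
      simp only
      linear_combination hq - 2 * q * hr
    · obtain ⟨q, hq⟩ : ∃ q, a2 + c2 = 2 * q + 1 := ⟨(a2 + c2) / 2, by omega⟩
      refine ⟨(- q * r, 1 - q * s, - q * t), (- q * r, - q * s, - q * t), ?_⟩
      simp only
      linear_combination hq - 2 * q * hr
    · obtain ⟨q, hq⟩ : ∃ q, a3 + c3 = 2 * q + 1 := ⟨(a3 + c3) / 2, by omega⟩
      refine ⟨(- q * r, - q * s, 1 - q * t), (- q * r, - q * s, - q * t), ?_⟩
      simp only
      linear_combination hq - 2 * q * hr
  refine ⟨((a1 + c1, a2 + c2, a3 + c3), (a1 - c1, a2 - c2, a3 - c3)), ⟨?_, ?_, hbez⟩, k, ?_, ?_⟩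
  · simp only; linarith
  · simp only; push_cast; linarith
  · simp only [Prod.mk_add_mk, Prod.smul_mk, Prod.mk.injEq, smul_eq_mul]; refine ⟨?_, ?_, ?_⟩ <;> ring
  · rw [← hcd]
    simp only [Prod.mk_sub_mk, Prod.smul_mk, Prod.mk.injEq, smul_eq_mul]; refine ⟨?_, ?_, ?_⟩ <;> ring

lemma RD_lower {D : ℕ} (hD : 0 < D) (h : D % 16 ∉ ({0, 7, 12, 15} : Set ℕ)) :
    ∃ n : ℕ, (n % 8 = 1 ∨ n % 8 = 2 ∨ n % 8 = 3 ∨ n % 8 = 5 ∨ n % 8 = 6) ∧ D ≤ 4 * n ∧ n ≤ D ∧ (P3 n).ncard ^ 2 ≤ 6 * (RD D).ncard := by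
  have hS : (S3 D).Finite := by
    obtain ⟨C, _, h⟩ := S3_bound (ε := 1) one_pos
    exact (h D hD.ne').1
  have h1 := WD_le hS
  simp only [Set.mem_insert_iff, Set.mem_singleton_iff, not_or] at h
  by_cases h8 : D % 8 = 1 ∨ D % 8 = 2 ∨ D % 8 = 3 ∨ D % 8 = 5 ∨ D % 8 = 6
  · refine ⟨D, h8, by omega, le_rfl, ?_⟩
    have := W_case1 hD.ne'
    omega
  · obtain ⟨n, rfl⟩ : ∃ n, D = 4 * n := ⟨D / 4, by omega⟩
    refine ⟨n, by omega, le_rfl, by omega, ?_⟩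
    have := W_case2 (n := n) (by omega)
    omega

lemma lower_final {ε : ℝ} (hε : 0 < ε) (hε1 : ε ≤ 1) : ∃ c : ℝ, 0 < c ∧ ∀ D : ℕ, 0 < D → D % 16 ∉ ({0, 7, 12, 15} : Set ℕ) →
    c * (D : ℝ) ^ (1 - ε) ≤ ((RD D).ncard : ℝ) := by
  obtain ⟨c, hc, h⟩ := P3_lower (ε := ε / 2) (by linarith)
  refine ⟨c ^ 2 * 4 ^ (-(1 - ε)) / 6, by positivity, fun D hD hD16 => ?_⟩
  obtain ⟨n, hn8, hDn, hnD, hle⟩ := RD_lower hD hD16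
  have h1 := h n hn8
  have hn0 : (0 : ℝ) < n := by
    have : 0 < n := by omega
    exact_mod_cast this
  have h2 : (c * (n : ℝ) ^ (1 / 2 - ε / 2)) ^ 2 ≤ 6 * (RD D).ncard := by
    refine le_trans (pow_le_pow_left₀ (by positivity) h1 2) ?_
    exact_mod_cast hle
  have h3 : ((n : ℝ) ^ (1 / 2 - ε / 2)) ^ 2 = (n : ℝ) ^ (1 - ε) := by
    rw [← Real.rpow_natCast, ← Real.rpow_mul hn0.le]
    congr 1; push_cast; ring
  have h4 : (D : ℝ) ^ (1 - ε) ≤ 4 ^ (1 - ε) * (n : ℝ) ^ (1 - ε) := by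
    rw [← Real.mul_rpow (by norm_num) hn0.le]
    exact Real.rpow_le_rpow (by positivity) (by exact_mod_cast hDn) (by linarith)
  have h5 : (4 : ℝ) ^ (-(1 - ε)) * 4 ^ (1 - ε) = 1 := by
    rw [← Real.rpow_add (by norm_num)]; simp
  rw [mul_pow, h3] at h2
  have h6 : (4 : ℝ) ^ (-(1 - ε)) * (D : ℝ) ^ (1 - ε) ≤ (n : ℝ) ^ (1 - ε) := by
    calc _ ≤ (4 : ℝ) ^ (-(1 - ε)) * (4 ^ (1 - ε) * (n : ℝ) ^ (1 - ε)) := by gcongr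
      _ = _ := by rw [← mul_assoc, h5, one_mul]
  have h7 : c ^ 2 * ((4 : ℝ) ^ (-(1 - ε)) * (D : ℝ) ^ (1 - ε)) ≤ c ^ 2 * (n : ℝ) ^ (1 - ε) := by gcongr
  calc _ = c ^ 2 * ((4 : ℝ) ^ (-(1 - ε)) * (D : ℝ) ^ (1 - ε)) / 6 := by ring
    _ ≤ 6 * (RD D).ncard / 6 := div_le_div_of_nonneg_right (h7.trans h2) (by norm_num)
    _ = _ := by ring

lemma upper_final {ε : ℝ} (hε : 0 < ε) : ∃ C : ℝ, 0 < C ∧ ∀ D : ℕ, 0 < D → ((RD D).ncard : ℝ) ≤ C * (D : ℝ) ^ (1 + ε) := by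
  obtain ⟨C, hC, h⟩ := S3_bound (ε := ε / 2) (by linarith)
  refine ⟨C ^ 2, by positivity, fun D hD => ?_⟩
  obtain ⟨hf, hb⟩ := h D hD.ne'
  have h1 := (RD_upper hf).2
  calc ((RD D).ncard : ℝ) ≤ ((S3 D).ncard : ℝ) ^ 2 := by exact_mod_cast h1
    _ ≤ (C * (D : ℝ) ^ (1 / 2 + ε / 2)) ^ 2 := pow_le_pow_left₀ (by positivity) hb 2
    _ = _ := by
      rw [mul_pow, ← Real.rpow_natCast ((D : ℝ) ^ _), ← Real.rpow_mul (by positivity)]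
      congr 2; push_cast; ring

lemma final_aux :
    (∀ D : ℕ, 0 < D → (RD D).Finite) ∧
      ∀ ε : ℝ, 0 < ε → ∃ C : ℝ, 0 < C ∧
        (∀ D : ℕ, 0 < D → ((RD D).ncard : ℝ) ≤ C * (D : ℝ) ^ ((1 : ℝ) + ε)) ∧
        (∀ D : ℕ, 0 < D → D % 16 ∉ ({0, 7, 12, 15} : Set ℕ) →
          C⁻¹ * (D : ℝ) ^ ((1 : ℝ) - ε) ≤ ((RD D).ncard : ℝ)) := by
  constructor
  · intro D hD
    obtain ⟨C, _, h⟩ := S3_bound (ε := 1) one_pos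
    exact (RD_upper (h D hD.ne').1).1
  · intro ε hε
    obtain ⟨C, hC, hU⟩ := upper_final hε
    obtain ⟨c, hc, hL⟩ := lower_final (ε := min ε 1) (by positivity) (min_le_right _ _)
    refine ⟨max C c⁻¹, by positivity, fun D hD => (hU D hD).trans ?_, fun D hD hD16 => le_trans ?_ (hL D hD hD16)⟩
    · gcongr
      exact le_max_left _ _
    · have hD1 : (1 : ℝ) ≤ D := by exact_mod_cast hD
      have : (max C c⁻¹)⁻¹ ≤ c := by
        rw [inv_le_comm₀ (by positivity) hc]
        exact le_max_right _ _
      have h2 : (D : ℝ) ^ (1 - ε) ≤ (D : ℝ) ^ (1 - min ε 1) :=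
        Real.rpow_le_rpow_of_exponent_le hD1 (by linarith [min_le_left ε 1])
      exact mul_le_mul this h2 (by positivity) hc.le

end

/-- For every positive integer `D` the set `𝓡_D` is finite; moreover for
every `ε > 0` there is a constant `C > 0` with `|𝓡_D| ≤ C·D^(1+ε)` for all `D > 0`, and
`|𝓡_D| ≥ C⁻¹·D^(1-ε)` for all `D > 0` with `D mod 16 ∉ {0, 7, 12, 15}`. -/
theorem stmt_11 :
    (∀ D : ℕ, 0 < D → (RD D).Finite) ∧
      ∀ ε : ℝ, 0 < ε → ∃ C : ℝ, 0 < C ∧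
        (∀ D : ℕ, 0 < D → ((RD D).ncard : ℝ) ≤ C * (D : ℝ) ^ ((1 : ℝ) + ε)) ∧
        (∀ D : ℕ, 0 < D → D % 16 ∉ ({0, 7, 12, 15} : Set ℕ) →
          C⁻¹ * (D : ℝ) ^ ((1 : ℝ) - ε) ≤ ((RD D).ncard : ℝ)) := by
  exact final_aux
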